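/- The all-term-instance termination problem of equality saturation — given a finite signature Σ and a finite term rewriting system R over Σ, decide whether EqSat(R, t) terminates for every ground term t ∈ T(Σ) — is Π2-complete in the arithmetical hierarchy: it is expressible by a ∀∃-sentence over a decidable matrix, and the universal halting problem for Turing machines (does a given machine halt on every input?) many-one reduces to it. -/

import Mathlib

set_option autoImplicit false

/-! ## Terms over a signature -/

inductive Tm (F : Type) (ar : F → ℕ) (V : Type) : Type where
  | var : V → Tm F ar V
  | node : (f : F) → (Fin (ar f) → Tm F ar V) → Tm F ar V

namespace Tm

variable {F : Type} {ar : F → ℕ} {V W : Type}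

/-- Apply a renaming of variables/states. -/
def map (σ : V → W) : Tm F ar V → Tm F ar W
  | .var v => .var (σ v)
  | .node f ts => .node f fun i => (ts i).map σ

/-- Apply a substitution. -/
def subst (σ : V → Tm F ar W) : Tm F ar V → Tm F ar W
  | .var v => σ v
  | .node f ts => .node f fun i => (ts i).subst σ

/-- The set of variables occurring in a pattern. -/
def vars : Tm F ar V → Set V
  | .var v => {v}
  | .node _ ts => ⋃ i, (ts i).vars

end Tm

/-- Ground terms: terms with no variables. -/
abbrev GTm (F : Type) (ar : F → ℕ) : Type := Tm F ar Empty

/-- A ground term viewed as a term over `Σ ∪ V`. -/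
def GTm.embed {F : Type} {ar : F → ℕ} {V : Type} (t : GTm F ar) : Tm F ar V :=
  Tm.map (fun e => e.elim) t

/-- The (reflexive) subterm relation. -/
inductive Subterm {F : Type} {ar : F → ℕ} {V : Type} : Tm F ar V → Tm F ar V → Prop where
  | refl (t : Tm F ar V) : Subterm t t
  | node {u : Tm F ar V} {f : F} {ts : Fin (ar f) → Tm F ar V} (i : Fin (ar f)) :
      Subterm u (ts i) → Subterm u (.node f ts)

theorem Subterm.trans' {F : Type} {ar : F → ℕ} {V : Type} {a b c : Tm F ar V}
    (h1 : Subterm a b) (h2 : Subterm b c) : Subterm a c := by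
  induction h2 with
  | refl => exact h1
  | node i _ ih => exact Subterm.node i ih

theorem Subterm.child {F : Type} {ar : F → ℕ} {V : Type} {f : F}
    {ts : Fin (ar f) → Tm F ar V} {c : Tm F ar V} (i : Fin (ar f))
    (h : Subterm (.node f ts) c) : Subterm (ts i) c :=
  Subterm.trans' (Subterm.node i (Subterm.refl _)) h

/-! ## Tree automata and E-graphs -/

/-- A (bottom-up, possibly infinite) tree automaton: a set of states together with
transitions `f(q₁,…,qₖ) → q`. -/
structure Automaton (F : Type) (ar : F → ℕ) : Type 1 where
  Q : Type
  trans : (f : F) → Set ((Fin (ar f) → Q) × Q)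

/-- `Accepts A t q` formalizes `t →*_A q`: the term `t ∈ T(Σ ∪ Q)` rewrites to the state `q`. -/
inductive Accepts {F : Type} {ar : F → ℕ} (A : Automaton F ar) : Tm F ar A.Q → A.Q → Prop where
  | var (q : A.Q) : Accepts A (.var q) q
  | node {f : F} {ts : Fin (ar f) → Tm F ar A.Q} {qs : Fin (ar f) → A.Q} {q : A.Q} :
      (∀ i, Accepts A (ts i) (qs i)) → (qs, q) ∈ A.trans f → Accepts A (.node f ts) q

/-- A ground term `t ∈ T(Σ)` is accepted by the state `q`, i.e. `t →*_A q`. -/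
def Automaton.AcceptsG {F : Type} {ar : F → ℕ} (A : Automaton F ar) (t : GTm F ar) (q : A.Q) : Prop :=
  Accepts A (GTm.embed t) q

/-- Deterministic: every ground term is accepted by at most one state. -/
def Automaton.Deterministic {F : Type} {ar : F → ℕ} (A : Automaton F ar) : Prop :=
  ∀ (t : GTm F ar) (q1 q2 : A.Q), A.AcceptsG t q1 → A.AcceptsG t q2 → q1 = q2

/-- Reachable: every state accepts some ground term. -/
def Automaton.ReachableA {F : Type} {ar : F → ℕ} (A : Automaton F ar) : Prop :=
  ∀ q : A.Q, ∃ t : GTm F ar, A.AcceptsG t q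

/-- An E-graph is a deterministic and reachable tree automaton. -/
structure EGraph (F : Type) (ar : F → ℕ) extends Automaton F ar where
  det : toAutomaton.Deterministic
  reach : toAutomaton.ReachableA

/-- A homomorphism of tree automata: maps states to states, preserving all transitions. -/
structure AHom {F : Type} {ar : F → ℕ} (A B : Automaton F ar) : Type where
  toFun : A.Q → B.Q
  map_trans : ∀ (f : F) (qs : Fin (ar f) → A.Q) (q : A.Q),
    (qs, q) ∈ A.trans f → (fun i => toFun (qs i), toFun q) ∈ B.trans f

/-- `A ⊑ B` : there exists a homomorphism from `A` to `B`. -/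
def ALe {F : Type} {ar : F → ℕ} (A B : Automaton F ar) : Prop := Nonempty (AHom A B)

def EGraph.Le {F : Type} {ar : F → ℕ} (G H : EGraph F ar) : Prop :=
  ALe G.toAutomaton H.toAutomaton

/-- Isomorphism of E-graphs: mutually inverse homomorphisms. -/
def EGraph.Iso {F : Type} {ar : F → ℕ} (G H : EGraph F ar) : Prop :=
  ∃ (h : AHom G.toAutomaton H.toAutomaton) (h' : AHom H.toAutomaton G.toAutomaton),
    (∀ q, h'.toFun (h.toFun q) = q) ∧ (∀ q, h.toFun (h'.toFun q) = q)

/-- The partial congruence relation `≈_G` induced by an E-graph: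
two ground terms are related iff some state accepts both. -/
def EGraph.eqv {F : Type} {ar : F → ℕ} (G : EGraph F ar) (t1 t2 : GTm F ar) : Prop :=
  ∃ q : G.Q, G.toAutomaton.AcceptsG t1 q ∧ G.toAutomaton.AcceptsG t2 q

/-- A finite E-graph: finitely many states and transitions. -/
def EGraph.IsFinite {F : Type} {ar : F → ℕ} (G : EGraph F ar) : Prop :=
  Finite G.Q ∧ ∀ f : F, (G.trans f).Finite

/-! ## Partial congruence relations -/

/-- A partial congruence relation (PCR) on ground terms: a symmetric, transitive,
congruent and reachable binary relation. -/
structure IsPCR {F : Type} {ar : F → ℕ} (E : GTm F ar → GTm F ar → Prop) : Prop where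
  symm : ∀ {t1 t2 : GTm F ar}, E t1 t2 → E t2 t1
  trans : ∀ {t1 t2 t3 : GTm F ar}, E t1 t2 → E t2 t3 → E t1 t3
  congruent : ∀ (f : F) (s t : Fin (ar f) → GTm F ar),
    (∀ i, E (s i) (t i)) → E (.node f s) (.node f s) → E (.node f s) (.node f t)
  reachable : ∀ (f : F) (s : Fin (ar f) → GTm F ar),
    E (.node f s) (.node f s) → ∀ i, E (s i) (s i)

/-- The join of two PCRs: the smallest PCR containing both. -/
def joinPCR {F : Type} {ar : F → ℕ} (E1 E2 : GTm F ar → GTm F ar → Prop)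
    (a b : GTm F ar) : Prop :=
  ∀ E : GTm F ar → GTm F ar → Prop, IsPCR E →
    (∀ x y, E1 x y → E x y) → (∀ x y, E2 x y → E x y) → E a b

/-! ## Term rewriting systems -/

/-- A term rewriting system: a finite set of rules `lhs → rhs` between patterns
(terms with variables drawn from `ℕ`), with `Var(rhs) ⊆ Var(lhs)`. -/
structure TRS (F : Type) (ar : F → ℕ) where
  rules : Set (Tm F ar ℕ × Tm F ar ℕ)
  finite : rules.Finite
  var_cond : ∀ r ∈ rules, Tm.vars r.2 ⊆ Tm.vars r.1

/-- The ground rewrite relation `→_R` determined by a TRS. -/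
inductive RWStep {F : Type} {ar : F → ℕ} (R : TRS F ar) : GTm F ar → GTm F ar → Prop where
  | rule {l r : Tm F ar ℕ} (h : (l, r) ∈ R.rules) (σ : ℕ → GTm F ar) :
      RWStep R (l.subst σ) (r.subst σ)
  | congr {f : F} {ts : Fin (ar f) → GTm F ar} {i : Fin (ar f)} {u : GTm F ar} :
      RWStep R (ts i) u → RWStep R (.node f ts) (.node f (Function.update ts i u))

/-- `≈_R` : the reflexive-symmetric-transitive closure of `→_R`. -/
def TRSEqv {F : Type} {ar : F → ℕ} (R : TRS F ar) : GTm F ar → GTm F ar → Prop :=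
  Relation.ReflTransGen fun a b => RWStep R a b ∨ RWStep R b a

/-! ## E-matching, insertion and congruence closure -/

/-- An e-match of a rule in an E-graph: a substitution `σ` into E-classes and a root
E-class `c` with `lhs[σ] →*_G c`. -/
structure EMatch {F : Type} {ar : F → ℕ} (R : TRS F ar) (G : EGraph F ar) : Type where
  lhs : Tm F ar ℕ
  rhs : Tm F ar ℕ
  mem : (lhs, rhs) ∈ R.rules
  sub : ℕ → G.Q
  root : G.Q
  acc : Accepts G.toAutomaton (Tm.map sub lhs) root

/-- Fresh states of the flattenings added by the match/apply operator: one state per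
(match, subterm of the instantiated right-hand side). -/
def MExtra {F : Type} {ar : F → ℕ} (R : TRS F ar) (G : EGraph F ar) : Type :=
  { p : EMatch R G × Tm F ar G.Q // Subterm p.2 (Tm.map p.1.sub p.1.rhs) }

open Classical in
/-- The state of the flattening `FL(rhs[σ] →* c)` associated to a subterm `u` of `rhs[σ]`:
states at the leaves are kept, the root is mapped to `c = root`, and all other subterms
get a fresh state. -/
noncomputable def stateOf {F : Type} {ar : F → ℕ} (R : TRS F ar) (G : EGraph F ar)
    (m : EMatch R G) :
    (u : Tm F ar G.Q) → Subterm u (Tm.map m.sub m.rhs) → G.Q ⊕ MExtra R G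
  | .var q, _ => Sum.inl q
  | .node f ts, h =>
      if Tm.node f ts = Tm.map m.sub m.rhs then Sum.inl m.root
      else Sum.inr ⟨(m, Tm.node f ts), h⟩

/-- The match/apply operator `T_R`: the (possibly non-deterministic) tree automaton
obtained from `G` by inserting the flattening `FL(rhs[σ] →* c)` for every e-match. -/
noncomputable def TRaut {F : Type} {ar : F → ℕ} (R : TRS F ar) (G : EGraph F ar) :
    Automaton F ar where
  Q := G.Q ⊕ MExtra R G
  trans f := { p |
    (∃ (qs : Fin (ar f) → G.Q) (q : G.Q), (qs, q) ∈ G.trans f ∧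
      p = (fun i => Sum.inl (qs i), Sum.inl q)) ∨
    (∃ (m : EMatch R G) (ts : Fin (ar f) → Tm F ar G.Q)
        (h : Subterm (.node f ts) (Tm.map m.sub m.rhs)),
      p = (fun i => stateOf R G m (ts i) (Subterm.child i h),
           stateOf R G m (.node f ts) h)) }

/-- `G` is the congruence closure (rebuilding) of the automaton `A`: the ⊑-least E-graph
above `A`. -/
def IsCC {F : Type} {ar : F → ℕ} (A : Automaton F ar) (G : EGraph F ar) : Prop :=
  ALe A G.toAutomaton ∧ ∀ H : EGraph F ar, ALe A H.toAutomaton → EGraph.Le G H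

/-- `H` is (up to isomorphism) the result of the immediate consequence operator
`ICO_R = CC ∘ T_R` applied to `G`. -/
def IsICO {F : Type} {ar : F → ℕ} (R : TRS F ar) (G H : EGraph F ar) : Prop :=
  IsCC (TRaut R G) H

/-- `S` is the sequence of iterates `S i = ICO_R^(i)(G)`. -/
def IterSeq {F : Type} {ar : F → ℕ} (R : TRS F ar) (G : EGraph F ar)
    (S : ℕ → EGraph F ar) : Prop :=
  S 0 = G ∧ ∀ i, IsICO R (S i) (S (i + 1))

/-- `H` is a least upper bound of the sequence `S` of E-graphs. -/
def IsLUBseq {F : Type} {ar : F → ℕ} (S : ℕ → EGraph F ar) (H : EGraph F ar) : Prop :=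
  (∀ i, (S i).Le H) ∧ ∀ H' : EGraph F ar, (∀ i, (S i).Le H') → H.Le H'

/-- `H` is a least upper bound of the family `Gs` of E-graphs. -/
def IsLUBfam {F : Type} {ar : F → ℕ} {I : Type} (Gs : I → EGraph F ar)
    (H : EGraph F ar) : Prop :=
  (∀ i, (Gs i).Le H) ∧ ∀ H' : EGraph F ar, (∀ i, (Gs i).Le H') → H.Le H'

/-- `H = EqSat(R, G) = ⊔_{i ≥ 0} ICO_R^(i)(G)`. -/
def IsEqSat {F : Type} {ar : F → ℕ} (R : TRS F ar) (G H : EGraph F ar) : Prop :=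
  ∃ S : ℕ → EGraph F ar, IterSeq R G S ∧ IsLUBseq S H

/-- `H` is a model of the TRS `R`. -/
def ModelTRS {F : Type} {ar : F → ℕ} (R : TRS F ar) (H : EGraph F ar) : Prop :=
  ∀ r ∈ R.rules, ∀ (σ : ℕ → H.Q) (c : H.Q),
    Accepts H.toAutomaton (Tm.map σ r.1) c → Accepts H.toAutomaton (Tm.map σ r.2) c

/-- `H` is a model of the pair `(R, G)`. -/
def IsModelOf {F : Type} {ar : F → ℕ} (R : TRS F ar) (G H : EGraph F ar) : Prop :=
  G.Le H ∧ ModelTRS R H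

/-- `H` is a universal model of the pair `(R, G)`. -/
def IsUniversalModel {F : Type} {ar : F → ℕ} (R : TRS F ar) (G H : EGraph F ar) : Prop :=
  IsModelOf R G H ∧ ∀ H' : EGraph F ar, IsModelOf R G H' → H.Le H'

/-- `G` is (up to isomorphism) the flattening `FL(t →* c)` of a ground term `t`:
the ⊑-least E-graph representing `t`. -/
def IsTermEG {F : Type} {ar : F → ℕ} (t : GTm F ar) (G : EGraph F ar) : Prop :=
  (∃ c, G.toAutomaton.AcceptsG t c) ∧
  ∀ H : EGraph F ar, (∃ c, H.toAutomaton.AcceptsG t c) → G.Le H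

/-- Equality saturation terminates on `(R, G)`: the sequence of iterates
`ICO_R^(i)(G)` is eventually constant up to isomorphism. -/
def EqSatTerminates {F : Type} {ar : F → ℕ} (R : TRS F ar) (G : EGraph F ar) : Prop :=
  ∃ S : ℕ → EGraph F ar, IterSeq R G S ∧ ∃ n, ∀ m, n ≤ m → (S m).Iso (S n)

/-! ## A structural Gödel encoding of EqSat problem instances -/

/-- The branching shape of terms, for the `WType` encoding. -/
def TmShape (n : ℕ) (ar : Fin n → ℕ) (V : Type) : Fin n ⊕ V → Type
  | Sum.inl f => Fin (ar f)
  | Sum.inr _ => Empty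

instance (n : ℕ) (ar : Fin n → ℕ) (V : Type) (x : Fin n ⊕ V) : Fintype (TmShape n ar V x) := by
  cases x with
  | inl f => exact inferInstanceAs (Fintype (Fin _))
  | inr v => exact inferInstanceAs (Fintype Empty)

instance (n : ℕ) (ar : Fin n → ℕ) (V : Type) (x : Fin n ⊕ V) : Encodable (TmShape n ar V x) := by
  cases x with
  | inl f => exact inferInstanceAs (Encodable (Fin _))
  | inr v => exact inferInstanceAs (Encodable Empty)

def Tm.toW {n : ℕ} {ar : Fin n → ℕ} {V : Type} : Tm (Fin n) ar V → WType (TmShape n ar V)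
  | .var v => ⟨Sum.inr v, fun e => nomatch e⟩
  | .node f ts => ⟨Sum.inl f, fun i => (ts i).toW⟩

def Tm.ofW {n : ℕ} {ar : Fin n → ℕ} {V : Type} : WType (TmShape n ar V) → Tm (Fin n) ar V
  | ⟨Sum.inl f, c⟩ => .node f fun i => Tm.ofW (c i)
  | ⟨Sum.inr v, _⟩ => .var v

theorem Tm.ofW_toW {n : ℕ} {ar : Fin n → ℕ} {V : Type} :
    ∀ t : Tm (Fin n) ar V, Tm.ofW (Tm.toW t) = t
  | .var v => rfl
  | .node f ts => by
      simp only [Tm.toW, Tm.ofW]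
      exact congrArg (Tm.node f) (funext fun i => Tm.ofW_toW (ts i))

theorem Tm.toW_ofW {n : ℕ} {ar : Fin n → ℕ} {V : Type} :
    ∀ w : WType (TmShape n ar V), Tm.toW (Tm.ofW w) = w
  | ⟨Sum.inl f, c⟩ => by
      simp only [Tm.ofW, Tm.toW]
      exact congrArg (WType.mk (Sum.inl f)) (funext fun i => Tm.toW_ofW (c i))
  | ⟨Sum.inr v, c⟩ => by
      simp only [Tm.ofW, Tm.toW]
      exact congrArg (WType.mk (Sum.inr v)) (funext fun e => nomatch e)

/-- Terms over the signature `Fin n` are equivalent to a W-type. -/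
def tmEquivW (n : ℕ) (ar : Fin n → ℕ) (V : Type) : Tm (Fin n) ar V ≃ WType (TmShape n ar V) where
  toFun := Tm.toW
  invFun := Tm.ofW
  left_inv := Tm.ofW_toW
  right_inv := Tm.toW_ofW

/-- A structural Gödel encoding of terms. -/
instance (n : ℕ) (ar : Fin n → ℕ) (V : Type) [Encodable V] : Encodable (Tm (Fin n) ar V) :=
  Encodable.ofEquiv _ (tmEquivW n ar V)




/-- A problem instance of the all-term-instance termination problem: a finite signature
(given by the number `n` of symbols and their arities) and a finite list of rewrite
rules. -/
abbrev TRSInstance : Type :=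
  Σ n : ℕ, Σ ar : Fin n → ℕ, List (Tm (Fin n) ar ℕ × Tm (Fin n) ar ℕ)

/-- The given instance determines a well-formed TRS on which equality saturation
terminates when started from (the flattening of) every ground term. -/
def AllTermTerminates (inst : TRSInstance) : Prop :=
  ∃ R : TRS (Fin inst.1) inst.2.1, R.rules = { r | r ∈ inst.2.2 } ∧
    ∀ t : GTm (Fin inst.1) inst.2.1,
      ∃ G0 : EGraph (Fin inst.1) inst.2.1, IsTermEG t G0 ∧ EqSatTerminates R G0

section EGraphTheory

variable {F : Type} {ar : F → ℕ}

theorem Automaton.acceptsG_node {A : Automaton F ar} {f : F} {ts : Fin (ar f) → GTm F ar} {q : A.Q} :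
    A.AcceptsG (.node f ts) q ↔
      ∃ qs : Fin (ar f) → A.Q, (∀ i, A.AcceptsG (ts i) (qs i)) ∧ (qs, q) ∈ A.trans f := by
  constructor
  · intro h
    unfold Automaton.AcceptsG GTm.embed at h
    rw [Tm.map] at h
    cases h with
    | node h1 h2 => exact ⟨_, h1, h2⟩
  · rintro ⟨qs, h1, h2⟩
    exact Accepts.node h1 h2

theorem AHom.acceptsG {A B : Automaton F ar} (h : AHom A B) {t : GTm F ar} :
    ∀ {q : A.Q}, A.AcceptsG t q → B.AcceptsG t (h.toFun q) := by
  induction t with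
  | var e => exact e.elim
  | node f ts ih =>
    intro q hq
    obtain ⟨qs, h1, h2⟩ := Automaton.acceptsG_node.1 hq
    exact Automaton.acceptsG_node.2 ⟨_, fun i => ih i (h1 i), h.map_trans _ _ _ h2⟩

theorem EGraph.eqv_isPCR (G : EGraph F ar) : IsPCR G.eqv where
  symm := fun ⟨q, h1, h2⟩ => ⟨q, h2, h1⟩
  trans := fun {t1 t2 t3} ⟨q, h1, h2⟩ ⟨q', h3, h4⟩ => by
    obtain rfl := G.det _ _ _ h2 h3
    exact ⟨q, h1, h4⟩
  congruent := fun f s t h ⟨q, h1, _⟩ => by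
    obtain ⟨qs, h2, h3⟩ := Automaton.acceptsG_node.1 h1
    refine ⟨q, h1, Automaton.acceptsG_node.2 ⟨qs, fun i => ?_, h3⟩⟩
    obtain ⟨q', h4, h5⟩ := h i
    rwa [G.det _ _ _ (h2 i) h4]
  reachable := fun f s ⟨q, h1, _⟩ i => by
    obtain ⟨qs, h2, h3⟩ := Automaton.acceptsG_node.1 h1
    exact ⟨qs i, h2 i, h2 i⟩

/-- The least partial congruence relation containing a relation. -/
inductive PCRGen (B : GTm F ar → GTm F ar → Prop) : GTm F ar → GTm F ar → Prop
  | base {a b} : B a b → PCRGen B a b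
  | symm {a b} : PCRGen B a b → PCRGen B b a
  | trans {a b c} : PCRGen B a b → PCRGen B b c → PCRGen B a c
  | congr {f} {s t : Fin (ar f) → GTm F ar} : (∀ i, PCRGen B (s i) (t i)) →
      PCRGen B (.node f s) (.node f s) → PCRGen B (.node f s) (.node f t)
  | reach {f} {s : Fin (ar f) → GTm F ar} (i : Fin (ar f)) :
      PCRGen B (.node f s) (.node f s) → PCRGen B (s i) (s i)

theorem PCRGen.isPCR (B : GTm F ar → GTm F ar → Prop) : IsPCR (PCRGen B) where
  symm := .symm
  trans := .trans
  congruent := fun _ _ _ => .congr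
  reachable := fun _ _ h i => .reach i h

theorem PCRGen.le {B E : GTm F ar → GTm F ar → Prop} (hE : IsPCR E) (h : ∀ a b, B a b → E a b)
    {a b : GTm F ar} (hab : PCRGen B a b) : E a b := by
  induction hab with
  | base h' => exact h _ _ h'
  | symm _ ih => exact hE.symm ih
  | trans _ _ ih1 ih2 => exact hE.trans ih1 ih2
  | congr _ _ ih1 ih2 => exact hE.congruent _ _ _ ih1 ih2
  | reach i _ ih => exact hE.reachable _ _ ih i

section OfPCR

variable {E : GTm F ar → GTm F ar → Prop}

theorem IsPCR.left (hE : IsPCR E) {a b : GTm F ar} (h : E a b) : E a a := hE.trans h (hE.symm h)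

theorem IsPCR.right (hE : IsPCR E) {a b : GTm F ar} (h : E a b) : E b b := hE.trans (hE.symm h) h

variable (hE : IsPCR E)

/-- The setoid of a partial congruence relation on its domain. -/
def IsPCR.setoid : Setoid {a : GTm F ar // E a a} where
  r a b := E a.1 b.1
  iseqv := ⟨fun a => a.2, fun h => hE.symm h, hE.trans⟩

/-- The automaton whose states are the classes of a partial congruence relation. -/
def IsPCR.automaton : Automaton F ar where
  Q := Quotient hE.setoid
  trans f := { p | ∃ (s : Fin (ar f) → GTm F ar) (h : E (.node f s) (.node f s)),
    p = (fun i => Quotient.mk hE.setoid ⟨s i, hE.reachable f s h i⟩,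
      Quotient.mk hE.setoid ⟨.node f s, h⟩) }

/-- The class of a term in the domain, as a state. -/
def IsPCR.cls (a : GTm F ar) (h : E a a) : hE.automaton.Q := Quotient.mk hE.setoid ⟨a, h⟩

theorem IsPCR.acceptsG_iff (b : GTm F ar) : ∀ (a : GTm F ar) (ha : E a a),
    hE.automaton.AcceptsG b (hE.cls a ha) ↔ E b a := by
  induction b with
  | var e => exact e.elim
  | node f ts ih =>
    intro a ha
    rw [Automaton.acceptsG_node]
    constructor
    · rintro ⟨qs, h1, s, h2, h3⟩
      obtain ⟨rfl, h4⟩ := Prod.mk.inj h3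
      have h5 : E a (.node f s) := Quotient.exact h4
      have h6 : ∀ i, E (s i) (ts i) := fun i =>
        hE.symm ((ih i (s i) (hE.reachable f s h2 i)).1 (h1 i))
      exact hE.symm (hE.trans h5 (hE.congruent _ _ _ h6 h2))
    · intro h
      have h2 := hE.left h
      refine ⟨_, fun i => (ih i (ts i) (hE.reachable f ts h2 i)).2 (hE.reachable f ts h2 i), ts, h2, ?_⟩
      exact Prod.ext rfl (Quotient.sound (hE.symm h))

/-- The E-graph of a partial congruence relation. -/
def IsPCR.egraph : EGraph F ar where
  toAutomaton := hE.automaton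
  det := by
    intro t q1 q2
    refine Quotient.inductionOn₂ q1 q2 fun ⟨a, ha⟩ ⟨b, hb⟩ h1 h2 => ?_
    exact Quotient.sound (hE.trans (hE.symm ((hE.acceptsG_iff _ _ ha).1 h1)) ((hE.acceptsG_iff _ _ hb).1 h2))
  reach := by
    intro q
    refine Quotient.inductionOn q fun a => ⟨a.1, (hE.acceptsG_iff _ _ a.2).2 a.2⟩

theorem IsPCR.eqv_egraph (a b : GTm F ar) : hE.egraph.eqv a b ↔ E a b := by
  constructor
  · rintro ⟨q, h1, h2⟩
    revert h1 h2
    refine Quotient.inductionOn q fun ⟨c, hc⟩ h1 h2 => ?_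
    exact hE.trans ((hE.acceptsG_iff _ _ hc).1 h1) (hE.symm ((hE.acceptsG_iff _ _ hc).1 h2))
  · intro h
    exact ⟨hE.cls b (hE.right h), (hE.acceptsG_iff _ _ _).2 h, (hE.acceptsG_iff _ _ _).2 (hE.right h)⟩

end OfPCR

theorem EGraph.eqv_self_iff {G : EGraph F ar} {t : GTm F ar} :
    G.eqv t t ↔ ∃ q, G.toAutomaton.AcceptsG t q :=
  ⟨fun ⟨q, h, _⟩ => ⟨q, h⟩, fun ⟨q, h⟩ => ⟨q, h, h⟩⟩

/-- A map of states that follows witness terms is a homomorphism into an E-graph. -/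
theorem EGraph.exists_hom (A : Automaton F ar) (H : EGraph F ar) (tm : A.Q → GTm F ar)
    (hdom : ∀ q, H.eqv (tm q) (tm q))
    (htrans : ∀ f (qs : Fin (ar f) → A.Q) q, (qs, q) ∈ A.trans f →
      H.eqv (.node f fun i => tm (qs i)) (tm q)) :
    ∃ h : AHom A H.toAutomaton, ∀ q, H.toAutomaton.AcceptsG (tm q) (h.toFun q) := by
  choose φ hφ using fun q => EGraph.eqv_self_iff.1 (hdom q)
  refine ⟨⟨φ, fun f qs q h => ?_⟩, hφ⟩
  obtain ⟨q', h1, h2⟩ := htrans f qs q h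
  obtain rfl := H.det _ _ _ (hφ q) h2
  obtain ⟨qs', h3, h4⟩ := Automaton.acceptsG_node.1 h1
  have : qs' = fun i => φ (qs i) := funext fun i => H.det _ _ _ (h3 i) (hφ (qs i))
  rwa [← this]

theorem EGraph.le_iff {G H : EGraph F ar} : G.Le H ↔ ∀ a b, G.eqv a b → H.eqv a b := by
  constructor
  · rintro ⟨h⟩ a b ⟨q, h1, h2⟩
    exact ⟨_, h.acceptsG h1, h.acceptsG h2⟩
  · intro hGH
    choose tm htm using G.reach
    obtain ⟨h, -⟩ := EGraph.exists_hom G.toAutomaton H tm (fun q => hGH _ _ ⟨q, htm q, htm q⟩)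
      fun f qs q hq => hGH _ _ ⟨q, Automaton.acceptsG_node.2 ⟨qs, fun i => htm _, hq⟩, htm q⟩
    exact ⟨h⟩

theorem EGraph.iso_iff {G H : EGraph F ar} : G.Iso H ↔ ∀ a b, G.eqv a b ↔ H.eqv a b := by
  constructor
  · rintro ⟨h, h', -, -⟩ a b
    exact ⟨EGraph.le_iff.1 ⟨h⟩ a b, EGraph.le_iff.1 ⟨h'⟩ a b⟩
  · intro hGH
    obtain ⟨h⟩ := EGraph.le_iff.2 fun a b => (hGH a b).1
    obtain ⟨h'⟩ := EGraph.le_iff.2 fun a b => (hGH a b).2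
    refine ⟨h, h', fun q => ?_, fun q => ?_⟩
    · obtain ⟨t, ht⟩ := G.reach q
      exact G.det _ _ _ (h'.acceptsG (h.acceptsG ht)) ht
    · obtain ⟨t, ht⟩ := H.reach q
      exact H.det _ _ _ (h.acceptsG (h'.acceptsG ht)) ht

/-- Instances of the rules with non-variable right-hand side whose left-hand side is represented. -/
inductive RuleInst (R : Set (Tm F ar ℕ × Tm F ar ℕ)) (E : GTm F ar → GTm F ar → Prop) :
    GTm F ar → GTm F ar → Prop
  | mk {l : Tm F ar ℕ} {f : F} {ts : Fin (ar f) → Tm F ar ℕ} (h : (l, Tm.node f ts) ∈ R) (σ : ℕ → GTm F ar)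
      (hl : E (l.subst σ) (l.subst σ)) : RuleInst R E (l.subst σ) ((Tm.node f ts).subst σ)

theorem Tm.subst_map {V W X : Type} (t : Tm F ar V) (σ : V → W) (τ : W → Tm F ar X) :
    (t.map σ).subst τ = t.subst (fun v => τ (σ v)) := by
  induction t with
  | var v => rfl
  | node f ts ih => exact congrArg (Tm.node f) (funext fun i => ih i)

theorem Accepts.acceptsG_subst {A : Automaton F ar} {t : Tm F ar A.Q} {q : A.Q} (h : Accepts A t q)
    (tm : A.Q → GTm F ar) (htm : ∀ q, A.AcceptsG (tm q) q) : A.AcceptsG (t.subst tm) q := by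
  induction h with
  | var q => exact htm q
  | node _ h2 ih => exact Automaton.acceptsG_node.2 ⟨_, ih, h2⟩

theorem Subterm.subst_dom {V : Type} {E : GTm F ar → GTm F ar → Prop} (hE : IsPCR E) {u v : Tm F ar V}
    (h : Subterm u v) (σ : V → GTm F ar) (hv : E (v.subst σ) (v.subst σ)) : E (u.subst σ) (u.subst σ) := by
  induction h with
  | refl => exact hv
  | node i _ ih => exact ih (hE.reachable _ _ hv i)

theorem TRaut_le {R : TRS F ar} {G H : EGraph F ar} (h1 : ∀ a b, G.eqv a b → H.eqv a b)
    (h2 : ∀ a b, RuleInst R.rules G.eqv a b → H.eqv a b) : ALe (TRaut R G) H.toAutomaton := by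
  choose tm htm using G.reach
  have hG : ∀ m : EMatch R G, G.eqv (tm m.root) ((m.lhs.map m.sub).subst tm) := fun m =>
    ⟨m.root, htm _, m.acc.acceptsG_subst tm htm⟩
  have hR : ∀ m : EMatch R G, (∃ q, m.rhs.map m.sub = .var q) ∨
      H.eqv (tm m.root) ((m.rhs.map m.sub).subst tm) := by
    rintro ⟨l, r, mem, sub, root, acc⟩
    cases r with
    | var v => exact Or.inl ⟨_, rfl⟩
    | node f ts =>
      have hg := hG ⟨l, _, mem, sub, root, acc⟩
      refine Or.inr (H.eqv_isPCR.trans (h1 _ _ hg) ?_)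
      dsimp only at hg ⊢
      rw [Tm.subst_map] at hg ⊢
      rw [Tm.subst_map]
      exact h2 _ _ (RuleInst.mk mem _ (G.eqv_isPCR.right hg))
  let φ : (TRaut R G).Q → GTm F ar := Sum.elim tm fun e => e.1.2.subst tm
  have hdom : ∀ q, H.eqv (φ q) (φ q) := by
    rintro (q | ⟨⟨m, u⟩, hu⟩)
    · exact h1 _ _ ⟨q, htm q, htm q⟩
    · show H.eqv (u.subst tm) (u.subst tm)
      refine Subterm.subst_dom H.eqv_isPCR hu tm ?_
      dsimp only
      rcases hR m with ⟨q, hq⟩ | h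
      · rw [hq]
        exact h1 _ _ ⟨q, htm q, htm q⟩
      · exact H.eqv_isPCR.right h
  have hst : ∀ (m : EMatch R G) (u : Tm F ar G.Q) (hu : Subterm u (m.rhs.map m.sub)),
      H.eqv (u.subst tm) (φ (stateOf R G m u hu)) := by
    rintro m (q | ⟨f, ts⟩) hu
    · exact h1 _ _ ⟨q, htm q, htm q⟩
    · unfold stateOf
      dsimp only
      split_ifs with h
      · rcases hR m with ⟨q, hq⟩ | h'
        · rw [hq] at h
          cases h
        · rw [h]
          exact H.eqv_isPCR.symm h'
      · exact hdom (Sum.inr ⟨(m, Tm.node f ts), hu⟩)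
  refine (EGraph.exists_hom (TRaut R G) H φ hdom ?_).elim fun h _ => ⟨h⟩
  · rintro f qs q (⟨qs', q', h, he⟩ | ⟨m, ts, h, he⟩)
    · obtain ⟨rfl, rfl⟩ := Prod.mk.inj he
      exact h1 _ _ ⟨q', Automaton.acceptsG_node.2 ⟨qs', fun i => htm _, h⟩, htm q'⟩
    · obtain ⟨rfl, rfl⟩ := Prod.mk.inj he
      have h3 := hst m _ h
      exact H.eqv_isPCR.trans (H.eqv_isPCR.symm (H.eqv_isPCR.congruent f (fun i => (ts i).subst tm) _
        (fun i => hst m (ts i) (Subterm.child i h)) (H.eqv_isPCR.left h3))) h3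

theorem accepts_of_subst {G : EGraph F ar} (σ : ℕ → GTm F ar) (sub : ℕ → G.Q)
    (hsub : ∀ x q, G.toAutomaton.AcceptsG (σ x) q → sub x = q) (l : Tm F ar ℕ) :
    ∀ {c : G.Q}, G.toAutomaton.AcceptsG (l.subst σ) c → Accepts G.toAutomaton (l.map sub) c ∧
      ∀ x ∈ l.vars, G.toAutomaton.AcceptsG (σ x) (sub x) := by
  induction l with
  | var x =>
    intro c h
    have := hsub x c h
    subst this
    refine ⟨.var _, ?_⟩
    rintro y rfl
    exact h
  | node f ts ih =>
    intro c h
    obtain ⟨qs, h1, h2⟩ := Automaton.acceptsG_node.1 h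
    refine ⟨.node (fun i => (ih i (h1 i)).1) h2, fun x hx => ?_⟩
    obtain ⟨i, hi⟩ := Set.mem_iUnion.1 hx
    exact (ih i (h1 i)).2 x hi

theorem le_of_TRaut_le {R : TRS F ar} {G H : EGraph F ar} (h : ALe (TRaut R G) H.toAutomaton) :
    (∀ a b, G.eqv a b → H.eqv a b) ∧ ∀ a b, RuleInst R.rules G.eqv a b → H.eqv a b := by
  classical
  obtain ⟨h⟩ := h
  let i : AHom G.toAutomaton (TRaut R G) := ⟨Sum.inl, fun f qs q hq => Or.inl ⟨qs, q, hq, rfl⟩⟩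
  refine ⟨fun a b ⟨q, h1, h2⟩ => ⟨_, h.acceptsG (i.acceptsG h1), h.acceptsG (i.acceptsG h2)⟩, ?_⟩
  rintro _ _ ⟨hr, σ, c, hc, -⟩
  rename_i l f ts
  let sub : ℕ → G.Q := fun x => if hx : ∃ q, G.toAutomaton.AcceptsG (σ x) q then hx.choose else c
  have hsub : ∀ x q, G.toAutomaton.AcceptsG (σ x) q → sub x = q := by
    intro x q hq
    have hx : ∃ q, G.toAutomaton.AcceptsG (σ x) q := ⟨q, hq⟩
    simp only [sub, dif_pos hx]
    exact G.det _ _ _ hx.choose_spec hq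
  obtain ⟨hacc, hvars⟩ := accepts_of_subst σ sub hsub l hc
  let m : EMatch R G := ⟨l, _, hr, sub, c, hacc⟩
  have key : ∀ (r : Tm F ar ℕ) (hr : Subterm (r.map sub) (m.rhs.map m.sub)), r.vars ⊆ l.vars →
      (TRaut R G).AcceptsG (r.subst σ) (stateOf R G m (r.map sub) hr) := by
    intro r
    induction r with
    | var x => exact fun _ hv => i.acceptsG (hvars x (hv rfl))
    | node f ts ih =>
      intro hr hv
      refine Automaton.acceptsG_node.2 ⟨_, fun j => ih j (Subterm.child j hr) fun x hx => hv ?_, Or.inr ⟨m, _, hr, rfl⟩⟩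
      exact Set.mem_iUnion.2 ⟨j, hx⟩
  have h2 := key (.node f ts) (Subterm.refl _) (R.var_cond _ hr)
  have h3 : stateOf R G m ((Tm.node f ts).map sub) (Subterm.refl _) = Sum.inl c := by
    simp only [Tm.map, stateOf]
    exact if_pos rfl
  rw [h3] at h2
  exact ⟨_, h.acceptsG (i.acceptsG hc), h.acceptsG h2⟩

end EGraphTheory

section Termination

variable {F : Type} {ar : F → ℕ}

theorem isICO_iff {R : TRS F ar} {G H : EGraph F ar} :
    IsICO R G H ↔ ∀ a b, H.eqv a b ↔
      PCRGen (fun a b => G.eqv a b ∨ RuleInst R.rules G.eqv a b) a b := by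
  set B : GTm F ar → GTm F ar → Prop := fun a b => G.eqv a b ∨ RuleInst R.rules G.eqv a b with hB
  constructor
  · rintro ⟨h1, h2⟩ a b
    obtain ⟨h3, h4⟩ := le_of_TRaut_le h1
    constructor
    · intro h
      have h5 : ALe (TRaut R G) (PCRGen.isPCR B).egraph.toAutomaton :=
        TRaut_le (fun a b h => (IsPCR.eqv_egraph _ _ _).2 (.base (Or.inl h)))
          fun a b h => (IsPCR.eqv_egraph _ _ _).2 (.base (Or.inr h))
      exact (IsPCR.eqv_egraph _ _ _).1 (EGraph.le_iff.1 (h2 _ h5) a b h)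
    · exact PCRGen.le H.eqv_isPCR fun a b h => h.elim (h3 a b) (h4 a b)
  · intro h
    refine ⟨TRaut_le (fun a b h' => (h a b).2 (.base (Or.inl h')))
      fun a b h' => (h a b).2 (.base (Or.inr h')), fun H' hH' => ?_⟩
    obtain ⟨h3, h4⟩ := le_of_TRaut_le hH'
    exact EGraph.le_iff.2 fun a b hab =>
      PCRGen.le H'.eqv_isPCR (fun a b h => h.elim (h3 a b) (h4 a b)) ((h a b).1 hab)

theorem isTermEG_iff {t : GTm F ar} {G : EGraph F ar} :
    IsTermEG t G ↔ ∀ a b, G.eqv a b ↔ PCRGen (fun a b => a = t ∧ b = t) a b := by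
  have key : ∀ H : EGraph F ar, (∃ c, H.toAutomaton.AcceptsG t c) →
      ∀ a b, PCRGen (fun a b => a = t ∧ b = t) a b → H.eqv a b := fun H h a b =>
    PCRGen.le H.eqv_isPCR (by rintro _ _ ⟨rfl, rfl⟩; exact EGraph.eqv_self_iff.2 h)
  constructor
  · rintro ⟨h1, h2⟩ a b
    refine ⟨fun h => ?_, key G h1 a b⟩
    have h3 := h2 (PCRGen.isPCR (fun a b => a = t ∧ b = t)).egraph
      (EGraph.eqv_self_iff.1 ((IsPCR.eqv_egraph _ _ _).2 (.base ⟨rfl, rfl⟩)))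
    exact (IsPCR.eqv_egraph _ _ _).1 (EGraph.le_iff.1 h3 a b h)
  · intro h
    exact ⟨EGraph.eqv_self_iff.1 ((h t t).2 (.base ⟨rfl, rfl⟩)),
      fun H hH => EGraph.le_iff.2 fun a b hab => key H hH a b ((h a b).1 hab)⟩

/-- The partial congruence relations of the iterates of equality saturation. -/
def Stage (R : Set (Tm F ar ℕ × Tm F ar ℕ)) (t : GTm F ar) : ℕ → GTm F ar → GTm F ar → Prop
  | 0 => PCRGen fun a b => a = t ∧ b = t
  | n + 1 => PCRGen fun a b => Stage R t n a b ∨ RuleInst R (Stage R t n) a b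

theorem Stage.isPCR (R : Set (Tm F ar ℕ × Tm F ar ℕ)) (t : GTm F ar) (n : ℕ) : IsPCR (Stage R t n) := by
  cases n <;> exact PCRGen.isPCR _

theorem terminates_iff_stage (R : TRS F ar) (t : GTm F ar) :
    (∃ G0, IsTermEG t G0 ∧ EqSatTerminates R G0) ↔
      ∃ n, ∀ m, n ≤ m → ∀ a b, Stage R.rules t m a b ↔ Stage R.rules t n a b := by
  constructor
  · rintro ⟨G0, h0, S, ⟨rfl, hS⟩, n, hn⟩
    have key : ∀ m a b, (S m).eqv a b ↔ Stage R.rules t m a b := by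
      intro m
      induction m with
      | zero => exact isTermEG_iff.1 h0
      | succ m ih =>
        intro a b
        have e : (S m).eqv = Stage R.rules t m := by
          funext a b
          exact propext (ih a b)
        rw [isICO_iff.1 (hS m) a b, e]
        rfl
    refine ⟨n, fun m hm a b => ?_⟩
    rw [← key, ← key]
    exact EGraph.iso_iff.1 (hn m hm) a b
  · rintro ⟨n, hn⟩
    have e : ∀ n, (Stage.isPCR R.rules t n).egraph.eqv = Stage R.rules t n := by
      intro n
      funext a b
      exact propext (IsPCR.eqv_egraph _ a b)
    refine ⟨(Stage.isPCR R.rules t 0).egraph, isTermEG_iff.2 fun a b => by rw [e]; rfl,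
      fun n => (Stage.isPCR R.rules t n).egraph, ⟨rfl, fun i => isICO_iff.2 fun a b => ?_⟩, n,
      fun m hm => EGraph.iso_iff.2 fun a b => ?_⟩
    · rw [e, e]
      rfl
    · rw [e, e]
      exact hn m hm a b

/-- The relation computed by equality saturation: the closure under all rules. -/
inductive Der (R : Set (Tm F ar ℕ × Tm F ar ℕ)) (t : GTm F ar) : GTm F ar → GTm F ar → Prop
  | init : Der R t t t
  | symm {a b} : Der R t a b → Der R t b a
  | trans {a b c} : Der R t a b → Der R t b c → Der R t a c
  | congr {f} {s s' : Fin (ar f) → GTm F ar} : (∀ i, Der R t (s i) (s' i)) →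
      Der R t (.node f s) (.node f s) → Der R t (.node f s) (.node f s')
  | reach {f} {s : Fin (ar f) → GTm F ar} (i : Fin (ar f)) :
      Der R t (.node f s) (.node f s) → Der R t (s i) (s i)
  | rule {l : Tm F ar ℕ} {f : F} {ts : Fin (ar f) → Tm F ar ℕ} (h : (l, Tm.node f ts) ∈ R) (σ : ℕ → GTm F ar)
      (hl : Der R t (l.subst σ) (l.subst σ)) : Der R t (l.subst σ) ((Tm.node f ts).subst σ)

theorem Der.isPCR (R : Set (Tm F ar ℕ × Tm F ar ℕ)) (t : GTm F ar) : IsPCR (Der R t) where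
  symm := .symm
  trans := .trans
  congruent := fun _ _ _ => .congr
  reachable := fun _ _ h i => .reach i h

/-- A relation has finite index: finitely many terms meet every class of its domain. -/
def FinIdx (E : GTm F ar → GTm F ar → Prop) : Prop :=
  ∃ W : Set (GTm F ar), W.Finite ∧ ∀ a, E a a → ∃ w ∈ W, E a w

theorem Stage.mono {R : Set (Tm F ar ℕ × Tm F ar ℕ)} {t : GTm F ar} {m n : ℕ} (h : m ≤ n)
    {a b : GTm F ar} (hab : Stage R t m a b) : Stage R t n a b := by
  induction h with
  | refl => exact hab
  | step _ ih => exact .base (Or.inl ih)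

theorem Stage.der {R : Set (Tm F ar ℕ × Tm F ar ℕ)} {t : GTm F ar} {n : ℕ} :
    ∀ {a b : GTm F ar}, Stage R t n a b → Der R t a b := by
  induction n with
  | zero =>
    intro a b
    exact PCRGen.le (Der.isPCR R t) (by rintro _ _ ⟨rfl, rfl⟩; exact .init)
  | succ n ih =>
    intro a b
    refine PCRGen.le (Der.isPCR R t) fun a b h => h.elim ih ?_
    rintro ⟨hr, σ, hl⟩
    exact .rule hr σ (ih hl)

theorem Der.exists_stage {R : Set (Tm F ar ℕ × Tm F ar ℕ)} {t a b : GTm F ar} (h : Der R t a b) :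
    ∃ n, Stage R t n a b := by
  induction h with
  | init => exact ⟨0, .base ⟨rfl, rfl⟩⟩
  | symm _ ih =>
    obtain ⟨n, h⟩ := ih
    exact ⟨n, (Stage.isPCR R t n).symm h⟩
  | trans _ _ ih1 ih2 =>
    obtain ⟨n, h⟩ := ih1
    obtain ⟨m, h'⟩ := ih2
    exact ⟨max n m, (Stage.isPCR R t _).trans (h.mono (le_max_left _ _)) (h'.mono (le_max_right _ _))⟩
  | congr _ _ ih1 ih2 =>
    choose n h using ih1
    obtain ⟨m, h'⟩ := ih2
    exact ⟨max (Finset.univ.sup n) m, (Stage.isPCR R t _).congruent _ _ _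
      (fun i => (h i).mono ((Finset.le_sup (Finset.mem_univ i)).trans (le_max_left _ _)))
      (h'.mono (le_max_right _ _))⟩
  | reach i _ ih =>
    obtain ⟨n, h⟩ := ih
    exact ⟨n, (Stage.isPCR R t n).reachable _ _ h i⟩
  | rule h σ _ ih =>
    obtain ⟨n, h'⟩ := ih
    exact ⟨n + 1, .base (Or.inr (.mk h σ h'))⟩

theorem Subterm.finite {V : Type} (t : Tm F ar V) : {u | Subterm u t}.Finite := by
  induction t with
  | var v =>
    refine (Set.finite_singleton (Tm.var v)).subset fun u hu => ?_
    cases hu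
    rfl
  | node f ts ih =>
    refine ((Set.finite_singleton (Tm.node f ts)).union (Set.finite_iUnion ih)).subset fun u hu => ?_
    cases hu with
    | refl => exact Or.inl rfl
    | node i h => exact Or.inr (Set.mem_iUnion.2 ⟨i, h⟩)

theorem Tm.finite_subst {V : Type} {Γ : Set (GTm F ar)} (hΓ : Γ.Finite) (v : Tm F ar V) :
    {a | ∃ σ : V → GTm F ar, (∀ x ∈ v.vars, σ x ∈ Γ) ∧ a = v.subst σ}.Finite := by
  induction v with
  | var x =>
    refine hΓ.subset ?_
    rintro _ ⟨σ, h, rfl⟩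
    exact h x rfl
  | node f ts ih =>
    refine ((Set.Finite.pi' ih).image (Tm.node f)).subset ?_
    rintro _ ⟨σ, h, rfl⟩
    exact ⟨fun i => (ts i).subst σ, fun i => ⟨σ, fun x hx => h x (Set.mem_iUnion.2 ⟨i, hx⟩), rfl⟩, rfl⟩

theorem Tm.subterm_subst {V : Type} {v : Tm F ar V} {σ : V → GTm F ar} {u : GTm F ar}
    (h : Subterm u (v.subst σ)) :
    (∃ v', Subterm v' v ∧ u = v'.subst σ) ∨ ∃ x ∈ v.vars, Subterm u (σ x) := by
  induction v with
  | var x => exact Or.inr ⟨x, rfl, h⟩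
  | node f ts ih =>
    cases h with
    | refl => exact Or.inl ⟨_, .refl _, rfl⟩
    | node i h =>
      rcases ih i h with ⟨v', h1, h2⟩ | ⟨x, h1, h2⟩
      · exact Or.inl ⟨v', .node i h1, h2⟩
      · exact Or.inr ⟨x, Set.mem_iUnion.2 ⟨i, h1⟩, h2⟩

theorem Subterm.of_mem_vars {V : Type} {v : Tm F ar V} {x : V} (h : x ∈ v.vars) (σ : V → GTm F ar) :
    Subterm (σ x) (v.subst σ) := by
  induction v with
  | var y =>
    obtain rfl : x = y := h
    exact .refl _
  | node f ts ih =>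
    obtain ⟨i, hi⟩ := Set.mem_iUnion.1 h
    exact .node i (ih i hi)

theorem Subterm.vars_subset {V : Type} {u v : Tm F ar V} (h : Subterm u v) : u.vars ⊆ v.vars := by
  induction h with
  | refl => exact subset_rfl
  | node i _ ih => exact ih.trans fun x hx => Set.mem_iUnion.2 ⟨i, hx⟩

theorem Subterm.dom {E : GTm F ar → GTm F ar → Prop} (hE : IsPCR E) {u v : GTm F ar}
    (h : Subterm u v) (hv : E v v) : E u u := by
  induction h with
  | refl => exact hv
  | node i _ ih => exact ih (hE.reachable _ _ hv i)

theorem IsPCR.subst_congr {V : Type} {E : GTm F ar → GTm F ar → Prop} (hE : IsPCR E)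
    {σ τ : V → GTm F ar} (v : Tm F ar V) (h : ∀ x ∈ v.vars, E (σ x) (τ x))
    (hv : E (v.subst σ) (v.subst σ)) : E (v.subst σ) (v.subst τ) := by
  induction v with
  | var x => exact h x rfl
  | node f ts ih =>
    exact hE.congruent _ _ _ (fun i => ih i (fun x hx => h x (Set.mem_iUnion.2 ⟨i, hx⟩))
      (hE.reachable _ _ hv i)) hv

theorem PCRGen.finIdx {B : GTm F ar → GTm F ar → Prop} {Γ : Set (GTm F ar)} (hΓ : Γ.Finite)
    (h : ∀ a b, B a b → ∀ u, Subterm u a ∨ Subterm u b → ∃ γ ∈ Γ, PCRGen B u γ) : FinIdx (PCRGen B) := by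
  have key : ∀ a b, PCRGen B a b → ∀ u, Subterm u a ∨ Subterm u b → ∃ γ ∈ Γ, PCRGen B u γ := by
    intro a b hab
    induction hab with
    | base hab => exact h _ _ hab
    | symm _ ih => exact fun u hu => ih u hu.symm
    | trans _ _ ih1 ih2 => exact fun u hu => hu.elim (fun h => ih1 u (Or.inl h)) fun h => ih2 u (Or.inr h)
    | @congr f s t h1 h2 ih1 ih2 =>
      rintro u (hu | hu)
      · exact ih2 u (Or.inl hu)
      · cases hu with
        | refl =>
          obtain ⟨γ, hγ, h3⟩ := ih2 _ (Or.inl (.refl _))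
          exact ⟨γ, hγ, (PCRGen.congr h1 h2).symm.trans h3⟩
        | node i hu => exact ih1 i u (Or.inr hu)
    | reach i _ ih => exact fun u hu => ih u (Or.inl (.node i (hu.elim id id)))
  exact ⟨Γ, hΓ, fun a ha => key a a ha a (Or.inl (.refl _))⟩

theorem Stage.finIdx {R : Set (Tm F ar ℕ × Tm F ar ℕ)} (hR : R.Finite)
    (hvar : ∀ r ∈ R, r.2.vars ⊆ r.1.vars) (t : GTm F ar) (n : ℕ) : FinIdx (Stage R t n) := by
  induction n with
  | zero =>
    refine PCRGen.finIdx (Subterm.finite t) ?_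
    rintro _ _ ⟨rfl, rfl⟩ u hu
    have hu : Subterm u _ := hu.elim id id
    exact ⟨u, hu, hu.dom (PCRGen.isPCR _) (.base ⟨rfl, rfl⟩)⟩
  | succ n ih =>
    obtain ⟨Γ, hΓ, h⟩ := ih
    have hfin : (⋃ r ∈ R, ⋃ v ∈ {v | Subterm v r.2},
        {a | ∃ σ : ℕ → GTm F ar, (∀ x ∈ v.vars, σ x ∈ Γ) ∧ a = v.subst σ}).Finite :=
      hR.biUnion fun r _ => (Subterm.finite r.2).biUnion fun v _ => Tm.finite_subst hΓ v
    have hold : ∀ a u, Stage R t n a a → Subterm u a → ∃ γ ∈ Γ, Stage R t n u γ :=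
      fun a u ha hu => h u (hu.dom (Stage.isPCR R t n) ha)
    refine PCRGen.finIdx (hΓ.union hfin) ?_
    rintro a b (hab | hab) u hu
    · obtain ⟨γ, h1, h2⟩ : ∃ γ ∈ Γ, Stage R t n u γ :=
        hu.elim (hold a u ((Stage.isPCR R t n).left hab)) (hold b u ((Stage.isPCR R t n).right hab))
      exact ⟨γ, Or.inl h1, .base (Or.inl h2)⟩
    · obtain ⟨hr, σ, hl⟩ := hab
      rename_i l f ts
      rcases hu with hu | hu
      · obtain ⟨γ, h1, h2⟩ := hold _ u hl hu
        exact ⟨γ, Or.inl h1, .base (Or.inl h2)⟩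
      · have hsub : ∀ x ∈ (Tm.node f ts).vars, Subterm (σ x) (l.subst σ) := fun x hx =>
          Subterm.of_mem_vars (hvar _ hr hx) σ
        rcases Tm.subterm_subst hu with ⟨v, hv, rfl⟩ | ⟨x, hx, hu⟩
        · have h1 : ∀ x, ∃ γ, x ∈ (Tm.node f ts).vars → γ ∈ Γ ∧ Stage R t n (σ x) γ := by
            intro x
            by_cases hx : x ∈ (Tm.node f ts).vars
            · obtain ⟨γ, h1, h2⟩ := hold _ _ hl (hsub x hx)
              exact ⟨γ, fun _ => ⟨h1, h2⟩⟩
            · exact ⟨σ x, fun h => absurd h hx⟩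
          choose τ hτ using h1
          have hvv := hv.vars_subset
          refine ⟨v.subst τ, Or.inr ?_, ?_⟩
          · simp only [Set.mem_iUnion]
            exact ⟨_, hr, v, hv, τ, fun x hx => (hτ x (hvv hx)).1, rfl⟩
          · refine (PCRGen.isPCR _).subst_congr v (fun x hx => .base (Or.inl (hτ x (hvv hx)).2)) ?_
            exact hv.subst_dom (PCRGen.isPCR _) σ
              ((PCRGen.isPCR _).right (.base (Or.inr (.mk hr σ hl))))
        · obtain ⟨γ, h1, h2⟩ := hold _ u hl (hu.trans' (hsub x hx))
          exact ⟨γ, Or.inl h1, .base (Or.inl h2)⟩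

theorem Der.le_stage_of_finIdx [Finite F] {R : Set (Tm F ar ℕ × Tm F ar ℕ)} {t : GTm F ar}
    (h : FinIdx (Der R t)) : ∃ n, ∀ a b, Der R t a b → Stage R t n a b := by
  obtain ⟨W, hW, h⟩ := h
  have hP : (⋃ f : F, Tm.node f '' {s : Fin (ar f) → GTm F ar | ∀ i, s i ∈ W}).Finite :=
    Set.finite_iUnion fun f => (Set.Finite.pi' fun _ => hW).image _
  set P := W ∪ ⋃ f : F, Tm.node f '' {s : Fin (ar f) → GTm F ar | ∀ i, s i ∈ W} with hPdef
  have hPW : (P ×ˢ P).Finite := (hW.union hP).prod (hW.union hP)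
  have h1 : ∀ p : GTm F ar × GTm F ar, ∃ n, Der R t p.1 p.2 → Stage R t n p.1 p.2 := by
    intro p
    by_cases hp : Der R t p.1 p.2
    · obtain ⟨n, hn⟩ := hp.exists_stage
      exact ⟨n, fun _ => hn⟩
    · exact ⟨0, fun h => absurd h hp⟩
  choose N hN using h1
  obtain ⟨n, hn⟩ := (hPW.image N).bddAbove
  have h2 : ∀ a ∈ P, ∀ b ∈ P, Der R t a b → Stage R t n a b := fun a ha b hb hab =>
    (hN (a, b) hab).mono (hn ⟨(a, b), ⟨ha, hb⟩, rfl⟩)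
  have h3 : ∀ a, Der R t a a → ∃ w ∈ W, Stage R t n a w := by
    intro a
    induction a with
    | var e => exact e.elim
    | node f s ih =>
      intro ha
      choose w hw hs using fun i => ih i (.reach i ha)
      have h4 : Der R t (.node f s) (.node f w) := .congr (fun i => (hs i).der) ha
      obtain ⟨v, hv, h5⟩ := h _ ((Der.isPCR R t).right h4)
      have h6 : Stage R t n (.node f w) v :=
        h2 _ (Or.inr (Set.mem_iUnion.2 ⟨f, w, hw, rfl⟩)) _ (Or.inl hv) h5
      have hp := Stage.isPCR R t n
      have h7 := hp.congruent f w s (fun i => hp.symm (hs i)) (hp.left h6)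
      exact ⟨v, hv, hp.trans (hp.symm h7) h6⟩
  refine ⟨n, fun a b hab => ?_⟩
  obtain ⟨v, hv, h4⟩ := h3 a ((Der.isPCR R t).left hab)
  obtain ⟨w, hw, h5⟩ := h3 b ((Der.isPCR R t).right hab)
  have hp := Stage.isPCR R t n
  exact hp.trans h4 (hp.trans (h2 v (Or.inl hv) w (Or.inl hw)
    (h4.der.symm.trans (hab.trans h5.der))) (hp.symm h5))

theorem terminates_iff_finIdx [Finite F] (R : TRS F ar) (t : GTm F ar) :
    (∃ G0, IsTermEG t G0 ∧ EqSatTerminates R G0) ↔ FinIdx (Der R.rules t) := by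
  rw [terminates_iff_stage]
  constructor
  · rintro ⟨n, hn⟩
    obtain ⟨W, hW, h⟩ := Stage.finIdx R.finite R.var_cond t n
    refine ⟨W, hW, fun a ha => ?_⟩
    obtain ⟨m, hm⟩ := ha.exists_stage
    obtain ⟨w, hw, h'⟩ := h a ((hn _ (le_max_left n m) a a).1 (hm.mono (le_max_right n m)))
    exact ⟨w, hw, h'.der⟩
  · intro h
    obtain ⟨n, hn⟩ := Der.le_stage_of_finIdx h
    exact ⟨n, fun m hm a b => ⟨fun h => hn a b h.der, fun h => h.mono hm⟩⟩

end Termination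

theorem allTermTerminates_iff (inst : TRSInstance) :
    AllTermTerminates inst ↔ (∀ r ∈ inst.2.2, r.2.vars ⊆ r.1.vars) ∧
      ∀ t : GTm (Fin inst.1) inst.2.1, FinIdx (Der {r | r ∈ inst.2.2} t) := by
  constructor
  · rintro ⟨R, hR, h⟩
    rw [← hR]
    refine ⟨fun r hr => R.var_cond r ?_, fun t => (terminates_iff_finIdx R t).1 (h t)⟩
    rw [hR]
    exact hr
  · rintro ⟨h1, h2⟩
    let R : TRS (Fin inst.1) inst.2.1 := ⟨{r | r ∈ inst.2.2}, List.finite_toSet _, h1⟩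
    exact ⟨R, rfl, fun t => (terminates_iff_finIdx R t).2 (h2 t)⟩

open Encodable

theorem encode_ofFn_eq {B : Type} [Encodable B] : ∀ {n : ℕ} (f : Fin n → B),
    encode (List.Vector.ofFn f) = encode (List.ofFn fun i => encode (f i))
  | 0, _ => rfl
  | n + 1, f => by
    have := encode_ofFn_eq fun i : Fin n => f i.succ
    rw [List.ofFn_succ, encode_list_cons, ← this]
    rfl

theorem encode_finPi {n : ℕ} {π : Fin n → Type} (inst : ∀ i, Encodable (π i)) (f : ∀ i, π i) :
    (finPi n π).encode f = encode (List.ofFn fun i : Fin n => Nat.pair i (encode (f i))) :=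
  encode_ofFn_eq (B := Σ i, π i) fun i => ⟨i, f i⟩

theorem encode_arrow {A B : Type} [Fintype A] [Encodable A] [Encodable B] (f : A → B) :
    encode f = encode (List.ofFn fun i : Fin (Fintype.card A) =>
      Nat.pair i (encode (f (fintypeEquivFin.symm i)))) :=
  encode_finPi (π := fun _ => B) (fun _ => inferInstance) fun i => f (fintypeEquivFin.symm i)

theorem encode_fun_congr {A B C : Type} [Fintype A] [Encodable A] (iB : Encodable B) (iC : Encodable C) (f : A → B) (g : A → C)
    (h : ∀ i, iB.encode (f i) = iC.encode (g i)) : encode f = encode g := by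
  rw [encode_arrow, encode_arrow]
  simp only [h]

theorem wenc {α : Type} {β : α → Type} [∀ a, Fintype (β a)] [∀ a, Encodable (β a)] [Encodable α] (E : WType β → ℕ) (hE : ∀ a f, E ⟨a, f⟩ = Nat.pair (encode a) (encode (fun i => E (f i)))) (t : WType β) :
   encode t = Nat.pair t.depth (E t) := by
    have key : ∀ (z : Encodable {t : WType β // t.depth ≤ 0})
        (s : ∀ n, Encodable {t : WType β // t.depth ≤ n} → Encodable {t : WType β // t.depth ≤ n + 1})
        (_ : ∀ (n : ℕ) (i : Encodable {t : WType β // t.depth ≤ n}) (a : α) (f : β a → WType β) (h : (WType.mk a f).depth ≤ n + 1) (h2 : ∀ j, (f j).depth ≤ n),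
          (s n i).encode ⟨⟨a, f⟩, h⟩ = Nat.pair (encode a) (encode fun j => (⟨f j, h2 j⟩ : {t : WType β // t.depth ≤ n})))
        n (t : WType β) (h : t.depth ≤ n),
        (Nat.rec (motive := fun n => Encodable {t : WType β // t.depth ≤ n}) z s n).encode ⟨t, h⟩ = E t := by
      intro z s hs n
      induction n with
      | zero => intro t h; exact absurd h (by have := t.depth_pos; omega)
      | succ n ih =>
        rintro ⟨a, f⟩ h
        have : ∀ i, (f i).depth ≤ n := fun i => Nat.le_of_lt_succ (lt_of_lt_of_le (WType.depth_lt_depth_mk a f i) h)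
        rw [hE]
        refine (hs n _ a f h this).trans ?_
        congr 1
        refine @encode_fun_congr _ _ _ _ _ (Nat.rec (motive := fun n => Encodable {t : WType β // t.depth ≤ n}) z s n) _ _ _ fun i => ?_
        exact ih (f i) (this i)
    unfold encode WType.instEncodable
    dsimp only [ofLeftInverse, ofLeftInjection, encode]
    unfold encodeSigma
    dsimp only
    refine congrArg₂ _ rfl ?_
    refine key _ _ ?_ _ _ _
    intros
    rfl

theorem sortedUniv_fin (k : ℕ) : sortedUniv (Fin k) = List.finRange k := by
  rw [← Fin.sort_univ]
  rfl

theorem val_fintypeEquivFin_symm (k : ℕ) (i : Fin (Fintype.card (Fin k))) :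
    ((fintypeEquivFin.symm i : Fin k) : ℕ) = i := by
  have h : (fintypeEquivFin.symm i : Fin k) = (sortedUniv (Fin k)).get (i.cast (length_sortedUniv _).symm) := by
    unfold fintypeEquivFin
    refine congrArg (sortedUniv (Fin k)).get (Fin.ext ?_)
    have : ∀ {a b : ℕ} (h : a = b) (h' : Fin a = Fin b) (i : Fin a), (cast h' i : Fin b).val = i.val := by
      intro a b h h' i; subst h; rfl
    exact this (length_sortedUniv _).symm _ _
  rw [h]
  have : ∀ (l : List (Fin k)) (hl : l = List.finRange k) (j : Fin l.length), (l.get j).val = j.val := by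
    rintro l rfl j; simp
  rw [this _ (sortedUniv_fin k)]
  rfl

theorem encode_fin_arrow {k : ℕ} (f : Fin k → ℕ) :
    (fintypeArrowOfEncodable (α := Fin k) (β := ℕ)).encode f = encode (List.ofFn fun i : Fin k => Nat.pair i (f i)) := by
  rw [encode_arrow]
  have : ∀ {m : ℕ} (h : m = k) (g : Fin m → Fin k), (∀ i, (g i : ℕ) = i) → List.ofFn (fun i => Nat.pair i (encode (f (g i)))) = List.ofFn fun i : Fin k => Nat.pair i (f i) := by
    rintro m rfl g hg
    congr 1; funext i
    rw [show g i = i from Fin.ext (hg i)]; rfl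
  rw [this (Fintype.card_fin k) _ (val_fintypeEquivFin_symm k)]

/-- depth-free part of the encoding -/
def Tm.shapeCode {n : ℕ} {ar : Fin n → ℕ} {V : Type} [Encodable V] : Tm (Fin n) ar V → ℕ
  | .var v => Nat.pair (encode v * 2 + 1) 0
  | .node f ts => Nat.pair (f * 2) (encode (List.ofFn fun i => Nat.pair i (ts i).shapeCode))

def Tm.depth {n : ℕ} {ar : Fin n → ℕ} {V : Type} : Tm (Fin n) ar V → ℕ
  | .var _ => 1
  | .node _ ts => (Finset.univ.sup fun i => (ts i).depth) + 1

theorem Tm.toW_depth {n : ℕ} {ar : Fin n → ℕ} {V : Type} : ∀ t : Tm (Fin n) ar V, t.toW.depth = t.depth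
  | .var _ => rfl
  | .node f ts => by
    simp only [Tm.toW, WType.depth, Tm.depth]
    congr 1
    exact congrArg (Finset.sup Finset.univ) (funext fun i => Tm.toW_depth (ts i))

theorem Tm.encode_eq {n : ℕ} {ar : Fin n → ℕ} {V : Type} [Encodable V] (t : Tm (Fin n) ar V) :
    encode t = Nat.pair t.depth t.shapeCode := by
  have h := wenc (β := TmShape n ar V) (fun w => (Tm.ofW w).shapeCode) ?_ t.toW
  · rw [← Tm.toW_depth]
    simp only [Tm.ofW_toW] at h
    exact h
  · rintro (f | v) g
    · simp only [Tm.ofW, Tm.shapeCode]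
      have := encode_fin_arrow (k := ar f) (fun i => (Tm.ofW (g i)).shapeCode)
      rw [← this, Nat.mul_comm]
      rfl
    · simp only [Tm.ofW, Tm.shapeCode]
      rw [Nat.mul_comm]
      rfl

section Tokens

variable {n : ℕ} {ar : Fin n → ℕ} {V : Type} [Encodable V] {α : Type}

/-- Prefix notation of a term. -/
def Tm.toks : Tm (Fin n) ar V → List (ℕ ⊕ ℕ)
  | .var v => [Sum.inr (encode v)]
  | .node f ts => Sum.inl f :: (List.ofFn fun i => (ts i).toks).flatten

/-- One step of the stack evaluation of a term in prefix notation. -/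
def tokStep (L : List ℕ) (alg : ℕ → List α → Option α) (σ : ℕ → Option α) (x : ℕ ⊕ ℕ)
    (S : Option (List α)) : Option (List α) :=
  S.bind fun s => Sum.casesOn x
    (fun f => (L[f]?).bind fun k =>
      if k ≤ s.length then (alg f (s.take k)).map fun c => c :: s.drop k else none)
    (fun v => (σ v).map fun c => c :: s)

/-- Stack evaluation of a term in prefix notation in a partial algebra. -/
def evalToks (L : List ℕ) (alg : ℕ → List α → Option α) (σ : ℕ → Option α) (w : List (ℕ ⊕ ℕ)) :
    Option (List α) :=
  w.foldr (tokStep L alg σ) (some [])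

/-- The value of a term in a partial algebra, as a relation. -/
def Tm.Ev (alg : ℕ → List α → Option α) (σ : ℕ → Option α) : Tm (Fin n) ar V → α → Prop
  | .var v, c => σ (encode v) = some c
  | .node f ts, c => ∃ cs : Fin (ar f) → α, (∀ i, (ts i).Ev alg σ (cs i)) ∧ alg f (List.ofFn cs) = some c

theorem foldr_flatten_ofFn {A : Type} {step : A → Option (List α) → Option (List α)} :
    ∀ {k : ℕ} (w : Fin k → List A) (P : Fin k → α → Prop)
      (_ : ∀ i S st, (w i).foldr step S = some st ↔ ∃ s c, S = some s ∧ P i c ∧ st = c :: s)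
      (S : Option (List α)) (st : List α),
      (List.ofFn w).flatten.foldr step S = some st ↔
        ∃ s cs, S = some s ∧ (∀ i, P i (cs i)) ∧ st = List.ofFn cs ++ s
  | 0, w, P, _, S, st => by
    simp only [List.ofFn_zero, List.flatten_nil, List.foldr_nil, List.nil_append]
    constructor
    · rintro rfl
      exact ⟨st, fun i => i.elim0, rfl, fun i => i.elim0, rfl⟩
    · rintro ⟨s, _, rfl, _, rfl⟩
      rfl
  | k + 1, w, P, h, S, st => by
    rw [List.ofFn_succ, List.flatten_cons, List.foldr_append, h]
    constructor
    · rintro ⟨s, c, h1, h2, rfl⟩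
      obtain ⟨s', cs, rfl, h3, rfl⟩ := (foldr_flatten_ofFn (fun i => w i.succ) (fun i => P i.succ)
        (fun i => h i.succ) S s).1 h1
      refine ⟨s', Fin.cons c cs, rfl, fun i => ?_, ?_⟩
      · refine Fin.cases ?_ (fun j => ?_) i
        · exact h2
        · exact h3 j
      · simp [List.ofFn_succ]
    · rintro ⟨s, cs, rfl, h2, rfl⟩
      refine ⟨List.ofFn (fun i : Fin k => cs i.succ) ++ s, cs 0, ?_, h2 0, by simp [List.ofFn_succ]⟩
      exact (foldr_flatten_ofFn (fun i => w i.succ) (fun i => P i.succ)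
        (fun i => h i.succ) _ _).2 ⟨s, fun i => cs i.succ, rfl, fun i => h2 i.succ, rfl⟩

theorem foldr_toks {L : List ℕ} (hL : L = List.ofFn ar) (alg : ℕ → List α → Option α) (σ : ℕ → Option α)
    (t : Tm (Fin n) ar V) : ∀ S st, t.toks.foldr (tokStep L alg σ) S = some st ↔
      ∃ s c, S = some s ∧ t.Ev alg σ c ∧ st = c :: s := by
  induction t with
  | var v =>
    intro S st
    cases S with
    | none => simp [Tm.toks, tokStep]
    | some s =>
      simp only [Tm.toks, tokStep, List.foldr_cons, List.foldr_nil, Option.bind_some, Tm.Ev,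
        Option.map_eq_some_iff, Option.some.injEq]
      constructor
      · rintro ⟨c, h, rfl⟩
        exact ⟨s, c, rfl, h, rfl⟩
      · rintro ⟨s, c, rfl, h, rfl⟩
        exact ⟨c, h, rfl⟩
  | node f ts ih =>
    intro S st
    have hf : L[(f : ℕ)]? = some (ar f) := by simp [hL]
    have key := foldr_flatten_ofFn (step := tokStep L alg σ) (fun i => (ts i).toks)
      (fun i c => (ts i).Ev alg σ c) ih S
    simp only [Tm.toks, List.foldr_cons, Tm.Ev]
    constructor
    · intro h
      unfold tokStep at h
      obtain ⟨s, h1, h2⟩ := Option.bind_eq_some_iff.1 h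
      obtain ⟨s', cs, rfl, h3, rfl⟩ := (key s).1 h1
      simp only [hf, Option.bind_some, List.length_append, List.length_ofFn] at h2
      rw [if_pos (Nat.le_add_right _ _), List.take_left' (List.length_ofFn),
        List.drop_left' (List.length_ofFn)] at h2
      obtain ⟨c, h4, rfl⟩ := Option.map_eq_some_iff.1 h2
      exact ⟨s', c, rfl, ⟨cs, h3, h4⟩, rfl⟩
    · rintro ⟨s, c, rfl, ⟨cs, h3, h4⟩, rfl⟩
      have h1 := (key (List.ofFn cs ++ s)).2 ⟨s, cs, rfl, h3, rfl⟩
      rw [h1]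
      unfold tokStep
      simp only [hf, Option.bind_some, List.length_append, List.length_ofFn]
      rw [if_pos (Nat.le_add_right _ _), List.take_left' (List.length_ofFn),
        List.drop_left' (List.length_ofFn), h4]
      rfl

theorem evalToks_toks (alg : ℕ → List α → Option α) (σ : ℕ → Option α) (t : Tm (Fin n) ar V) (st : List α) :
    evalToks (List.ofFn ar) alg σ t.toks = some st ↔ ∃ c, t.Ev alg σ c ∧ st = [c] := by
  unfold evalToks
  rw [foldr_toks rfl]
  simp

theorem evalToks_toks_singleton (alg : ℕ → List α → Option α) (σ : ℕ → Option α) (t : Tm (Fin n) ar V) (c : α) :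
    evalToks (List.ofFn ar) alg σ t.toks = some [c] ↔ t.Ev alg σ c := by
  rw [evalToks_toks]
  simp

theorem exists_terms_of_evalToks {alg : ℕ → List α → Option α} {σ : ℕ → Option α}
    (hσ : ∀ x c, σ x = some c → ∃ v : V, encode v = x) (w : List (ℕ ⊕ ℕ)) :
    ∀ st, evalToks (List.ofFn ar) alg σ w = some st →
      ∃ ts : List (Tm (Fin n) ar V), w = (ts.map Tm.toks).flatten ∧ ts.length = st.length := by
  induction w with
  | nil =>
    intro st h
    obtain rfl : [] = st := by simpa [evalToks] using h
    exact ⟨[], rfl, rfl⟩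
  | cons x w ih =>
    intro st h
    change tokStep _ alg σ x (evalToks (List.ofFn ar) alg σ w) = some st at h
    unfold tokStep at h
    obtain ⟨s, h1, h2⟩ := Option.bind_eq_some_iff.1 h
    obtain ⟨ts, rfl, hlen⟩ := ih s h1
    rcases x with f | x
    · simp only at h2
      obtain ⟨k, h3, h4⟩ := Option.bind_eq_some_iff.1 h2
      obtain ⟨hf, h3⟩ := List.getElem?_eq_some_iff.1 h3
      rw [List.length_ofFn] at hf
      simp only [List.getElem_ofFn] at h3
      subst h3
      split_ifs at h4 with h5
      obtain ⟨c, -, rfl⟩ := Option.map_eq_some_iff.1 h4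
      rw [← hlen] at h5
      refine ⟨.node ⟨f, hf⟩ (fun i => ts[(i : ℕ)]'(i.2.trans_le h5)) :: ts.drop (ar ⟨f, hf⟩), ?_, by simp [hlen]⟩
      have h6 : (List.ofFn fun i : Fin (ar ⟨f, hf⟩) => (ts[(i : ℕ)]'(i.2.trans_le h5)).toks)
          = (ts.take (ar ⟨f, hf⟩)).map Tm.toks := by
        apply List.ext_getElem
        · simp [h5]
        · intro i h1 h2
          simp
      simp only [List.map_cons, List.flatten_cons, Tm.toks, h6, List.cons_append]
      rw [← List.flatten_append, ← List.map_append, List.take_append_drop]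
    · simp only at h2
      obtain ⟨c, h3, rfl⟩ := Option.map_eq_some_iff.1 h2
      obtain ⟨v, rfl⟩ := hσ x c h3
      exact ⟨.var v :: ts, by simp [Tm.toks], by simp [hlen]⟩

theorem exists_term_of_evalToks {alg : ℕ → List α → Option α} {σ : ℕ → Option α}
    (hσ : ∀ x c, σ x = some c → ∃ v : V, encode v = x) {w : List (ℕ ⊕ ℕ)} {c : α}
    (h : evalToks (List.ofFn ar) alg σ w = some [c]) : ∃ t : Tm (Fin n) ar V, w = t.toks := by
  obtain ⟨ts, rfl, h2⟩ := exists_terms_of_evalToks hσ w _ h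
  obtain ⟨t, rfl⟩ := List.length_eq_one_iff.1 h2
  exact ⟨t, by simp⟩

theorem Tm.Ev.functional {alg : ℕ → List α → Option α} {σ : ℕ → Option α} {t : Tm (Fin n) ar V} :
    ∀ {c d : α}, t.Ev alg σ c → t.Ev alg σ d → c = d := by
  induction t with
  | var v =>
    intro c d h1 h2
    exact Option.some.inj (h1.symm.trans h2)
  | node f ts ih =>
    rintro c d ⟨cs, h1, h2⟩ ⟨ds, h3, h4⟩
    obtain rfl : cs = ds := funext fun i => ih i (h1 i) (h3 i)
    exact Option.some.inj (h2.symm.trans h4)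

theorem Tm.Ev.congr {alg : ℕ → List α → Option α} {σ τ : ℕ → Option α} {t : Tm (Fin n) ar V}
    (hστ : ∀ v ∈ t.vars, σ (encode v) = τ (encode v)) : ∀ {c : α}, t.Ev alg σ c → t.Ev alg τ c := by
  induction t with
  | var v =>
    intro c h
    exact (hστ v rfl).symm.trans h
  | node f ts ih =>
    rintro c ⟨cs, h1, h2⟩
    exact ⟨cs, fun i => ih i (fun v hv => hστ v (Set.mem_iUnion.2 ⟨i, hv⟩)) (h1 i), h2⟩

/-- Evaluating an instance amounts to evaluating the substitution first. -/
theorem Tm.ev_subst {W : Type} [Encodable W] {alg : ℕ → List α → Option α} {τ : ℕ → Option α}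
    {t : Tm (Fin n) ar V} {s : V → Tm (Fin n) ar W} : ∀ {c : α}, (t.subst s).Ev alg τ c ↔
    ∃ σ : V → α, (∀ v ∈ t.vars, (s v).Ev alg τ (σ v)) ∧
      t.Ev alg (fun x => (decode₂ V x).map σ) c := by
  induction t with
  | var v =>
    intro c
    simp only [Tm.subst, Tm.vars, Set.mem_singleton_iff, forall_eq, Tm.Ev, encodek₂, Option.map_some,
      Option.some.injEq]
    exact ⟨fun h => ⟨fun _ => c, h, rfl⟩, fun ⟨σ, h, h'⟩ => h' ▸ h⟩
  | node f ts ih =>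
    intro c
    classical
    constructor
    · rintro ⟨cs, h1, h2⟩
      choose σ h3 h4 using fun i => (ih i).1 (h1 i)
      have h5 : ∀ v ∈ (Tm.node f ts).vars, ∃ d, (s v).Ev alg τ d := fun v hv => by
        obtain ⟨i, hi⟩ := Set.mem_iUnion.1 hv
        exact ⟨_, h3 i v hi⟩
      refine ⟨fun v => if h : ∃ d, (s v).Ev alg τ d then h.choose else c, fun v hv => ?_, cs,
        fun i => ?_, h2⟩
      · dsimp only
        rw [dif_pos (h5 v hv)]
        exact (h5 v hv).choose_spec
      · refine (h4 i).congr fun v hv => ?_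
        have h6 := h5 v (Set.mem_iUnion.2 ⟨i, hv⟩)
        simp only [encodek₂, Option.map_some, dif_pos h6]
        exact congrArg some ((h3 i v hv).functional h6.choose_spec)
    · rintro ⟨σ, h1, cs, h2, h3⟩
      exact ⟨cs, fun i => (ih i).2 ⟨σ, fun v hv => h1 v (Set.mem_iUnion.2 ⟨i, hv⟩), h2 i⟩, h3⟩

/-- Evaluating an instance amounts to evaluating the substitution first. -/
theorem Tm.ev_subst_nat {W : Type} [Encodable W] {alg : ℕ → List α → Option α} {τ : ℕ → Option α}
    {t : Tm (Fin n) ar ℕ} {s : ℕ → Tm (Fin n) ar W} {c : α} : (t.subst s).Ev alg τ c ↔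
    ∃ σ : ℕ → α, (∀ v ∈ t.vars, (s v).Ev alg τ (σ v)) ∧ t.Ev alg (fun x => some (σ x)) c := by
  have h : ∀ x : ℕ, decode₂ ℕ x = some x := fun x => encodek₂ x
  rw [Tm.ev_subst]
  simp only [h, Option.map_some]

/-- The algebra computing depth and depth-free code of terms. -/
def encAlg (f : ℕ) (l : List (ℕ × ℕ)) : Option (ℕ × ℕ) :=
  some ((l.map Prod.fst).foldr max 0 + 1,
    Nat.pair (f * 2) (encode ((List.range l.length).map fun i => Nat.pair i (l.getD i (0, 0)).2)))

/-- The values of variables under `encAlg`. -/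
def encVar (x : ℕ) : Option (ℕ × ℕ) := some (1, Nat.pair (x * 2 + 1) 0)

theorem foldr_max_ofFn : ∀ {k : ℕ} (f : Fin k → ℕ), (List.ofFn f).foldr max 0 = Finset.univ.sup f
  | 0, f => by simp
  | k + 1, f => by
    rw [List.ofFn_succ, List.foldr_cons, foldr_max_ofFn, Fin.univ_succ]
    simp [Finset.sup_map, Function.comp_def]

theorem Tm.ev_encAlg (t : Tm (Fin n) ar V) : t.Ev encAlg encVar (t.depth, t.shapeCode) := by
  induction t with
  | var v => rfl
  | node f ts ih =>
    refine ⟨fun i => ((ts i).depth, (ts i).shapeCode), ih, ?_⟩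
    simp only [encAlg, Tm.depth, Tm.shapeCode, List.map_ofFn, foldr_max_ofFn, List.length_ofFn]
    congr 3
    congr 1
    apply List.ext_getElem
    · simp
    · intro i h1 h2
      rw [List.length_ofFn] at h2
      simp [List.getElem?_ofFn, h2]

/-- The code of a term given in prefix notation. -/
def encToks (L : List ℕ) (w : List (ℕ ⊕ ℕ)) : ℕ :=
  let p := ((evalToks L encAlg encVar w).bind List.head?).getD (0, 0)
  Nat.pair p.1 p.2

theorem encToks_toks (t : Tm (Fin n) ar V) : encToks (List.ofFn ar) t.toks = encode t := by
  unfold encToks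
  rw [(evalToks_toks_singleton _ _ _ _).2 t.ev_encAlg, Tm.encode_eq]
  rfl

/-- The prefix notation is well formed. -/
def WfToks (L : List ℕ) (w : List (ℕ ⊕ ℕ)) : Prop :=
  (evalToks L encAlg encVar w).map List.length = some 1

theorem wfToks_toks (t : Tm (Fin n) ar V) : WfToks (List.ofFn ar) t.toks := by
  unfold WfToks
  rw [(evalToks_toks_singleton _ _ _ _).2 t.ev_encAlg]
  rfl

theorem WfToks.exists_term {w : List (ℕ ⊕ ℕ)} (h : WfToks (List.ofFn ar) w) :
    ∃ t : Tm (Fin n) ar ℕ, w = t.toks := by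
  obtain ⟨st, h1, h2⟩ := Option.map_eq_some_iff.1 h
  obtain ⟨c, rfl⟩ := List.length_eq_one_iff.1 h2
  exact exists_term_of_evalToks (fun x _ _ => ⟨x, rfl⟩) h1

theorem mem_toks_inr {t : Tm (Fin n) ar ℕ} {x : ℕ} : Sum.inr x ∈ t.toks ↔ x ∈ t.vars := by
  induction t with
  | var v => simp [Tm.toks, Tm.vars]
  | node f ts ih =>
    simp only [Tm.toks, Tm.vars, List.mem_cons, reduceCtorEq, List.mem_flatten, List.mem_ofFn, false_or,
      Set.mem_iUnion]
    constructor
    · rintro ⟨_, ⟨i, rfl⟩, h⟩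
      exact ⟨i, (ih i).1 h⟩
    · rintro ⟨i, h⟩
      exact ⟨_, ⟨i, rfl⟩, (ih i).2 h⟩

end Tokens

/-- Raw problem instances: a list of arities and rules in prefix notation. -/
abbrev RawInstance : Type := List ℕ × List (List (ℕ ⊕ ℕ) × List (ℕ ⊕ ℕ))

/-- The raw form of a problem instance. -/
def TRSInstance.raw (inst : TRSInstance) : RawInstance :=
  (List.ofFn inst.2.1, inst.2.2.map fun r => (r.1.toks, r.2.toks))

/-- The code of a problem instance in raw form. -/
def RawInstance.code (ρ : RawInstance) : ℕ :=
  Nat.pair ρ.1.length (Nat.pair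
    (encode ((List.range ρ.1.length).map fun i => Nat.pair i (ρ.1.getD i 0)))
    (encode (ρ.2.map fun r => Nat.pair (encToks ρ.1 r.1) (encToks ρ.1 r.2))))

theorem TRSInstance.code_raw (inst : TRSInstance) : inst.raw.code = encode inst := by
  obtain ⟨n, ar, rules⟩ := inst
  have e1 : encode ar = encode (List.ofFn fun i : Fin n => Nat.pair i (ar i)) :=
    encode_finPi (fun _ => inferInstance) ar
  have e2 : encode rules = encode (rules.map fun r => Nat.pair (encode r.1) (encode r.2)) := by
    induction rules with
    | nil => rfl
    | cons r rs ih =>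
      rw [List.map_cons, encode_list_cons, encode_list_cons, ih]
      rfl
  have e3 : encode (⟨n, ar, rules⟩ : TRSInstance) = Nat.pair n (Nat.pair (encode ar) (encode rules)) := rfl
  rw [e3, e1, e2]
  simp only [RawInstance.code, TRSInstance.raw, List.map_map, List.length_ofFn, Function.comp_def,
    encToks_toks]
  congr 3
  apply List.ext_getElem
  · simp
  · intro i h1 h2
    rw [List.length_ofFn] at h2
    simp [List.getElem?_ofFn, h2]

/-- The rules of a raw instance are well formed. -/
def RawInstance.Wf (ρ : RawInstance) : Prop := ∀ r ∈ ρ.2, WfToks ρ.1 r.1 ∧ WfToks ρ.1 r.2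

theorem TRSInstance.wf_raw (inst : TRSInstance) : inst.raw.Wf := by
  intro r hr
  obtain ⟨r, -, rfl⟩ := List.mem_map.1 hr
  exact ⟨wfToks_toks _, wfToks_toks _⟩

theorem RawInstance.Wf.exists_inst {ρ : RawInstance} (h : ρ.Wf) : ∃ inst : TRSInstance, inst.raw = ρ := by
  obtain ⟨L, rules⟩ := ρ
  have : ∃ rs : List (Tm (Fin L.length) (fun i => L[i]) ℕ × Tm (Fin L.length) (fun i => L[i]) ℕ),
      rs.map (fun r => (r.1.toks, r.2.toks)) = rules := by
    have hL : L = List.ofFn fun i : Fin L.length => L[i] := by simp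
    induction rules with
    | nil => exact ⟨[], rfl⟩
    | cons r rules ih =>
      obtain ⟨rs, rfl⟩ := ih fun r hr => h r (List.mem_cons_of_mem _ hr)
      obtain ⟨h1, h2⟩ := h r (List.mem_cons_self)
      dsimp only at h1 h2
      rw [hL] at h1 h2
      obtain ⟨t1, e1⟩ := h1.exists_term
      obtain ⟨t2, e2⟩ := h2.exists_term
      exact ⟨(t1, t2) :: rs, by rw [List.map_cons, ← e1, ← e2]⟩
  obtain ⟨rs, rfl⟩ := this
  refine ⟨⟨L.length, fun i => L[i], rs⟩, Prod.ext ?_ rfl⟩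
  simp [TRSInstance.raw]

/-- The free algebra of codes of ground terms. -/
def codeAlg (f : ℕ) (l : List ℕ) : Option ℕ := some (Nat.pair f (encode l))

/-- The partial algebra given by a transition table. -/
def tableAlg (T : List (ℕ × ℕ)) (f : ℕ) (l : List ℕ) : Option ℕ := T.lookup (Nat.pair f (encode l))

/-- The prefix notation is not that of a variable. -/
def NonvarToks (w : List (ℕ ⊕ ℕ)) : Prop :=
  (w.head?.map (Sum.elim (fun _ => 1) fun _ => 0)).getD 0 = 1

/-- The fact `s.1` follows from the facts `acc` in one step, with substitution `s.2`. -/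
def Just (ρ : RawInstance) (c₀ : ℕ) (s : (ℕ × ℕ) × List ℕ) (acc : List (ℕ × ℕ)) : Prop :=
  s.1 = (c₀, c₀) ∨ (s.1.2, s.1.1) ∈ acc ∨ (∃ p ∈ acc, p.1 = s.1.1 ∧ (p.2, s.1.2) ∈ acc) ∨
  ((s.1.1, s.1.1) ∈ acc ∧ s.1.1.unpair.1 = s.1.2.unpair.1 ∧
    (Denumerable.ofNat (List ℕ) s.1.1.unpair.2).length =
      (Denumerable.ofNat (List ℕ) s.1.2.unpair.2).length ∧
    ∀ k < (Denumerable.ofNat (List ℕ) s.1.1.unpair.2).length,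
      ((Denumerable.ofNat (List ℕ) s.1.1.unpair.2).getD k 0,
        (Denumerable.ofNat (List ℕ) s.1.2.unpair.2).getD k 0) ∈ acc) ∨
  (∃ p ∈ acc, p.1 = p.2 ∧ s.1.1 = s.1.2 ∧ s.1.1 ∈ Denumerable.ofNat (List ℕ) p.1.unpair.2) ∨
  ∃ r ∈ ρ.2, NonvarToks r.2 ∧ (s.1.1, s.1.1) ∈ acc ∧
    evalToks ρ.1 codeAlg (fun x => s.2[x]?) r.1 = some [s.1.1] ∧
    evalToks ρ.1 codeAlg (fun x => s.2[x]?) r.2 = some [s.1.2]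

open Classical in
/-- The facts established by a list of derivation steps. -/
noncomputable def derive (ρ : RawInstance) (c₀ : ℕ) (D : List ((ℕ × ℕ) × List ℕ)) : List (ℕ × ℕ) :=
  D.foldr (fun s acc => if Just ρ c₀ s acc then s.1 :: acc else acc) []

theorem Just.mono {ρ : RawInstance} {c₀ : ℕ} {s : (ℕ × ℕ) × List ℕ} {acc acc' : List (ℕ × ℕ)}
    (h : acc ⊆ acc') (hs : Just ρ c₀ s acc) : Just ρ c₀ s acc' := by
  rcases hs with h1 | h1 | ⟨p, h1, h2, h3⟩ | ⟨h1, h2, h3, h4⟩ | ⟨p, h1, h2⟩ | ⟨r, h1, h2, h3, h4⟩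
  · exact Or.inl h1
  · exact Or.inr (Or.inl (h h1))
  · exact Or.inr (Or.inr (Or.inl ⟨p, h h1, h2, h h3⟩))
  · exact Or.inr (Or.inr (Or.inr (Or.inl ⟨h h1, h2, h3, fun k hk => h (h4 k hk)⟩)))
  · exact Or.inr (Or.inr (Or.inr (Or.inr (Or.inl ⟨p, h h1, h2⟩))))
  · exact Or.inr (Or.inr (Or.inr (Or.inr (Or.inr ⟨r, h1, h2, h h3, h4⟩))))

theorem mem_derive_cons {ρ : RawInstance} {c₀ : ℕ} {s : (ℕ × ℕ) × List ℕ}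
    {D : List ((ℕ × ℕ) × List ℕ)} {p : ℕ × ℕ} :
    p ∈ derive ρ c₀ (s :: D) ↔ p ∈ derive ρ c₀ D ∨ p = s.1 ∧ Just ρ c₀ s (derive ρ c₀ D) := by
  unfold derive
  rw [List.foldr_cons]
  split_ifs with h
  · simp only [List.mem_cons, h, and_true]
    tauto
  · simp only [h, and_false, or_false]

theorem derive_append_right (ρ : RawInstance) (c₀ : ℕ) (D D' : List ((ℕ × ℕ) × List ℕ)) :
    derive ρ c₀ D' ⊆ derive ρ c₀ (D ++ D') := by
  induction D with
  | nil => exact fun _ h => h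
  | cons s D ih => exact fun p hp => mem_derive_cons.2 (Or.inl (ih hp))

theorem derive_append_left (ρ : RawInstance) (c₀ : ℕ) (D D' : List ((ℕ × ℕ) × List ℕ)) :
    derive ρ c₀ D ⊆ derive ρ c₀ (D ++ D') := by
  induction D with
  | nil => exact fun p hp => absurd hp List.not_mem_nil
  | cons s D ih =>
    intro p hp
    rcases mem_derive_cons.1 hp with h | ⟨h1, h2⟩
    · exact mem_derive_cons.2 (Or.inl (ih h))
    · exact mem_derive_cons.2 (Or.inr ⟨h1, h2.mono ih⟩)

theorem exists_derive_of_forall {ρ : RawInstance} {c₀ : ℕ} (l : List (ℕ × ℕ))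
    (h : ∀ p ∈ l, ∃ D, p ∈ derive ρ c₀ D) : ∃ D, ∀ p ∈ l, p ∈ derive ρ c₀ D := by
  induction l with
  | nil => exact ⟨[], by simp⟩
  | cons p l ih =>
    obtain ⟨D, hD⟩ := ih fun p hp => h p (List.mem_cons_of_mem _ hp)
    obtain ⟨D', hD'⟩ := h p List.mem_cons_self
    refine ⟨D' ++ D, fun q hq => ?_⟩
    rcases List.mem_cons.1 hq with rfl | hq
    · exact derive_append_left _ _ _ _ hD'
    · exact derive_append_right _ _ _ _ (hD q hq)

theorem exists_derive_of_just {ρ : RawInstance} {c₀ : ℕ} {s : (ℕ × ℕ) × List ℕ} (l : List (ℕ × ℕ))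
    (h : ∀ p ∈ l, ∃ D, p ∈ derive ρ c₀ D) (hs : Just ρ c₀ s l) : ∃ D, s.1 ∈ derive ρ c₀ D := by
  obtain ⟨D, hD⟩ := exists_derive_of_forall l h
  exact ⟨s :: D, mem_derive_cons.2 (Or.inr ⟨rfl, hs.mono hD⟩)⟩

section Codes

variable {n : ℕ} {ar : Fin n → ℕ}

/-- The code of a ground term. -/
def gcode : GTm (Fin n) ar → ℕ
  | .node f ts => Nat.pair f (encode (List.ofFn fun i => gcode (ts i)))

theorem ev_codeAlg_iff {t : GTm (Fin n) ar} : ∀ {c : ℕ}, t.Ev codeAlg (fun _ => none) c ↔ c = gcode t := by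
  induction t with
  | var e => exact e.elim
  | node f ts ih =>
    intro c
    simp only [Tm.Ev, ih, codeAlg, Option.some.injEq]
    constructor
    · rintro ⟨cs, h, rfl⟩
      obtain rfl : cs = fun i => gcode (ts i) := funext h
      rfl
    · rintro rfl
      exact ⟨_, fun i => rfl, rfl⟩

theorem gcode_injective : Function.Injective (gcode : GTm (Fin n) ar → ℕ) := by
  intro s
  induction s with
  | var e => exact e.elim
  | node f ts ih =>
    rintro (e | ⟨g, us⟩) h
    · exact e.elim
    · obtain ⟨h1, h2⟩ := Nat.pair_eq_pair.1 h
      obtain rfl := Fin.ext h1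
      have h3 := List.ofFn_injective (encode_injective h2)
      exact congrArg _ (funext fun i => ih i (congrFun h3 i))

theorem nonvarToks_iff {t : Tm (Fin n) ar ℕ} : NonvarToks t.toks ↔ ∃ f ts, t = .node f ts := by
  cases t with
  | var v => simp [NonvarToks, Tm.toks]
  | node f ts => simp [NonvarToks, Tm.toks]

theorem gcode_args {f : Fin n} {ts : Fin (ar f) → GTm (Fin n) ar} :
    Denumerable.ofNat (List ℕ) (gcode (.node f ts)).unpair.2 = List.ofFn fun i => gcode (ts i) := by
  simp only [gcode, Nat.unpair_pair]
  exact Denumerable.ofNat_encode _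

/-- Decomposing an evaluation of a pattern to the code of a ground term. -/
theorem exists_subst_of_ev_codeAlg {σ : ℕ → Option ℕ} {t : Tm (Fin n) ar ℕ} :
    ∀ {a : GTm (Fin n) ar}, t.Ev codeAlg σ (gcode a) →
      ∃ s : ℕ → GTm (Fin n) ar, a = t.subst s ∧ ∀ x ∈ t.vars, σ x = some (gcode (s x)) := by
  classical
  induction t with
  | var v =>
    intro a h
    exact ⟨fun _ => a, rfl, by rintro x rfl; exact h⟩
  | node f ts ih =>
    rintro (e | ⟨g, us⟩) ⟨cs, h1, h2⟩
    · exact e.elim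
    · obtain ⟨h3, h4⟩ := Nat.pair_eq_pair.1 (Option.some.inj h2)
      obtain rfl := Fin.ext h3
      have h5 := List.ofFn_injective (encode_injective h4)
      subst h5
      choose s hs hσ using fun i => ih i (h1 i)
      have h6 : ∀ x, ∃ b : GTm (Fin n) ar, x ∈ (Tm.node f ts).vars → σ x = some (gcode b) := by
        intro x
        by_cases hx : x ∈ (Tm.node f ts).vars
        · obtain ⟨i, hi⟩ := Set.mem_iUnion.1 hx
          exact ⟨s i x, fun _ => hσ i x hi⟩
        · exact ⟨.node f us, fun h => absurd h hx⟩
      choose s' hs' using h6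
      refine ⟨s', ?_, hs'⟩
      simp only [Tm.subst]
      congr 1
      funext i
      have h7 : ∀ (t : Tm (Fin n) ar ℕ) (s s' : ℕ → GTm (Fin n) ar), (∀ x ∈ t.vars, s x = s' x) →
          t.subst s = t.subst s' := by
        intro t s s'
        induction t with
        | var v => exact fun h => h v rfl
        | node f ts ih =>
          exact fun h => congrArg _ (funext fun i => ih i fun x hx => h x (Set.mem_iUnion.2 ⟨i, hx⟩))
      rw [hs i]
      refine h7 _ _ _ fun x hx => gcode_injective (Option.some.inj ?_)
      rw [← hσ i x hx]
      exact hs' x (Set.mem_iUnion.2 ⟨i, hx⟩)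

theorem ev_codeAlg_subst {σ : ℕ → Option ℕ} {t : Tm (Fin n) ar ℕ} {s : ℕ → GTm (Fin n) ar}
    (h : ∀ x ∈ t.vars, σ x = some (gcode (s x))) : t.Ev codeAlg σ (gcode (t.subst s)) := by
  induction t with
  | var v => exact h v rfl
  | node f ts ih =>
    exact ⟨_, fun i => ih i fun x hx => h x (Set.mem_iUnion.2 ⟨i, hx⟩), rfl⟩

end Codes

section Derive

variable (inst : TRSInstance)

theorem der_of_mem_derive (hvar : ∀ r ∈ inst.2.2, r.2.vars ⊆ r.1.vars) (t : GTm (Fin inst.1) inst.2.1)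
    {D : List ((ℕ × ℕ) × List ℕ)} : ∀ {p : ℕ × ℕ},
    p ∈ derive inst.raw (gcode t) D → ∃ a b : GTm (Fin inst.1) inst.2.1, p = (gcode a, gcode b) ∧
      Der {r | r ∈ inst.2.2} t a b := by
  induction D with
  | nil => exact fun hp => absurd hp List.not_mem_nil
  | cons s D ih =>
    intro p hp
    rcases mem_derive_cons.1 hp with h | ⟨rfl, h⟩
    · exact ih h
    have ih' : ∀ {i j : ℕ}, (i, j) ∈ derive inst.raw (gcode t) D →
        ∃ a b : GTm (Fin inst.1) inst.2.1, i = gcode a ∧ j = gcode b ∧ Der {r | r ∈ inst.2.2} t a b := by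
      intro i j hij
      obtain ⟨a, b, h1, h2⟩ := ih hij
      obtain ⟨rfl, rfl⟩ := Prod.mk.inj h1
      exact ⟨a, b, rfl, rfl, h2⟩
    obtain ⟨⟨i, j⟩, l⟩ := s
    rcases h with h | h | ⟨⟨k, m⟩, h1, h2, h3⟩ | ⟨h1, h2, h3, h4⟩ | ⟨⟨k, m⟩, h1, h2, h3, h4⟩ | ⟨r, h1, h2, h3, h4, h5⟩
    · exact ⟨t, t, h, .init⟩
    · obtain ⟨a, b, rfl, rfl, hab⟩ := ih' h
      exact ⟨b, a, rfl, hab.symm⟩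
    · obtain ⟨a, b, rfl, rfl, hab⟩ := ih' h1
      obtain ⟨b', c, hb, rfl, hbc⟩ := ih' h3
      obtain rfl := gcode_injective hb
      dsimp only at h2
      exact ⟨a, c, by rw [h2], hab.trans hbc⟩
    · obtain ⟨a, b, rfl, hb, hab⟩ := ih' h1
      obtain rfl := gcode_injective hb
      rcases a with e | ⟨f, ts⟩
      · exact e.elim
      dsimp only at h2 h3 h4
      simp only [gcode_args] at h3 h4
      rw [List.length_ofFn] at h3 h4
      have h5 : ∀ k : Fin (inst.2.1 f), ∃ b, (Denumerable.ofNat (List ℕ) j.unpair.2).getD k 0 = gcode b ∧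
          Der {r | r ∈ inst.2.2} t (ts k) b := by
        intro k
        obtain ⟨a, b, ha, hb, hab⟩ := ih' (h4 k k.2)
        rw [List.getD_eq_getElem _ _ (by simp), List.getElem_ofFn] at ha
        obtain rfl := gcode_injective ha
        exact ⟨b, hb, hab⟩
      choose us hus hder using h5
      refine ⟨.node f ts, .node f us, ?_, .congr hder hab⟩
      refine Prod.ext rfl ?_
      show j = _
      rw [← Nat.pair_unpair j, ← h2]
      simp only [gcode, Nat.unpair_pair]
      congr 1
      rw [← Denumerable.encode_ofNat (α := List ℕ) j.unpair.2]
      congr 1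
      apply List.ext_getElem
      · rw [← h3, List.length_ofFn]
      · intro i h5 h6
        rw [List.getElem_ofFn, ← hus, List.getD_eq_getElem _ _ h5]
    · obtain ⟨a, b, rfl, rfl, hab⟩ := ih' h1
      obtain rfl := gcode_injective h2
      dsimp only at h3 h4
      subst h3
      rcases a with e | ⟨f, ts⟩
      · exact e.elim
      rw [gcode_args, List.mem_ofFn] at h4
      obtain ⟨k, rfl⟩ := h4
      exact ⟨ts k, ts k, rfl, .reach k hab⟩
    · obtain ⟨a, b, ha, hb, hab⟩ := ih' h3
      dsimp only at ha hb h4 h5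
      subst ha
      obtain rfl := gcode_injective hb
      obtain ⟨⟨l, r⟩, hr, rfl⟩ := List.mem_map.1 h1
      dsimp only at h2 h4 h5
      obtain ⟨f, ts, rfl⟩ := nonvarToks_iff.1 h2
      have h6 := (evalToks_toks_singleton _ _ _ _).1 h4
      have h7 := (evalToks_toks_singleton _ _ _ _).1 h5
      obtain ⟨s, rfl, hs⟩ := exists_subst_of_ev_codeAlg h6
      have h8 := ev_codeAlg_subst (t := .node f ts) (s := s) fun x hx => hs x (hvar _ hr hx)
      obtain rfl := h7.functional h8
      exact ⟨_, _, rfl, .rule hr s hab⟩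

theorem exists_derive_of_der (hvar : ∀ r ∈ inst.2.2, r.2.vars ⊆ r.1.vars) (t : GTm (Fin inst.1) inst.2.1)
    {a b : GTm (Fin inst.1) inst.2.1} (h : Der {r | r ∈ inst.2.2} t a b) :
    ∃ D, (gcode a, gcode b) ∈ derive inst.raw (gcode t) D := by
  induction h with
  | init => exact exists_derive_of_just (s := ((_, _), [])) [] (by simp) (Or.inl rfl)
  | @symm a b _ ih =>
    exact exists_derive_of_just (s := ((_, _), [])) [(gcode a, gcode b)] (by simpa using ih)
      (Or.inr (Or.inl (by simp)))
  | @trans a b c _ _ ih1 ih2 =>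
    exact exists_derive_of_just (s := ((_, _), [])) [(gcode a, gcode b), (gcode b, gcode c)]
      (by simpa using ⟨ih1, ih2⟩)
      (Or.inr (Or.inr (Or.inl ⟨(gcode a, gcode b), by simp, rfl, by simp⟩)))
  | @congr f s s' _ _ ih1 ih2 =>
    refine exists_derive_of_just (s := ((_, _), [])) ((gcode (.node f s), gcode (.node f s)) ::
      List.ofFn fun i => (gcode (s i), gcode (s' i))) ?_
      (Or.inr (Or.inr (Or.inr (Or.inl ⟨by simp, ?_, ?_, ?_⟩))))
    · intro p hp
      rcases List.mem_cons.1 hp with rfl | hp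
      · exact ih2
      · obtain ⟨i, rfl⟩ := List.mem_ofFn.1 hp
        exact ih1 i
    · simp [gcode]
    · simp only [gcode_args, List.length_ofFn]
    · simp only [gcode_args, List.length_ofFn]
      intro k hk
      refine List.mem_cons_of_mem _ (List.mem_ofFn.2 ⟨⟨k, hk⟩, ?_⟩)
      rw [List.getD_eq_getElem _ _ (by simpa using hk), List.getD_eq_getElem _ _ (by simpa using hk),
        List.getElem_ofFn, List.getElem_ofFn]
  | @reach f s i _ ih =>
    refine exists_derive_of_just (s := ((_, _), [])) [(gcode (.node f s), gcode (.node f s))]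
      (by simpa using ih)
      (Or.inr (Or.inr (Or.inr (Or.inr (Or.inl ⟨_, List.mem_singleton_self _, rfl, rfl, ?_⟩)))))
    rw [gcode_args, List.mem_ofFn]
    exact ⟨i, rfl⟩
  | @rule l f ts hr σ _ ih =>
    obtain ⟨N, hN⟩ : ∃ N, ∀ x ∈ l.vars, x < N := by
      obtain ⟨N, hN⟩ : BddAbove l.vars := by
        refine Set.Finite.bddAbove ?_
        refine ((List.finite_toSet l.toks).image (Sum.elim id id)).subset fun x hx => ?_
        exact ⟨Sum.inr x, mem_toks_inr.2 hx, rfl⟩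
      exact ⟨N + 1, fun x hx => Nat.lt_succ_of_le (hN hx)⟩
    have hs : ∀ x ∈ l.vars, (List.ofFn fun i : Fin N => gcode (σ i))[x]? = some (gcode (σ x)) := by
      intro x hx
      simp [hN x hx]
    refine exists_derive_of_just (s := ((_, _), List.ofFn fun i : Fin N => gcode (σ i)))
      [(gcode (l.subst σ), gcode (l.subst σ))] (by simpa using ih)
      (Or.inr (Or.inr (Or.inr (Or.inr (Or.inr ⟨(l.toks, (Tm.node f ts).toks),
        List.mem_map.2 ⟨_, hr, rfl⟩, nonvarToks_iff.2 ⟨f, ts, rfl⟩, List.mem_singleton_self _, ?_, ?_⟩)))))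
    · exact (evalToks_toks_singleton _ _ _ _).2 (ev_codeAlg_subst hs)
    · exact (evalToks_toks_singleton _ _ _ _).2 (ev_codeAlg_subst fun x hx => hs x (hvar _ hr hx))

end Derive

/-- The lists of length `N` with entries in `S`. -/
def assigns (S : List ℕ) : ℕ → List (List ℕ)
  | 0 => [[]]
  | N + 1 => (assigns S N).flatMap fun s => S.map fun x => x :: s

theorem mem_assigns {S : List ℕ} : ∀ {N : ℕ} {s : List ℕ}, s ∈ assigns S N ↔ s.length = N ∧ ∀ x ∈ s, x ∈ S
  | 0, s => by
    simp only [assigns, List.mem_singleton, List.length_eq_zero_iff]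
    constructor
    · rintro rfl
      simp
    · exact fun h => h.1
  | N + 1, s => by
    simp only [assigns, List.mem_flatMap, List.mem_map]
    constructor
    · rintro ⟨s', h, x, hx, rfl⟩
      obtain ⟨h1, h2⟩ := mem_assigns.1 h
      exact ⟨by simp [h1], by simpa using ⟨hx, h2⟩⟩
    · rintro ⟨h1, h2⟩
      cases s with
      | nil => simp at h1
      | cons x s =>
        exact ⟨s, mem_assigns.2 ⟨by simpa using h1, fun y hy => h2 y (List.mem_cons_of_mem _ hy)⟩, x,
          h2 x List.mem_cons_self, rfl⟩

/-- `T` is the transition table of a finite E-graph which is a model of the rules of `ρ`, contains the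
ground term with prefix notation `a` and code `c₀`, and consists of facts established by `D`. -/
def ModelOk (ρ : RawInstance) (c₀ : ℕ) (a : List (ℕ ⊕ ℕ)) (T : List (ℕ × ℕ)) (N : ℕ)
    (D : List ((ℕ × ℕ) × List ℕ)) : Prop :=
  (∀ p ∈ T, p ∈ derive ρ c₀ D) ∧ (evalToks ρ.1 (tableAlg T) (fun _ => none) a).isSome = true ∧
  (∀ r ∈ ρ.2, ∀ x ∈ r.1, Sum.elim (fun _ => 0) (fun v => v + 1) x ≤ N) ∧
  ∀ s ∈ assigns (T.map Prod.snd) N, ∀ r ∈ ρ.2, NonvarToks r.2 →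
    (evalToks ρ.1 (tableAlg T) (fun x => s[x]?) r.1).isSome = true →
    evalToks ρ.1 (tableAlg T) (fun x => s[x]?) r.2 = evalToks ρ.1 (tableAlg T) (fun x => s[x]?) r.1

theorem mem_of_lookup {T : List (ℕ × ℕ)} {k v : ℕ} (h : T.lookup k = some v) : (k, v) ∈ T := by
  obtain ⟨l₁, l₂, rfl, -⟩ := List.lookup_eq_some_iff.1 h
  simp

theorem lookup_eq_of_mem {T : List (ℕ × ℕ)} (hT : ∀ k v v', (k, v) ∈ T → (k, v') ∈ T → v = v') {k v : ℕ}
    (h : (k, v) ∈ T) : T.lookup k = some v := by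
  cases h' : T.lookup k with
  | none =>
    have := List.lookup_eq_none_iff.1 h' _ h
    simp at this
  | some v' => rw [hT _ _ _ h (mem_of_lookup h')]

section Model

variable (inst : TRSInstance)

theorem ev_value_mem {T : List (ℕ × ℕ)} {a : GTm (Fin inst.1) inst.2.1} {c : ℕ}
    (h : a.Ev (tableAlg T) (fun _ => none) c) : c ∈ T.map Prod.snd := by
  cases a with
  | var e => exact e.elim
  | node f ts =>
    obtain ⟨cs, -, h⟩ := h
    exact List.mem_map.2 ⟨_, mem_of_lookup h, rfl⟩

theorem isSome_evalToks_iff {alg : ℕ → List ℕ → Option ℕ} {σ : ℕ → Option ℕ} {V : Type} [Encodable V]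
    {u : Tm (Fin inst.1) inst.2.1 V} : (evalToks inst.raw.1 alg σ u.toks).isSome = true ↔ ∃ c, u.Ev alg σ c := by
  rw [Option.isSome_iff_exists]
  constructor
  · rintro ⟨st, h⟩
    obtain ⟨c, h, -⟩ := (evalToks_toks _ _ _ _).1 h
    exact ⟨c, h⟩
  · rintro ⟨c, h⟩
    exact ⟨_, (evalToks_toks_singleton _ _ _ _).2 h⟩

theorem ev_of_der (hvar : ∀ r ∈ inst.2.2, r.2.vars ⊆ r.1.vars) (t : GTm (Fin inst.1) inst.2.1)
    {T : List (ℕ × ℕ)} {N : ℕ} {D : List ((ℕ × ℕ) × List ℕ)}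
    (h : ModelOk inst.raw (gcode t) t.toks T N D) {a b : GTm (Fin inst.1) inst.2.1}
    (hab : Der {r | r ∈ inst.2.2} t a b) :
    ∃ c, a.Ev (tableAlg T) (fun _ => none) c ∧ b.Ev (tableAlg T) (fun _ => none) c := by
  classical
  obtain ⟨-, h2, h3, h4⟩ := h
  obtain ⟨d, hd⟩ := (isSome_evalToks_iff inst).1 h2
  induction hab with
  | init => exact ⟨d, hd, hd⟩
  | symm _ ih =>
    obtain ⟨c, h1, h2⟩ := ih
    exact ⟨c, h2, h1⟩
  | trans _ _ ih1 ih2 =>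
    obtain ⟨c, h1, h2⟩ := ih1
    obtain ⟨c', h3, h4⟩ := ih2
    obtain rfl := h2.functional h3
    exact ⟨c, h1, h4⟩
  | congr _ _ ih1 ih2 =>
    obtain ⟨c, ⟨cs, h5, h6⟩, -⟩ := ih2
    refine ⟨c, ⟨cs, h5, h6⟩, cs, fun i => ?_, h6⟩
    obtain ⟨c', h7, h8⟩ := ih1 i
    obtain rfl := (h5 i).functional h7
    exact h8
  | reach i _ ih =>
    obtain ⟨c, ⟨cs, h5, h6⟩, -⟩ := ih
    exact ⟨_, h5 i, h5 i⟩
  | @rule l f ts hr σ _ ih =>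
    obtain ⟨c, h5, -⟩ := ih
    refine ⟨c, h5, ?_⟩
    obtain ⟨τ, hτ, h6⟩ := Tm.ev_subst_nat.1 h5
    set s : List ℕ := List.ofFn fun i : Fin N => if (i : ℕ) ∈ l.vars then τ i else d with hs
    have hs1 : s ∈ assigns (T.map Prod.snd) N := by
      refine mem_assigns.2 ⟨by simp [hs], fun x hx => ?_⟩
      obtain ⟨i, rfl⟩ := List.mem_ofFn.1 hx
      split_ifs with hi
      · exact ev_value_mem inst (hτ i hi)
      · exact ev_value_mem inst hd
    have hmem : (l.toks, (Tm.node f ts).toks) ∈ inst.raw.2 := List.mem_map.2 ⟨_, hr, rfl⟩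
    have hs2 : ∀ x ∈ l.vars, s[x]? = some (τ x) := by
      intro x hx
      have hxN : x < N := h3 _ hmem (Sum.inr x) (mem_toks_inr.2 hx)
      simp [hs, hxN, hx]
    have h7 : l.Ev (tableAlg T) (fun x => s[x]?) c := Tm.Ev.congr (fun x hx => (hs2 x hx).symm) h6
    have h8 := h4 s hs1 _ hmem (nonvarToks_iff.2 ⟨f, ts, rfl⟩) ((isSome_evalToks_iff inst).2 ⟨c, h7⟩)
    dsimp only at h8
    have h9 : evalToks inst.raw.1 (tableAlg T) (fun x => s[x]?) l.toks = some [c] :=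
      (evalToks_toks_singleton _ _ _ _).2 h7
    rw [h9] at h8
    have h10 := (evalToks_toks_singleton _ _ _ _).1 h8
    exact Tm.ev_subst_nat.2 ⟨τ, fun v hv => hτ v (hvar _ hr hv),
      Tm.Ev.congr (fun x hx => hs2 x (hvar _ hr hx)) h10⟩

theorem der_of_ev (hvar : ∀ r ∈ inst.2.2, r.2.vars ⊆ r.1.vars) (t : GTm (Fin inst.1) inst.2.1)
    {T : List (ℕ × ℕ)} {D : List ((ℕ × ℕ) × List ℕ)}
    (hT : ∀ p ∈ T, p ∈ derive inst.raw (gcode t) D) {a : GTm (Fin inst.1) inst.2.1} :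
    ∀ {c : ℕ}, a.Ev (tableAlg T) (fun _ => none) c →
      ∃ w, gcode w = c ∧ Der {r | r ∈ inst.2.2} t a w := by
  induction a with
  | var e => exact e.elim
  | node f ts ih =>
    rintro c ⟨cs, h1, h2⟩
    obtain ⟨a, w, h3, h4⟩ := der_of_mem_derive inst hvar t (hT _ (mem_of_lookup h2))
    obtain ⟨h5, rfl⟩ := Prod.mk.inj h3
    rcases a with e | ⟨g, us⟩
    · exact e.elim
    obtain ⟨h6, h7⟩ := Nat.pair_eq_pair.1 h5
    obtain rfl := Fin.ext h6
    have h8 := List.ofFn_injective (encode_injective h7)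
    subst h8
    refine ⟨w, rfl, ?_⟩
    have h9 : ∀ i, Der {r | r ∈ inst.2.2} t (us i) (ts i) := by
      intro i
      obtain ⟨v, h10, h11⟩ := ih i (h1 i)
      obtain rfl := gcode_injective h10
      exact h11.symm
    exact (Der.congr h9 (h4.trans h4.symm)).symm.trans h4

theorem finIdx_of_modelOk (hvar : ∀ r ∈ inst.2.2, r.2.vars ⊆ r.1.vars) (t : GTm (Fin inst.1) inst.2.1)
    {T : List (ℕ × ℕ)} {N : ℕ} {D : List ((ℕ × ℕ) × List ℕ)}
    (h : ModelOk inst.raw (gcode t) t.toks T N D) : FinIdx (Der {r | r ∈ inst.2.2} t) := by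
  refine ⟨{w | gcode w ∈ T.map Prod.snd}, ?_, fun a ha => ?_⟩
  · exact (List.finite_toSet (T.map Prod.snd)).preimage gcode_injective.injOn
  · obtain ⟨c, h1, -⟩ := ev_of_der inst hvar t h ha
    obtain ⟨w, rfl, hw⟩ := der_of_ev inst hvar t h.1 h1
    exact ⟨w, ev_value_mem inst h1, hw⟩

theorem exists_modelOk (hvar : ∀ r ∈ inst.2.2, r.2.vars ⊆ r.1.vars) (t : GTm (Fin inst.1) inst.2.1)
    (h : FinIdx (Der {r | r ∈ inst.2.2} t)) :
    ∃ T N D, ModelOk inst.raw (gcode t) t.toks T N D := by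
  obtain ⟨W, hW, hWa⟩ := h
  have : Nonempty (GTm (Fin inst.1) inst.2.1) := ⟨t⟩
  let rep : GTm (Fin inst.1) inst.2.1 → GTm (Fin inst.1) inst.2.1 :=
    fun a => Classical.epsilon fun w => w ∈ W ∧ Der {r | r ∈ inst.2.2} t a w
  have hrep : ∀ a, Der {r | r ∈ inst.2.2} t a a → rep a ∈ W ∧ Der {r | r ∈ inst.2.2} t a (rep a) :=
    fun a ha => Classical.epsilon_spec (hWa a ha)
  have hrep_eq : ∀ a b, Der {r | r ∈ inst.2.2} t a b → rep a = rep b := by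
    intro a b hab
    show Classical.epsilon _ = Classical.epsilon _
    congr 1
    funext w
    exact propext (and_congr_right fun _ => ⟨fun h => hab.symm.trans h, fun h => hab.trans h⟩)
  set P : Set (GTm (Fin inst.1) inst.2.1) := {p | Der {r | r ∈ inst.2.2} t p p ∧ ∃ f s, p = .node f s ∧
    ∀ i, s i ∈ W} with hP
  have hPfin : P.Finite := by
    have : (⋃ f : Fin inst.1, (fun s => (Tm.node f s : GTm (Fin inst.1) inst.2.1)) ''
        Set.pi Set.univ fun _ : Fin (inst.2.1 f) => W).Finite :=
      Set.finite_iUnion fun f => (Set.Finite.pi' fun _ => hW).subset (by intro s hs i; exact hs i trivial) |>.image _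
    refine this.subset ?_
    rintro p ⟨-, f, s, rfl, hs⟩
    exact Set.mem_iUnion.2 ⟨f, s, fun i _ => hs i, rfl⟩
  obtain ⟨T, hT⟩ : ∃ T : List (ℕ × ℕ), ∀ x, x ∈ T ↔ ∃ p ∈ P, (gcode p, gcode (rep p)) = x :=
    ⟨(hPfin.image fun p => (gcode p, gcode (rep p))).toFinset.toList, fun x => by simp⟩
  have hlook : ∀ k v, T.lookup k = some v ↔ ∃ p ∈ P, gcode p = k ∧ gcode (rep p) = v := by
    intro k v
    constructor
    · intro h
      obtain ⟨p, hp, h⟩ := (hT _).1 (mem_of_lookup h)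
      obtain ⟨rfl, rfl⟩ := Prod.mk.inj h
      exact ⟨p, hp, rfl, rfl⟩
    · rintro ⟨p, hp, rfl, rfl⟩
      refine lookup_eq_of_mem ?_ ((hT _).2 ⟨p, hp, rfl⟩)
      intro k v v' h1 h2
      obtain ⟨p, -, h1⟩ := (hT _).1 h1
      obtain ⟨q, -, h2⟩ := (hT _).1 h2
      obtain ⟨rfl, rfl⟩ := Prod.mk.inj h1
      obtain ⟨h3, rfl⟩ := Prod.mk.inj h2
      rw [gcode_injective h3]
  have hev : ∀ (a : GTm (Fin inst.1) inst.2.1) (c : ℕ), a.Ev (tableAlg T) (fun _ => none) c ↔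
      Der {r | r ∈ inst.2.2} t a a ∧ c = gcode (rep a) := by
    intro a
    induction a with
    | var e => exact e.elim
    | node f ts ih =>
      intro c
      constructor
      · rintro ⟨cs, h1, h2⟩
        obtain ⟨p, ⟨hp, -⟩, h3, h4⟩ := (hlook _ _).1 h2
        have h5 : p = .node f fun i => rep (ts i) := by
          refine gcode_injective (h3.trans ?_)
          simp only [gcode]
          congr 3
          funext i
          exact ((ih i _).1 (h1 i)).2
        subst h5
        have h6 := Der.congr (fun i => (hrep _ ((ih i _).1 (h1 i)).1).2.symm) hp
        exact ⟨h6.symm.trans h6, by rw [← h4, hrep_eq _ _ h6]⟩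
      · rintro ⟨h1, rfl⟩
        have h2 : ∀ i, Der {r | r ∈ inst.2.2} t (ts i) (ts i) := fun i => .reach i h1
        refine ⟨fun i => gcode (rep (ts i)), fun i => (ih i _).2 ⟨h2 i, rfl⟩, ?_⟩
        have h3 := Der.congr (fun i => (hrep _ (h2 i)).2) h1
        refine (hlook _ _).2 ⟨.node f fun i => rep (ts i), ⟨h3.symm.trans h3, f, _, rfl,
          fun i => (hrep _ (h2 i)).1⟩, rfl, ?_⟩
        rw [hrep_eq _ _ h3]
  obtain ⟨D, hD⟩ := exists_derive_of_forall (ρ := inst.raw) (c₀ := gcode t) T (by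
    intro x hx
    obtain ⟨p, ⟨hp, -⟩, rfl⟩ := (hT _).1 hx
    exact exists_derive_of_der inst hvar t (hrep p hp).2)
  obtain ⟨N, hN⟩ : ∃ N, ∀ r ∈ inst.raw.2, ∀ x ∈ r.1, Sum.elim (fun _ => 0) (fun v => v + 1) x ≤ N := by
    obtain ⟨N, hN⟩ := ((List.finite_toSet (inst.raw.2.flatMap Prod.fst)).image
      (Sum.elim (fun _ => 0) (fun v => v + 1))).bddAbove
    exact ⟨N, fun r hr x hx => hN ⟨x, List.mem_flatMap.2 ⟨r, hr, hx⟩, rfl⟩⟩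
  refine ⟨T, N, D, hD, (isSome_evalToks_iff inst).2 ⟨_, (hev t _).2 ⟨.init, rfl⟩⟩, hN, ?_⟩
  intro s hs r hr hnv hsome
  obtain ⟨⟨l, r⟩, hr', rfl⟩ := List.mem_map.1 hr
  dsimp only at hnv hsome ⊢
  obtain ⟨f, ts, rfl⟩ := nonvarToks_iff.1 hnv
  obtain ⟨c, hc⟩ := (isSome_evalToks_iff inst).1 hsome
  obtain ⟨hs1, hs2⟩ := mem_assigns.1 hs
  have h1 : ∀ x, ∃ u : GTm (Fin inst.1) inst.2.1, x ∈ l.vars → s[x]? = some (gcode u) ∧ u.Ev (tableAlg T) (fun _ => none) (gcode u) := by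
    intro x
    by_cases hx : x ∈ l.vars
    · have hxN : x < s.length := by
        rw [hs1]
        exact hN _ hr (Sum.inr x) (mem_toks_inr.2 hx)
      obtain ⟨⟨k, v⟩, h2, h3⟩ := List.mem_map.1 (hs2 s[x] (List.getElem_mem _))
      obtain ⟨p, ⟨hp, -⟩, h4⟩ := (hT _).1 h2
      obtain ⟨rfl, rfl⟩ := Prod.mk.inj h4
      dsimp only at h3
      have h5 := (hrep p hp).2
      refine ⟨rep p, fun _ => ⟨by rw [List.getElem?_eq_getElem hxN, h3], (hev _ _).2 ⟨h5.symm.trans h5, ?_⟩⟩⟩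
      rw [← hrep_eq _ _ h5]
    · exact ⟨t, fun h => absurd h hx⟩
  choose u hu using h1
  have h2 : (l.subst u).Ev (tableAlg T) (fun _ => none) c :=
    Tm.ev_subst_nat.2 ⟨fun x => gcode (u x), fun v hv => (hu v hv).2,
      Tm.Ev.congr (fun x hx => (hu x hx).1) hc⟩
  obtain ⟨h3, rfl⟩ := (hev _ _).1 h2
  have h4 := Der.rule hr' u h3
  have h5 : ((Tm.node f ts).subst u).Ev (tableAlg T) (fun _ => none) (gcode (rep (l.subst u))) :=
    (hev _ _).2 ⟨h4.symm.trans h4, by rw [hrep_eq _ _ h4]⟩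
  obtain ⟨τ, h6, h7⟩ := Tm.ev_subst_nat.1 h5
  have h8 : (Tm.node f ts).Ev (tableAlg T) (fun x => s[x]?) (gcode (rep (l.subst u))) := by
    refine Tm.Ev.congr (fun x hx => ?_) h7
    show some (τ x) = s[x]?
    rw [Tm.Ev.functional (h6 x hx) (hu x (hvar _ hr' hx)).2]
    exact (hu x (hvar _ hr' hx)).1.symm
  exact ((evalToks_toks_singleton _ _ _ _).2 h8).trans ((evalToks_toks_singleton _ _ _ _).2 hc).symm

end Model

section Primitive

variable {α β γ : Type} [Primcodable α] [Primcodable β] [Primcodable γ]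

theorem primrecPred_exists_mem {L : γ → List α} (hL : Primrec L) {R : γ → α → Prop} (hR : PrimrecRel R) :
    PrimrecPred fun c => ∃ a ∈ L c, R c a :=
  (PrimrecRel.exists_mem_list (R := fun a c => R c a) hR.swap).comp hL .id

theorem primrecPred_forall_mem {L : γ → List α} (hL : Primrec L) {R : γ → α → Prop} (hR : PrimrecRel R) :
    PrimrecPred fun c => ∀ a ∈ L c, R c a :=
  (PrimrecRel.forall_mem_list (R := fun a c => R c a) hR.swap).comp hL .id

theorem primrecPred_forall_lt {N : γ → ℕ} (hN : Primrec N) {R : γ → ℕ → Prop} (hR : PrimrecRel R) :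
    PrimrecPred fun c => ∀ a < N c, R c a :=
  (primrecPred_forall_mem (Primrec.list_range.comp hN) hR).of_eq fun c => by simp

theorem primrecPred_mem {L : γ → List α} (hL : Primrec L) {f : γ → α} (hf : Primrec f) :
    PrimrecPred fun c => f c ∈ L c :=
  (primrecPred_exists_mem hL (R := fun c a => a = f c)
    (Primrec.eq.comp Primrec.snd (hf.comp Primrec.fst))).of_eq fun c => by simp

theorem PrimrecPred.imp {p q : γ → Prop} (hp : PrimrecPred p) (hq : PrimrecPred q) :
    PrimrecPred fun c => p c → q c :=
  (hp.not.or hq).of_eq fun c => by tauto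

theorem primrec_tokStep {L : γ → List ℕ} (hL : Primrec L) {alg : γ → ℕ → List α → Option α}
    (halg : Primrec fun p : γ × ℕ × List α => alg p.1 p.2.1 p.2.2) {σ : γ → ℕ → Option α} (hσ : Primrec₂ σ) :
    Primrec fun p : γ × (ℕ ⊕ ℕ) × Option (List α) => tokStep (L p.1) (alg p.1) (σ p.1) p.2.1 p.2.2 := by
  unfold tokStep
  refine Primrec.option_bind (Primrec.snd.comp Primrec.snd) ?_
  refine Primrec.sumCasesOn (Primrec.fst.comp (Primrec.snd.comp Primrec.fst)) ?_ ?_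
  · refine Primrec.option_bind (Primrec.list_getElem?.comp
      (hL.comp (Primrec.fst.comp (Primrec.fst.comp Primrec.fst))) Primrec.snd) ?_
    refine Primrec.ite (PrimrecRel.comp Primrec.nat_le Primrec.snd (Primrec.list_length.comp
      (Primrec.snd.comp (Primrec.fst.comp Primrec.fst)))) ?_ (Primrec.const none)
    refine Primrec.option_map ?_ ?_
    · exact halg.comp ((Primrec.fst.comp (Primrec.fst.comp (Primrec.fst.comp Primrec.fst))).pair
        ((Primrec.snd.comp Primrec.fst).pair (Primrec.list_take.comp Primrec.snd
          (Primrec.snd.comp (Primrec.fst.comp Primrec.fst)))))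
    · exact Primrec.list_cons.comp Primrec.snd (Primrec.list_drop.comp (Primrec.snd.comp Primrec.fst)
        (Primrec.snd.comp (Primrec.fst.comp (Primrec.fst.comp Primrec.fst))))
  · refine Primrec.option_map (hσ.comp (Primrec.fst.comp (Primrec.fst.comp Primrec.fst)) Primrec.snd) ?_
    exact Primrec.list_cons.comp Primrec.snd (Primrec.snd.comp (Primrec.fst.comp Primrec.fst))

theorem primrec_evalToks {L : γ → List ℕ} (hL : Primrec L) {alg : γ → ℕ → List α → Option α}
    (halg : Primrec fun p : γ × ℕ × List α => alg p.1 p.2.1 p.2.2) {σ : γ → ℕ → Option α} (hσ : Primrec₂ σ)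
    {w : γ → List (ℕ ⊕ ℕ)} (hw : Primrec w) :
    Primrec fun c => evalToks (L c) (alg c) (σ c) (w c) :=
  Primrec.list_foldr hw (Primrec.const (some [])) (primrec_tokStep hL halg hσ).to₂

theorem primrec_codeAlg : Primrec fun p : ℕ × List ℕ => codeAlg p.1 p.2 :=
  Primrec.option_some.comp (Primrec₂.natPair.comp Primrec.fst (Primrec.encode.comp Primrec.snd))

theorem primrec_tableAlg : Primrec fun p : List (ℕ × ℕ) × ℕ × List ℕ => tableAlg p.1 p.2.1 p.2.2 :=
  Primrec.listLookup.comp (Primrec₂.natPair.comp (Primrec.fst.comp Primrec.snd)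
    (Primrec.encode.comp (Primrec.snd.comp Primrec.snd))) Primrec.fst

theorem primrec_encAlg : Primrec fun p : ℕ × List (ℕ × ℕ) => encAlg p.1 p.2 := by
  refine Primrec.option_some.comp (Primrec.pair (Primrec.succ.comp ?_) (Primrec₂.natPair.comp ?_ ?_))
  · exact Primrec.list_foldr (Primrec.list_map Primrec.snd (Primrec.fst.comp₂ Primrec₂.right))
      (Primrec.const 0) (Primrec.nat_max.comp₂ (Primrec.fst.comp₂ Primrec₂.right)
        (Primrec.snd.comp₂ Primrec₂.right))
  · exact Primrec.nat_mul.comp Primrec.fst (Primrec.const 2)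
  · refine Primrec.encode.comp (Primrec.list_map (Primrec.list_range.comp
      (Primrec.list_length.comp Primrec.snd)) ?_)
    exact Primrec₂.natPair.comp Primrec.snd (Primrec.snd.comp ((Primrec.list_getD (0, 0)).comp
      (Primrec.snd.comp Primrec.fst) Primrec.snd))

theorem primrec_encVar : Primrec encVar :=
  Primrec.option_some.comp (Primrec.pair (Primrec.const 1) (Primrec₂.natPair.comp
    (Primrec.succ.comp (Primrec.nat_mul.comp Primrec.id (Primrec.const 2))) (Primrec.const 0)))

theorem primrec_evalToks_enc : Primrec fun p : List ℕ × List (ℕ ⊕ ℕ) => evalToks p.1 encAlg encVar p.2 :=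
  primrec_evalToks Primrec.fst (primrec_encAlg.comp Primrec.snd) (primrec_encVar.comp Primrec.snd).to₂
    Primrec.snd

theorem primrec_encToks : Primrec₂ encToks := by
  have h : Primrec fun p : List ℕ × List (ℕ ⊕ ℕ) =>
      ((evalToks p.1 encAlg encVar p.2).bind List.head?).getD (0, 0) :=
    Primrec.option_getD.comp (Primrec.option_bind primrec_evalToks_enc
      (Primrec.list_head?.comp Primrec.snd)) (Primrec.const (0, 0))
  exact Primrec₂.natPair.comp (Primrec.fst.comp h) (Primrec.snd.comp h)

theorem primrec_code : Primrec RawInstance.code := by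
  refine Primrec₂.natPair.comp (Primrec.list_length.comp Primrec.fst) (Primrec₂.natPair.comp
    (Primrec.encode.comp ?_) (Primrec.encode.comp ?_))
  · exact Primrec.list_map (Primrec.list_range.comp (Primrec.list_length.comp Primrec.fst))
      (Primrec₂.natPair.comp Primrec.snd ((Primrec.list_getD 0).comp (Primrec.fst.comp Primrec.fst)
        Primrec.snd))
  · exact Primrec.list_map Primrec.snd (Primrec₂.natPair.comp
      (primrec_encToks.comp (Primrec.fst.comp Primrec.fst) (Primrec.fst.comp Primrec.snd))
      (primrec_encToks.comp (Primrec.fst.comp Primrec.fst) (Primrec.snd.comp Primrec.snd)))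

theorem primrecPred_wf : PrimrecPred RawInstance.Wf := by
  have h : PrimrecPred fun p : List ℕ × List (ℕ ⊕ ℕ) => WfToks p.1 p.2 :=
    Primrec.eq.comp (Primrec.option_map primrec_evalToks_enc (Primrec.list_length.comp Primrec.snd))
      (Primrec.const (some 1))
  refine primrecPred_forall_mem Primrec.snd (PrimrecPred.and ?_ ?_)
  · exact h.comp ((Primrec.fst.comp Primrec.fst).pair (Primrec.fst.comp Primrec.snd))
  · exact h.comp ((Primrec.fst.comp Primrec.fst).pair (Primrec.snd.comp Primrec.snd))

theorem primrecPred_nonvarToks : PrimrecPred NonvarToks :=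
  Primrec.eq.comp (Primrec.option_getD.comp (Primrec.option_map Primrec.list_head?
    (Primrec.sumCasesOn Primrec.snd (Primrec.const 1).to₂ (Primrec.const 0).to₂ |>.of_eq fun p => by
      cases p.2 <;> rfl)) (Primrec.const 0)) (Primrec.const 1)

theorem primrecPred_just {ρ : γ → RawInstance} (hρ : Primrec ρ) {c : γ → ℕ} (hc : Primrec c)
    {s : γ → (ℕ × ℕ) × List ℕ} (hs' : Primrec s) {acc : γ → List (ℕ × ℕ)} (hacc : Primrec acc) :
    PrimrecPred fun p => Just (ρ p) (c p) (s p) (acc p) := by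
  have hs : Primrec fun p => (s p).1 := Primrec.fst.comp hs'
  have hl : Primrec fun p => (s p).2 := Primrec.snd.comp hs'
  have hargs : Primrec fun x : ℕ => Denumerable.ofNat (List ℕ) x.unpair.2 :=
    (Primrec.ofNat _).comp (Primrec.snd.comp Primrec.unpair)
  have hhead : Primrec fun x : ℕ => x.unpair.1 := Primrec.fst.comp Primrec.unpair
  have h1 := Primrec.fst.comp hs
  have h2 := Primrec.snd.comp hs
  refine PrimrecPred.or (Primrec.eq.comp hs (hc.pair hc)) ?_
  refine PrimrecPred.or (primrecPred_mem hacc (h2.pair h1)) ?_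
  refine PrimrecPred.or (primrecPred_exists_mem hacc (PrimrecPred.and
    (Primrec.eq.comp (Primrec.fst.comp Primrec.snd) (h1.comp Primrec.fst))
    (primrecPred_mem (hacc.comp Primrec.fst) ((Primrec.snd.comp Primrec.snd).pair (h2.comp Primrec.fst))))) ?_
  refine PrimrecPred.or (PrimrecPred.and (primrecPred_mem hacc (h1.pair h1)) (PrimrecPred.and
    (Primrec.eq.comp (hhead.comp h1) (hhead.comp h2)) (PrimrecPred.and
    (Primrec.eq.comp (Primrec.list_length.comp (hargs.comp h1)) (Primrec.list_length.comp (hargs.comp h2)))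
    (primrecPred_forall_lt (Primrec.list_length.comp (hargs.comp h1)) ?_)))) ?_
  · exact primrecPred_mem (hacc.comp Primrec.fst) (Primrec.pair
      ((Primrec.list_getD 0).comp (hargs.comp (h1.comp Primrec.fst)) Primrec.snd)
      ((Primrec.list_getD 0).comp (hargs.comp (h2.comp Primrec.fst)) Primrec.snd))
  refine PrimrecPred.or (primrecPred_exists_mem hacc (PrimrecPred.and
    (Primrec.eq.comp (Primrec.fst.comp Primrec.snd) (Primrec.snd.comp Primrec.snd)) (PrimrecPred.and
    (Primrec.eq.comp (h1.comp Primrec.fst) (h2.comp Primrec.fst))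
    (primrecPred_mem (hargs.comp (Primrec.fst.comp Primrec.snd)) (h1.comp Primrec.fst))))) ?_
  have hev : ∀ {w : γ × List (ℕ ⊕ ℕ) × List (ℕ ⊕ ℕ) → List (ℕ ⊕ ℕ)}, Primrec w → Primrec fun q =>
      evalToks (ρ q.1).1 codeAlg (fun x => (s q.1).2[x]?) (w q) := fun hw =>
    primrec_evalToks (Primrec.fst.comp (hρ.comp Primrec.fst)) (primrec_codeAlg.comp Primrec.snd)
      (Primrec.list_getElem?.comp (hl.comp (Primrec.fst.comp Primrec.fst)) Primrec.snd).to₂ hw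
  refine primrecPred_exists_mem (Primrec.snd.comp hρ) (PrimrecPred.and
    (primrecPred_nonvarToks.comp (Primrec.snd.comp Primrec.snd)) (PrimrecPred.and
    (primrecPred_mem (hacc.comp Primrec.fst) ((h1.comp Primrec.fst).pair (h1.comp Primrec.fst)))
    (PrimrecPred.and ?_ ?_)))
  · exact Primrec.eq.comp (hev (Primrec.fst.comp Primrec.snd))
      (Primrec.list_cons.comp (h1.comp Primrec.fst) (Primrec.const ([] : List ℕ)) |> Primrec.option_some.comp)
  · exact Primrec.eq.comp (hev (Primrec.snd.comp Primrec.snd))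
      (Primrec.list_cons.comp (h2.comp Primrec.fst) (Primrec.const ([] : List ℕ)) |> Primrec.option_some.comp)

theorem primrec_derive : Primrec fun p : (RawInstance × ℕ) × List ((ℕ × ℕ) × List ℕ) =>
    derive p.1.1 p.1.2 p.2 := by
  classical
  unfold derive
  have h1 : Primrec fun p : (RawInstance × ℕ) × List ((ℕ × ℕ) × List ℕ) => p.2 := Primrec.snd
  refine Primrec.list_foldr (h := fun p q => if Just p.1.1 p.1.2 q.1 q.2 then q.1.1 :: q.2 else q.2)
    h1 (Primrec.const ([] : List (ℕ × ℕ))) ?_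
  refine Primrec.ite ?_ ?_ (Primrec.snd.comp Primrec.snd)
  · exact primrecPred_just (Primrec.fst.comp (Primrec.fst.comp Primrec.fst))
      (Primrec.snd.comp (Primrec.fst.comp Primrec.fst)) (Primrec.fst.comp Primrec.snd)
      (Primrec.snd.comp Primrec.snd)
  · exact Primrec.list_cons.comp (Primrec.fst.comp (Primrec.fst.comp Primrec.snd))
      (Primrec.snd.comp Primrec.snd)

theorem primrec_assigns : Primrec₂ assigns := by
  have h : Primrec₂ fun (S : List ℕ) (N : ℕ) => Nat.rec (motive := fun _ => List (List ℕ)) [[]]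
      (fun _ l => l.flatMap fun s => S.map fun x => x :: s) N := by
    refine Primrec.nat_rec (f := fun _ : List ℕ => [([] : List ℕ)])
      (g := fun S q => q.2.flatMap fun s => S.map fun x => x :: s) (Primrec.const _) ?_
    have h1 : Primrec fun p : (List ℕ × ℕ × List (List ℕ)) × List ℕ => p.1.1 :=
      Primrec.fst.comp Primrec.fst
    have h2 : Primrec fun q : List ℕ × ℕ × List (List ℕ) => q.2.2 := Primrec.snd.comp Primrec.snd
    have h3 : Primrec₂ fun (q : List ℕ × ℕ × List (List ℕ)) (s : List ℕ) => q.1.map fun x => x :: s :=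
      Primrec.list_map h1 (Primrec.list_cons.comp Primrec.snd (Primrec.snd.comp Primrec.fst))
    exact Primrec.list_flatMap h2 h3
  refine h.of_eq fun S N => ?_
  induction N with
  | zero => rfl
  | succ N ih => simp only [assigns, ih]

theorem primrecPred_modelOk {ρ : γ → RawInstance} (hρ : Primrec ρ) {c : γ → ℕ} (hc : Primrec c)
    {a : γ → List (ℕ ⊕ ℕ)} (ha : Primrec a) {T : γ → List (ℕ × ℕ)} (hT : Primrec T) {N : γ → ℕ}
    (hN : Primrec N) {D : γ → List ((ℕ × ℕ) × List ℕ)} (hD : Primrec D) :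
    PrimrecPred fun p => ModelOk (ρ p) (c p) (a p) (T p) (N p) (D p) := by
  refine PrimrecPred.and (primrecPred_forall_mem hT (primrecPred_mem
    ((primrec_derive.comp ((hρ.pair hc).pair hD)).comp Primrec.fst) Primrec.snd)) (PrimrecPred.and ?_
      (PrimrecPred.and ?_ ?_))
  · refine Primrec.eq.comp (Primrec.option_isSome.comp ?_) (Primrec.const true)
    exact primrec_evalToks (Primrec.fst.comp hρ) (primrec_tableAlg.comp ((hT.comp Primrec.fst).pair
      Primrec.snd)) (Primrec.const none).to₂ ha
  · refine primrecPred_forall_mem (Primrec.snd.comp hρ) ?_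
    refine primrecPred_forall_mem (Primrec.fst.comp Primrec.snd) ?_
    refine Primrec.nat_le.comp ?_ (hN.comp (Primrec.fst.comp Primrec.fst))
    exact (Primrec.sumCasesOn Primrec.snd (Primrec.const 0).to₂ (Primrec.succ.comp Primrec.snd).to₂).of_eq
      fun p => by cases p.2 <;> rfl
  · refine primrecPred_forall_mem (primrec_assigns.comp (Primrec.list_map hT
      (Primrec.snd.comp Primrec.snd).to₂) hN) ?_
    refine primrecPred_forall_mem (Primrec.snd.comp (hρ.comp Primrec.fst)) ?_
    refine PrimrecPred.imp (primrecPred_nonvarToks.comp (Primrec.snd.comp Primrec.snd)) ?_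
    have hev : ∀ {w : (γ × List ℕ) × List (ℕ ⊕ ℕ) × List (ℕ ⊕ ℕ) → List (ℕ ⊕ ℕ)}, Primrec w →
        Primrec fun q => evalToks (ρ q.1.1).1 (tableAlg (T q.1.1)) (fun x => q.1.2[x]?) (w q) := fun hw =>
      primrec_evalToks (Primrec.fst.comp (hρ.comp (Primrec.fst.comp Primrec.fst)))
        (primrec_tableAlg.comp ((hT.comp (Primrec.fst.comp (Primrec.fst.comp Primrec.fst))).pair
          Primrec.snd))
        (Primrec.list_getElem?.comp (Primrec.snd.comp (Primrec.fst.comp Primrec.fst)) Primrec.snd).to₂ hw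
    have hl := hev (Primrec.fst.comp Primrec.snd)
    exact PrimrecPred.imp (Primrec.eq.comp (Primrec.option_isSome.comp hl) (Primrec.const true))
      (Primrec.eq.comp (hev (Primrec.snd.comp Primrec.snd)) hl)

end Primitive

/-- Every variable of a right-hand side occurs in the left-hand side. -/
def RawInstance.VarOk (ρ : RawInstance) : Prop :=
  ∀ r ∈ ρ.2, ∀ x ∈ r.2, Sum.elim (fun _ => 0) (fun _ => 1) x = 0 ∨ x ∈ r.1

theorem TRSInstance.varOk_raw (inst : TRSInstance) :
    inst.raw.VarOk ↔ ∀ r ∈ inst.2.2, r.2.vars ⊆ r.1.vars := by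
  constructor
  · intro h r hr x hx
    exact mem_toks_inr.1 ((h _ (List.mem_map.2 ⟨r, hr, rfl⟩) _ (mem_toks_inr.2 hx)).resolve_left (by simp))
  · intro h r hr x hx
    obtain ⟨r, hr', rfl⟩ := List.mem_map.1 hr
    rcases x with x | x
    · exact Or.inl rfl
    · exact Or.inr (mem_toks_inr.2 (h r hr' (mem_toks_inr.1 hx)))

/-- The data certifying termination on a single ground term. -/
abbrev Certificate : Type := RawInstance × List (ℕ × ℕ) × ℕ × List ((ℕ × ℕ) × List ℕ)

/-- The certificate `b` shows that `m` is the code of a problem instance and, if `a` is a ground term, that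
equality saturation terminates on it. -/
def Certifies (m : ℕ) (a : List (ℕ ⊕ ℕ)) (b : Certificate) : Prop :=
  b.1.code = m ∧ b.1.Wf ∧ b.1.VarOk ∧
    ((evalToks b.1.1 codeAlg (fun _ => none) a).map List.length = some 1 →
      ModelOk b.1 (((evalToks b.1.1 codeAlg (fun _ => none) a).bind List.head?).getD 0) a
        b.2.1 b.2.2.1 b.2.2.2)

theorem primrecPred_certifies :
    PrimrecPred fun p : ℕ × List (ℕ ⊕ ℕ) × Certificate => Certifies p.1 p.2.1 p.2.2 := by
  have ha : Primrec fun p : ℕ × List (ℕ ⊕ ℕ) × Certificate => p.2.1 := Primrec.fst.comp Primrec.snd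
  have hb : Primrec fun p : ℕ × List (ℕ ⊕ ℕ) × Certificate => p.2.2 := Primrec.snd.comp Primrec.snd
  have hρ := Primrec.fst.comp hb
  have hev : Primrec fun p : ℕ × List (ℕ ⊕ ℕ) × Certificate =>
      evalToks p.2.2.1.1 codeAlg (fun _ => none) p.2.1 :=
    primrec_evalToks (Primrec.fst.comp hρ) (primrec_codeAlg.comp Primrec.snd) (Primrec.const none).to₂ ha
  refine PrimrecPred.and (Primrec.eq.comp (primrec_code.comp hρ) Primrec.fst) (PrimrecPred.and
    (primrecPred_wf.comp hρ) (PrimrecPred.and ?_ (PrimrecPred.imp ?_ ?_)))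
  · refine primrecPred_forall_mem (Primrec.snd.comp hρ) ?_
    refine primrecPred_forall_mem (Primrec.snd.comp Primrec.snd) ?_
    refine PrimrecPred.or (Primrec.eq.comp ?_ (Primrec.const 0)) (primrecPred_mem
      (Primrec.fst.comp (Primrec.snd.comp Primrec.fst)) Primrec.snd)
    exact (Primrec.sumCasesOn Primrec.snd (Primrec.const 0).to₂ (Primrec.const 1).to₂).of_eq
      fun p => by cases p.2 <;> rfl
  · exact Primrec.eq.comp (Primrec.option_map hev (Primrec.list_length.comp Primrec.snd).to₂)
      (Primrec.const (some 1))
  · exact primrecPred_modelOk hρ (Primrec.option_getD.comp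
      (Primrec.option_bind hev (Primrec.list_head?.comp Primrec.snd).to₂) (Primrec.const 0)) ha
      (Primrec.fst.comp (Primrec.snd.comp hb))
      (Primrec.fst.comp (Primrec.snd.comp (Primrec.snd.comp hb)))
      (Primrec.snd.comp (Primrec.snd.comp (Primrec.snd.comp hb)))

theorem evalToks_codeAlg (inst : TRSInstance) (t : GTm (Fin inst.1) inst.2.1) :
    evalToks inst.raw.1 codeAlg (fun _ => none) t.toks = some [gcode t] :=
  (evalToks_toks_singleton _ _ _ _).2 (ev_codeAlg_iff.2 rfl)

theorem exists_code_allTermTerminates_iff (m : ℕ) :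
    (∃ inst : TRSInstance, encode inst = m ∧ AllTermTerminates inst) ↔ ∀ a, ∃ b, Certifies m a b := by
  constructor
  · rintro ⟨inst, rfl, h⟩ a
    obtain ⟨hvar, hfin⟩ := (allTermTerminates_iff inst).1 h
    by_cases ha : (evalToks inst.raw.1 codeAlg (fun _ => none) a).map List.length = some 1
    · obtain ⟨st, h1, h2⟩ := Option.map_eq_some_iff.1 ha
      obtain ⟨c, rfl⟩ := List.length_eq_one_iff.1 h2
      obtain ⟨t, rfl⟩ : ∃ t : GTm (Fin inst.1) inst.2.1, a = t.toks :=
        exists_term_of_evalToks (fun x c h => by simp at h) h1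
      obtain ⟨T, N, D, h3⟩ := exists_modelOk inst hvar t (hfin t)
      refine ⟨(inst.raw, T, N, D), inst.code_raw, inst.wf_raw, inst.varOk_raw.2 hvar, fun _ => ?_⟩
      dsimp only
      rw [evalToks_codeAlg]
      exact h3
    · exact ⟨(inst.raw, [], 0, []), inst.code_raw, inst.wf_raw, inst.varOk_raw.2 hvar, fun h => absurd h ha⟩
  · intro h
    obtain ⟨⟨ρ, b⟩, h1, h2, h3, -⟩ := h []
    obtain ⟨inst, rfl⟩ := h2.exists_inst
    have hm : encode inst = m := inst.code_raw.symm.trans h1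
    have hvar := inst.varOk_raw.1 h3
    refine ⟨inst, hm, (allTermTerminates_iff inst).2 ⟨hvar, fun t => ?_⟩⟩
    obtain ⟨⟨ρ', T, N, D⟩, h1', h2', -, h4⟩ := h t.toks
    obtain ⟨inst', rfl⟩ := h2'.exists_inst
    obtain rfl : inst' = inst := encode_injective ((inst'.code_raw.symm.trans h1').trans hm.symm)
    dsimp only at h4
    rw [evalToks_codeAlg] at h4
    exact finIdx_of_modelOk inst' hvar t (h4 rfl)

theorem exists_computable_matrix : ∃ f : ℕ → ℕ → ℕ → Bool,
    Computable (fun p : ℕ × ℕ × ℕ => f p.1 p.2.1 p.2.2) ∧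
    ∀ m : ℕ, (∃ inst : TRSInstance, encode inst = m ∧ AllTermTerminates inst) ↔
      ∀ a : ℕ, ∃ b : ℕ, f m a b = true := by
  classical
  refine ⟨fun m a b => decide (Certifies m (Denumerable.ofNat _ a) (Denumerable.ofNat Certificate b)),
    ?_, fun m => ?_⟩
  · refine Primrec.to_comp (PrimrecPred.decide ?_)
    exact primrecPred_certifies.comp (Primrec.fst.pair (Primrec.pair
      ((Primrec.ofNat _).comp (Primrec.fst.comp Primrec.snd))
      ((Primrec.ofNat _).comp (Primrec.snd.comp Primrec.snd))))
  · rw [exists_code_allTermTerminates_iff]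
    simp only [decide_eq_true_eq]
    constructor
    · intro h a
      obtain ⟨b, hb⟩ := h (Denumerable.ofNat _ a)
      exact ⟨encode b, by rwa [Denumerable.ofNat_encode]⟩
    · intro h a
      obtain ⟨b, hb⟩ := h (encode a)
      rw [Denumerable.ofNat_encode] at hb
      exact ⟨_, hb⟩

section Trees

/-- The arities of the signature with a constant, a binary symbol and a unary symbol. -/
def treeAr : Fin 3 → ℕ := ![0, 2, 1]

/-- Ground terms over the signature `treeAr`. -/
inductive CTree : Type
  | leaf : CTree
  | pair : CTree → CTree → CTree
  | cfg : CTree → CTree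

/-- Patterns over the signature `treeAr` that do not use the unary symbol. -/
inductive Pat : Type
  | var : ℕ → Pat
  | leaf : Pat
  | pair : Pat → Pat → Pat

variable {V : Type}

def Tm.leaf {V : Type} : Tm (Fin 3) treeAr V := .node 0 Fin.elim0
def Tm.pair {V : Type} (a b : Tm (Fin 3) treeAr V) : Tm (Fin 3) treeAr V := .node 1 ![a, b]
def Tm.cfg {V : Type} (a : Tm (Fin 3) treeAr V) : Tm (Fin 3) treeAr V := .node 2 ![a]

theorem Tm.node_zero (ts : Fin (treeAr 0) → Tm (Fin 3) treeAr V) : Tm.node 0 ts = Tm.leaf :=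
  congrArg (Tm.node 0) (funext fun i : Fin 0 => i.elim0)

theorem Tm.node_one (ts : Fin (treeAr 1) → Tm (Fin 3) treeAr V) :
    Tm.node 1 ts = Tm.pair (ts (0 : Fin 2)) (ts (1 : Fin 2)) :=
  congrArg (Tm.node 1) (funext fun i : Fin 2 => by fin_cases i <;> rfl)

theorem Tm.node_two (ts : Fin (treeAr 2) → Tm (Fin 3) treeAr V) :
    Tm.node 2 ts = Tm.cfg (ts (0 : Fin 1)) :=
  congrArg (Tm.node 2) (funext fun i : Fin 1 => by fin_cases i; rfl)

def CTree.tm : CTree → GTm (Fin 3) treeAr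
  | .leaf => .leaf
  | .pair a b => .pair a.tm b.tm
  | .cfg a => .cfg a.tm

def Pat.tm : Pat → Tm (Fin 3) treeAr ℕ
  | .var x => .var x
  | .leaf => .leaf
  | .pair a b => .pair a.tm b.tm

def CTree.ofTm : GTm (Fin 3) treeAr → CTree
  | .node 0 _ => .leaf
  | .node 1 ts => .pair (ofTm (ts (0 : Fin 2))) (ofTm (ts (1 : Fin 2)))
  | .node 2 ts => .cfg (ofTm (ts (0 : Fin 1)))

theorem CTree.ofTm_tm : ∀ a : CTree, CTree.ofTm a.tm = a
  | .leaf => rfl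
  | .pair a b => congrArg₂ CTree.pair a.ofTm_tm b.ofTm_tm
  | .cfg a => congrArg CTree.cfg a.ofTm_tm

theorem CTree.tm_ofTm : ∀ a : GTm (Fin 3) treeAr, (CTree.ofTm a).tm = a
  | .node 0 ts => (Tm.node_zero ts).symm
  | .node 1 ts => (congrArg₂ Tm.pair (tm_ofTm _) (tm_ofTm _)).trans (Tm.node_one ts).symm
  | .node 2 ts => (congrArg Tm.cfg (tm_ofTm _)).trans (Tm.node_two ts).symm

/-- Substitution of trees for variables. -/
def Pat.inst (σ : ℕ → CTree) : Pat → CTree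
  | .var x => σ x
  | .leaf => .leaf
  | .pair a b => .pair (a.inst σ) (b.inst σ)

/-- The list of variables of a pattern. -/
def Pat.vs : Pat → List ℕ
  | .var x => [x]
  | .leaf => []
  | .pair a b => a.vs ++ b.vs

theorem Pat.ofTm_subst (σ : ℕ → GTm (Fin 3) treeAr) : ∀ p : Pat,
    CTree.ofTm (p.tm.subst σ) = p.inst fun x => CTree.ofTm (σ x)
  | .var _ => rfl
  | .leaf => rfl
  | .pair a b => congrArg₂ CTree.pair (a.ofTm_subst σ) (b.ofTm_subst σ)

theorem Pat.tm_subst (σ : ℕ → CTree) (p : Pat) : p.tm.subst (fun x => (σ x).tm) = (p.inst σ).tm := by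
  rw [← CTree.tm_ofTm (p.tm.subst _), p.ofTm_subst]
  simp only [CTree.ofTm_tm]

theorem Pat.mem_vars {x : ℕ} : ∀ p : Pat, x ∈ p.tm.vars ↔ x ∈ p.vs
  | .var y => by simp [Pat.tm, Tm.vars, Pat.vs]
  | .leaf => by simp [Pat.tm, Tm.vars, Pat.vs, Tm.leaf, treeAr]
  | .pair a b => by
    rw [Pat.vs, List.mem_append, ← a.mem_vars, ← b.mem_vars]
    simp only [Pat.tm, Tm.pair, Tm.vars, Set.mem_iUnion]
    exact Fin.exists_fin_two

theorem Pat.inst_congr {σ τ : ℕ → CTree} : ∀ {p : Pat}, (∀ x ∈ p.vs, σ x = τ x) → p.inst σ = p.inst τ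
  | .var _, h => h _ (by simp [Pat.vs])
  | .leaf, _ => rfl
  | .pair _ _, h => congrArg₂ CTree.pair (inst_congr fun x hx => h x (List.mem_append_left _ hx))
      (inst_congr fun x hx => h x (List.mem_append_right _ hx))

theorem Pat.eq_of_inst_eq {σ τ : ℕ → CTree} : ∀ {p : Pat}, p.inst σ = p.inst τ → ∀ x ∈ p.vs, σ x = τ x
  | .var _, h, x, hx => by
    obtain rfl := List.mem_singleton.1 hx
    exact h
  | .leaf, _, _, hx => absurd hx List.not_mem_nil
  | .pair _ _, h, x, hx => by
    obtain ⟨h1, h2⟩ := CTree.pair.inj h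
    exact (List.mem_append.1 hx).elim (eq_of_inst_eq h1 x) (eq_of_inst_eq h2 x)

/-- A syntactic sufficient criterion for two patterns to have no common instance. -/
def Pat.clash : Pat → Pat → Bool
  | .leaf, .pair _ _ => true
  | .pair _ _, .leaf => true
  | .pair a b, .pair c d => a.clash c || b.clash d
  | _, _ => false

theorem Pat.inst_ne_of_clash {σ τ : ℕ → CTree} : ∀ {p q : Pat}, p.clash q = true → p.inst σ ≠ q.inst τ
  | .leaf, .pair _ _, _ => CTree.noConfusion
  | .pair _ _, .leaf, _ => CTree.noConfusion
  | .pair a b, .pair c d, h => fun he => by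
    obtain ⟨h1, h2⟩ := CTree.pair.inj he
    rw [Pat.clash, Bool.or_eq_true] at h
    exact h.elim (fun h => inst_ne_of_clash h h1) fun h => inst_ne_of_clash h h2

/-- The root rewrite relation of a list of rules. -/
def RootStep (rs : List (Pat × Pat)) (a b : CTree) : Prop :=
  ∃ r ∈ rs, ∃ σ, a = r.1.inst σ ∧ b = r.2.inst σ

/-- Rules with pairwise clashing left-hand sides and no fresh variables on the right. -/
structure Orthogonal (rs : List (Pat × Pat)) : Prop where
  clash : (rs.map Prod.fst).Pairwise fun p q => p.clash q = true ∧ q.clash p = true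
  vars : ∀ r ∈ rs, r.2.vs ⊆ r.1.vs

theorem Orthogonal.functional {rs : List (Pat × Pat)} (h : Orthogonal rs) {a b c : CTree}
    (hb : RootStep rs a b) (hc : RootStep rs a c) : b = c := by
  obtain ⟨r, hr, σ, rfl, rfl⟩ := hb
  obtain ⟨r', hr', τ, he, rfl⟩ := hc
  have hp := List.pairwise_map.1 h.clash
  have : r = r' := by
    by_contra hne
    have : Std.Symm fun p q : Pat × Pat => p.1.clash q.1 = true ∧ q.1.clash p.1 = true :=
      ⟨fun _ _ h => h.symm⟩
    exact Pat.inst_ne_of_clash (hp.forall hr hr' hne).1 he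
  subst this
  exact Pat.inst_congr fun x hx => Pat.eq_of_inst_eq he x (h.vars r hr hx)

end Trees

section Saturation

open Relation

/-- The list of subtrees. -/
def CTree.subs : CTree → List CTree
  | .leaf => [.leaf]
  | .pair a b => .pair a b :: (a.subs ++ b.subs)
  | .cfg a => .cfg a :: a.subs

theorem CTree.self_mem_subs : ∀ a : CTree, a ∈ a.subs
  | .leaf => List.mem_singleton_self _
  | .pair _ _ => List.mem_cons_self
  | .cfg _ => List.mem_cons_self

theorem CTree.subs_trans {a b : CTree} (hab : a ∈ b.subs) : ∀ {c : CTree}, b ∈ c.subs → a ∈ c.subs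
  | .leaf, h => by rwa [← List.mem_singleton.1 h]
  | .pair c d, h => by
    rcases List.mem_cons.1 h with rfl | h
    · exact hab
    · exact List.mem_cons_of_mem _ (List.mem_append.2 ((List.mem_append.1 h).imp
        (subs_trans hab) (subs_trans hab)))
  | .cfg c, h => by
    rcases List.mem_cons.1 h with rfl | h
    · exact hab
    · exact List.mem_cons_of_mem _ (subs_trans hab h)

theorem Pat.mem_subs_inst {σ : ℕ → CTree} {x : ℕ} : ∀ {p : Pat}, x ∈ p.vs → σ x ∈ (p.inst σ).subs
  | .var _, h => by
    obtain rfl := List.mem_singleton.1 h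
    exact CTree.self_mem_subs _
  | .leaf, h => absurd h List.not_mem_nil
  | .pair _ _, h => List.mem_cons_of_mem _ (List.mem_append.2 ((List.mem_append.1 h).imp
        mem_subs_inst mem_subs_inst))

theorem Pat.cfg_mem_subs_inst {σ : ℕ → CTree} {a : CTree} : ∀ {p : Pat}, a.cfg ∈ (p.inst σ).subs →
    ∃ x ∈ p.vs, a.cfg ∈ (σ x).subs
  | .var x, h => ⟨x, List.mem_singleton_self _, h⟩
  | .leaf, h => CTree.noConfusion (List.mem_singleton.1 h)
  | .pair p q, h => by
    rcases List.mem_cons.1 h with h | h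
    · exact CTree.noConfusion h
    · rcases List.mem_append.1 h with h | h
      · obtain ⟨x, hx, h⟩ := cfg_mem_subs_inst h
        exact ⟨x, List.mem_append_left _ hx, h⟩
      · obtain ⟨x, hx, h⟩ := cfg_mem_subs_inst h
        exact ⟨x, List.mem_append_right _ hx, h⟩

variable {rs : List (Pat × Pat)}

/-- The terms of the rewrite rules `cfg l → cfg r`. -/
def cfgRules (rs : List (Pat × Pat)) : List (Tm (Fin 3) treeAr ℕ × Tm (Fin 3) treeAr ℕ) :=
  rs.map fun r => (.cfg r.1.tm, .cfg r.2.tm)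

theorem Orthogonal.cfg_mem_subs (h : Orthogonal rs) {a b c : CTree} (hs : RootStep rs a b)
    (hc : c.cfg ∈ b.subs) : c.cfg ∈ a.subs := by
  obtain ⟨r, hr, σ, rfl, rfl⟩ := hs
  obtain ⟨x, hx, hc⟩ := Pat.cfg_mem_subs_inst hc
  exact CTree.subs_trans hc (Pat.mem_subs_inst (h.vars r hr hx))

theorem Orthogonal.finite_run (h : Orthogonal rs) {a : CTree} (ha : Acc (flip (RootStep rs)) a) :
    {b | ReflTransGen (RootStep rs) a b}.Finite := by
  induction ha with
  | intro a _ ih =>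
    by_cases hs : ∃ b, RootStep rs a b
    · obtain ⟨b, hb⟩ := hs
      refine ((ih b hb).insert a).subset fun c hc => ?_
      rcases ReflTransGen.cases_head hc with rfl | ⟨d, hd, hc⟩
      · exact Set.mem_insert _ _
      · rw [h.functional hd hb] at hc
        exact Set.mem_insert_of_mem _ hc
    · refine (Set.finite_singleton a).subset fun c hc => ?_
      rcases ReflTransGen.cases_head hc with rfl | ⟨d, hd, hc⟩
      · exact rfl
      · exact absurd ⟨d, hd⟩ hs

instance : Nonempty CTree := ⟨.leaf⟩

/-- The result of a terminating sequence of root steps. -/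
noncomputable def CTree.final (rs : List (Pat × Pat)) (a : CTree) : CTree :=
  Classical.epsilon fun b => ReflTransGen (RootStep rs) a b ∧ ∀ c, ¬ RootStep rs b c

theorem CTree.final_spec {a : CTree} (ha : Acc (flip (RootStep rs)) a) :
    ReflTransGen (RootStep rs) a (a.final rs) ∧ ∀ c, ¬ RootStep rs (a.final rs) c := by
  refine Classical.epsilon_spec
    (p := fun b => ReflTransGen (RootStep rs) a b ∧ ∀ c, ¬ RootStep rs b c) ?_
  induction ha with
  | intro a _ ih =>
    by_cases hs : ∃ b, RootStep rs a b
    · obtain ⟨b, hb⟩ := hs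
      obtain ⟨c, hc, hc'⟩ := ih b hb
      exact ⟨c, hc.head hb, hc'⟩
    · exact ⟨a, .refl, fun c hc => hs ⟨c, hc⟩⟩

theorem Orthogonal.final_eq (h : Orthogonal rs) {a b : CTree} (hs : RootStep rs a b) :
    a.final rs = b.final rs := by
  refine congrArg Classical.epsilon (funext fun c => propext (and_congr_left fun hc => ?_))
  refine ⟨fun h' => ?_, fun h' => h'.head hs⟩
  rcases ReflTransGen.cases_head h' with rfl | ⟨d, hd, h'⟩
  · exact absurd hs (hc b)
  · rwa [h.functional hs hd]

/-- The normal form of a tree under the rules `cfg l → cfg r`. -/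
noncomputable def CTree.nf (rs : List (Pat × Pat)) : CTree → CTree
  | .leaf => .leaf
  | .pair a b => .pair (a.nf rs) (b.nf rs)
  | .cfg a => .cfg ((a.nf rs).final rs)

theorem Pat.nf_inst (σ : ℕ → CTree) : ∀ p : Pat, (p.inst σ).nf rs = p.inst fun x => (σ x).nf rs
  | .var _ => rfl
  | .leaf => rfl
  | .pair a b => congrArg₂ CTree.pair (a.nf_inst σ) (b.nf_inst σ)

/-- All subtrees have, after normalisation of their arguments, a value in `S`. -/
def CTree.Within (rs : List (Pat × Pat)) (S : Set CTree) : CTree → Prop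
  | .leaf => CTree.leaf ∈ S
  | .pair a b => a.Within rs S ∧ b.Within rs S ∧ .pair (a.nf rs) (b.nf rs) ∈ S
  | .cfg a => a.Within rs S ∧ .cfg (a.nf rs) ∈ S

theorem CTree.Within.mono {S T : Set CTree} (hST : S ⊆ T) : ∀ {a : CTree}, a.Within rs S → a.Within rs T
  | .leaf, h => hST h
  | .pair _ _, ⟨h1, h2, h3⟩ => ⟨h1.mono hST, h2.mono hST, hST h3⟩
  | .cfg _, ⟨h1, h2⟩ => ⟨h1.mono hST, hST h2⟩

theorem CTree.exists_within (rs : List (Pat × Pat)) (a : CTree) : ∃ S : Set CTree, S.Finite ∧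
    (∀ u ∈ S, ∀ v ∈ u.subs, v ∈ S) ∧ a.Within rs S := by
  have key : ∀ u : CTree, ({v | v ∈ u.subs} : Set CTree).Finite ∧
      ∀ v ∈ {v | v ∈ u.subs}, ∀ w ∈ v.subs, w ∈ {v | v ∈ u.subs} :=
    fun u => ⟨List.finite_toSet _, fun v hv w hw => CTree.subs_trans hw hv⟩
  induction a with
  | leaf => exact ⟨_, (key .leaf).1, (key .leaf).2, CTree.self_mem_subs _⟩
  | pair a b iha ihb =>
    obtain ⟨S, hS, hS', ha⟩ := iha
    obtain ⟨T, hT, hT', hb⟩ := ihb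
    obtain ⟨k1, k2⟩ := key (.pair (a.nf rs) (b.nf rs))
    refine ⟨S ∪ T ∪ _, (hS.union hT).union k1, ?_, ha.mono fun _ h => .inl (.inl h),
      hb.mono fun _ h => .inl (.inr h), .inr (CTree.self_mem_subs _)⟩
    rintro u ((h | h) | h) v hv
    exacts [.inl (.inl (hS' u h v hv)), .inl (.inr (hT' u h v hv)), .inr (k2 u h v hv)]
  | cfg a iha =>
    obtain ⟨S, hS, hS', ha⟩ := iha
    obtain ⟨k1, k2⟩ := key (.cfg (a.nf rs))
    refine ⟨S ∪ _, hS.union k1, ?_, ha.mono fun _ h => .inl h, .inr (CTree.self_mem_subs _)⟩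
    rintro u (h | h) v hv
    exacts [.inl (hS' u h v hv), .inr (k2 u h v hv)]

/-- A finite set of trees can be enlarged to a finite set closed under subtrees and steps. -/
theorem Orthogonal.exists_closed (h : Orthogonal rs) (hT : ∀ a, Acc (flip (RootStep rs)) a)
    {S : Set CTree} (hS : S.Finite) (hS' : ∀ u ∈ S, ∀ v ∈ u.subs, v ∈ S) :
    ∃ T : Set CTree, T.Finite ∧ S ⊆ T ∧
      ∀ a b, a.cfg ∈ T → RootStep rs a b → b.cfg ∈ T ∧ ∀ u ∈ b.subs, u ∈ T := by
  refine ⟨{u | u ∈ S ∨ ∃ a b, a.cfg ∈ S ∧ ReflTransGen (RootStep rs) a b ∧ u ∈ b.cfg.subs}, ?_,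
    fun u hu => .inl hu, ?_⟩
  · refine Set.Finite.subset (hS.union (hS.biUnion (t := fun v => ⋃ b ∈ {b | ∃ a, v = CTree.cfg a ∧
      ReflTransGen (RootStep rs) a b}, {u | u ∈ b.cfg.subs}) fun v _ => ?_)) ?_
    · refine Set.Finite.biUnion ?_ fun b _ => List.finite_toSet _
      cases v with
      | cfg a =>
        refine (h.finite_run (hT a)).subset ?_
        rintro b ⟨_, ⟨⟩, hb⟩
        exact hb
      | _ => exact Set.finite_empty.subset (by rintro b ⟨_, ⟨⟩, _⟩)
    · rintro u (hu | ⟨a, b, ha, hb, hu⟩)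
      · exact .inl hu
      · refine .inr (Set.mem_biUnion ha (Set.mem_biUnion (x := b) ⟨a, rfl, hb⟩ hu))
  · have run : ∀ {a b c}, a.cfg ∈ S → ReflTransGen (RootStep rs) a b → RootStep rs b c →
        ∀ u ∈ c.cfg.subs, ∃ a b, a.cfg ∈ S ∧ ReflTransGen (RootStep rs) a b ∧ u ∈ b.cfg.subs :=
      fun ha hb hc u hu => ⟨_, _, ha, hb.tail hc, hu⟩
    have inner : ∀ {a b c : CTree}, ReflTransGen (RootStep rs) a b → c.cfg ∈ b.subs → c.cfg ∈ a.subs := by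
      intro a b c hab
      induction hab with
      | refl => exact id
      | tail _ hbc ih => exact fun hc => ih (h.cfg_mem_subs hbc hc)
    suffices ∀ a b, a.cfg ∈ S ∨ (∃ c d, c.cfg ∈ S ∧ ReflTransGen (RootStep rs) c d ∧ a.cfg ∈ d.cfg.subs) →
        RootStep rs a b → ∀ u ∈ b.cfg.subs, ∃ a b, a.cfg ∈ S ∧ ReflTransGen (RootStep rs) a b ∧ u ∈ b.cfg.subs from
      fun a b ha hb => ⟨.inr (this a b ha hb _ (CTree.self_mem_subs _)),
        fun u hu => .inr (this a b ha hb u (List.mem_cons_of_mem _ hu))⟩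
    rintro a b (ha | ⟨c, d, hc, hd, ha⟩) hb
    · exact run ha .refl hb
    · rcases List.mem_cons.1 ha with ha | ha
      · obtain rfl := CTree.cfg.inj ha
        exact run hc hd hb
      · exact run (hS' _ hc _ (List.mem_cons_of_mem _ (inner hd ha))) .refl hb

end Saturation

section Saturation

open Relation

variable {rs : List (Pat × Pat)}

/-- The relation of equality saturation, on trees. -/
def TDer (rs : List (Pat × Pat)) (t a b : CTree) : Prop := Der {r | r ∈ cfgRules rs} t.tm a.tm b.tm

theorem finIdx_der_iff {t : CTree} : FinIdx (Der {r | r ∈ cfgRules rs} t.tm) ↔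
    ∃ W : Set CTree, W.Finite ∧ ∀ a, TDer rs t a a → ∃ w ∈ W, TDer rs t a w := by
  constructor
  · rintro ⟨W, hW, h⟩
    refine ⟨CTree.ofTm '' W, hW.image _, fun a ha => ?_⟩
    obtain ⟨w, hw, haw⟩ := h _ ha
    exact ⟨_, Set.mem_image_of_mem _ hw, by rwa [TDer, CTree.tm_ofTm]⟩
  · rintro ⟨W, hW, h⟩
    refine ⟨CTree.tm '' W, hW.image _, fun a ha => ?_⟩
    rw [← CTree.tm_ofTm a] at ha ⊢
    obtain ⟨w, hw, haw⟩ := h _ ha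
    exact ⟨_, Set.mem_image_of_mem _ hw, haw⟩

theorem TDer.trans {t a b c : CTree} (h : TDer rs t a b) (h' : TDer rs t b c) : TDer rs t a c :=
  Der.trans h h'

theorem TDer.right {t a b : CTree} (h : TDer rs t a b) : TDer rs t b b := Der.trans (.symm h) h

theorem TDer.pair {t a b a' b' : CTree} (ha : TDer rs t a a') (hb : TDer rs t b b')
    (h : TDer rs t (.pair a b) (.pair a b)) : TDer rs t (.pair a b) (.pair a' b') :=
  Der.congr (fun i : Fin 2 => by fin_cases i; exacts [ha, hb]) h

theorem TDer.cfg {t a a' : CTree} (ha : TDer rs t a a')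
    (h : TDer rs t (.cfg a) (.cfg a)) : TDer rs t (.cfg a) (.cfg a') :=
  Der.congr (fun i : Fin 1 => by fin_cases i; exact ha) h

theorem TDer.pair_left {t a b : CTree} (h : TDer rs t (.pair a b) (.pair a b)) : TDer rs t a a := by
  have h' := Der.reach (ar := treeAr) (f := (1 : Fin 3)) (s := ![a.tm, b.tm]) (0 : Fin 2) h
  exact h'

theorem TDer.pair_right {t a b : CTree} (h : TDer rs t (.pair a b) (.pair a b)) : TDer rs t b b := by
  have h' := Der.reach (ar := treeAr) (f := (1 : Fin 3)) (s := ![a.tm, b.tm]) (1 : Fin 2) h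
  exact h'

theorem TDer.of_cfg {t a : CTree} (h : TDer rs t (.cfg a) (.cfg a)) : TDer rs t a a := by
  have h' := Der.reach (ar := treeAr) (f := (2 : Fin 3)) (s := ![a.tm]) (0 : Fin 1) h
  exact h'

theorem Tm.cfg_subst {V W : Type} (a : Tm (Fin 3) treeAr V) (σ : V → Tm (Fin 3) treeAr W) :
    (Tm.cfg a).subst σ = .cfg (a.subst σ) :=
  congrArg (Tm.node 2) (funext fun i : Fin 1 => by fin_cases i; rfl)

theorem CTree.ofTm_cfg (a : GTm (Fin 3) treeAr) : CTree.ofTm (.cfg a) = .cfg (CTree.ofTm a) := rfl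

theorem TDer.step {t a b : CTree} (hs : RootStep rs a b) (h : TDer rs t (.cfg a) (.cfg a)) :
    TDer rs t (.cfg a) (.cfg b) := by
  obtain ⟨r, hr, σ, rfl, rfl⟩ := hs
  have hr' : (Tm.cfg r.1.tm, Tm.cfg r.2.tm) ∈ cfgRules rs := List.mem_map.2 ⟨r, hr, rfl⟩
  have key := Der.rule (R := {r | r ∈ cfgRules rs}) (t := t.tm) (f := 2) hr' (fun x => (σ x).tm)
  change Der _ _ ((Tm.cfg _).subst _) _ → Der _ _ _ ((Tm.cfg _).subst _) at key
  rw [Tm.cfg_subst, Tm.cfg_subst, Pat.tm_subst, Pat.tm_subst] at key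
  exact key h

theorem TDer.run {t a b : CTree} (hs : ReflTransGen (RootStep rs) a b)
    (h : TDer rs t (.cfg a) (.cfg a)) : TDer rs t (.cfg a) (.cfg b) := by
  induction hs with
  | refl => exact h
  | tail _ hbc ih => exact ih.trans (.step hbc ih.right)

/-- Two derivably equal trees have the same value under an invariant compatible with the rules. -/
theorem TDer.invariant {D : CTree → Prop} {f : CTree → CTree} {t : CTree}
    (pair_eq : ∀ {a b a' b'}, f a = f a' → f b = f b' → f (.pair a b) = f (.pair a' b'))
    (cfg_eq : ∀ {a a'}, f a = f a' → f (.cfg a) = f (.cfg a'))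
    (pair_dom : ∀ {a b a' b'}, f a = f a' → f b = f b' → D a' → D b' → D (.pair a b) → D (.pair a' b'))
    (cfg_dom : ∀ {a a'}, f a = f a' → D a' → D (.cfg a) → D (.cfg a'))
    (pair_reach : ∀ {a b}, D (.pair a b) → D a ∧ D b) (cfg_reach : ∀ {a}, D (.cfg a) → D a)
    (rule : ∀ {a b}, RootStep rs a b → D (.cfg a) → f (.cfg a) = f (.cfg b) ∧ D (.cfg b))
    (ht : D t) {a b : CTree} (h : TDer rs t a b) : f a = f b ∧ D a ∧ D b := by
  suffices ∀ a b : GTm (Fin 3) treeAr, Der {r | r ∈ cfgRules rs} t.tm a b →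
      f (CTree.ofTm a) = f (CTree.ofTm b) ∧ D (CTree.ofTm a) ∧ D (CTree.ofTm b) by
    simpa only [CTree.ofTm_tm] using this _ _ h
  intro a b h
  induction h with
  | init => rw [CTree.ofTm_tm]; exact ⟨rfl, ht, ht⟩
  | symm _ ih => exact ⟨ih.1.symm, ih.2.2, ih.2.1⟩
  | trans _ _ ih ih' => exact ⟨ih.1.trans ih'.1, ih.2.1, ih'.2.2⟩
  | @congr g s s' _ _ ih ih' =>
    match g, s, s', ih, ih' with
    | 0, s, s', ih, ih' => exact ⟨rfl, ih'.2.1, ih'.2.1⟩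
    | 1, s, s', ih, ih' =>
      have h0 := ih (0 : Fin 2)
      have h1 := ih (1 : Fin 2)
      exact ⟨pair_eq h0.1 h1.1, ih'.2.1, pair_dom h0.1 h1.1 h0.2.2 h1.2.2 ih'.2.1⟩
    | 2, s, s', ih, ih' =>
      have h0 := ih (0 : Fin 1)
      exact ⟨cfg_eq h0.1, ih'.2.1, cfg_dom h0.1 h0.2.2 ih'.2.1⟩
  | @reach g s i _ ih =>
    match g, s, i, ih with
    | 1, s, i, ih =>
      refine ⟨rfl, and_self_iff.2 ?_⟩
      have := pair_reach ih.2.1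
      match i with
      | ⟨0, _⟩ => exact this.1
      | ⟨1, _⟩ => exact this.2
    | 2, s, i, ih =>
      refine ⟨rfl, and_self_iff.2 ?_⟩
      have := cfg_reach ih.2.1
      match i with
      | ⟨0, _⟩ => exact this
  | @rule l g ts h σ _ ih =>
    obtain ⟨r, hr, he⟩ := List.mem_map.1 h
    obtain ⟨rfl, he'⟩ := Prod.mk.inj he
    rw [← he']
    rw [Tm.cfg_subst] at ih ⊢
    rw [Tm.cfg_subst]
    rw [CTree.ofTm_cfg, Pat.ofTm_subst] at ih ⊢
    rw [CTree.ofTm_cfg, Pat.ofTm_subst]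
    have := rule ⟨r, hr, _, rfl, rfl⟩ ih.2.1
    exact ⟨this.1, ih.2.1, this.2⟩

theorem Pat.within_inst {S : Set CTree} {σ : ℕ → CTree} : ∀ {p : Pat},
    (∀ x ∈ p.vs, (σ x).Within rs S) → (∀ u ∈ (p.inst fun x => (σ x).nf rs).subs, u ∈ S) →
      (p.inst σ).Within rs S
  | .var _, h, _ => h _ (List.mem_singleton_self _)
  | .leaf, _, h => h _ (CTree.self_mem_subs _)
  | .pair p q, h, h' => by
    refine ⟨within_inst (fun x hx => h x (List.mem_append_left _ hx))
        fun u hu => h' u (List.mem_cons_of_mem _ (List.mem_append_left _ hu)),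
      within_inst (fun x hx => h x (List.mem_append_right _ hx))
        fun u hu => h' u (List.mem_cons_of_mem _ (List.mem_append_right _ hu)), ?_⟩
    rw [p.nf_inst, q.nf_inst]
    exact h' _ (CTree.self_mem_subs _)

theorem Pat.within_of_inst {S : Set CTree} {σ : ℕ → CTree} {x : ℕ} : ∀ {p : Pat}, x ∈ p.vs →
    (p.inst σ).Within rs S → (σ x).Within rs S
  | .var _, hx, h => by
    obtain rfl := List.mem_singleton.1 hx
    exact h
  | .leaf, hx, _ => absurd hx List.not_mem_nil
  | .pair _ _, hx, h => (List.mem_append.1 hx).elim (fun hx => within_of_inst hx h.1)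
      fun hx => within_of_inst hx h.2.1

theorem CTree.Within.nf_mem {S : Set CTree} (hT : ∀ a, Acc (flip (RootStep rs)) a)
    (hS : ∀ a b, a.cfg ∈ S → RootStep rs a b → b.cfg ∈ S ∧ ∀ u ∈ b.subs, u ∈ S) :
    ∀ {a : CTree}, a.Within rs S → a.nf rs ∈ S
  | .leaf, h => h
  | .pair _ _, h => h.2.2
  | .cfg a, h => by
    rw [CTree.nf]
    have h2 := h.2
    have h3 := (CTree.final_spec (hT (a.nf rs))).1
    generalize (a.nf rs).final rs = b at h3
    induction h3 with
    | refl => exact h2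
    | tail _ hbc ih => exact (hS _ _ ih hbc).1

theorem TDer.nf {t : CTree} (hT : ∀ a, Acc (flip (RootStep rs)) a) : ∀ {a : CTree},
    TDer rs t a a → TDer rs t a (a.nf rs)
  | .leaf, h => h
  | .pair _ _, h => .pair (.nf hT h.pair_left) (.nf hT h.pair_right) h
  | .cfg a, h => by
    have h1 : TDer rs t (.cfg a) (.cfg (a.nf rs)) := .cfg (.nf hT h.of_cfg) h
    exact h1.trans (.run (CTree.final_spec (hT (a.nf rs))).1 h1.right)

/-- Equality saturation terminates on all terms if orthogonal root rewriting terminates. -/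
theorem Orthogonal.finIdx (h : Orthogonal rs) (hT : ∀ a, Acc (flip (RootStep rs)) a)
    (t : GTm (Fin 3) treeAr) : FinIdx (Der {r | r ∈ cfgRules rs} t) := by
  rw [← CTree.tm_ofTm t, finIdx_der_iff]
  obtain ⟨S, hS, hS', ht⟩ := CTree.exists_within rs (CTree.ofTm t)
  obtain ⟨T, hTf, hST, hcl⟩ := h.exists_closed hT hS hS'
  refine ⟨T, hTf, fun a ha => ⟨a.nf rs, ?_, .nf hT ha⟩⟩
  refine CTree.Within.nf_mem hT hcl (TDer.invariant (D := CTree.Within rs T) (f := CTree.nf rs)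
    (fun h h' => by rw [CTree.nf, CTree.nf, h, h']) (fun h => by rw [CTree.nf, CTree.nf, h])
    (fun h h' ha hb hd => ⟨ha, hb, ?_⟩) (fun h ha hd => ⟨ha, ?_⟩) (fun h => ⟨h.1, h.2.1⟩) (fun h => h.1)
    (fun {a b} hs ha => ?_) (ht.mono hST) ha).2.1
  · rw [← h, ← h']
    exact hd.2.2
  · rw [← h]
    exact hd.2
  · have hs' : RootStep rs (a.nf rs) (b.nf rs) := by
      obtain ⟨r, hr, σ, rfl, rfl⟩ := hs
      exact ⟨r, hr, _, r.1.nf_inst σ, r.2.nf_inst σ⟩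
    refine ⟨by rw [CTree.nf, CTree.nf, h.final_eq hs'], ?_, (hcl _ _ ha.2 hs').1⟩
    obtain ⟨hb, hbn⟩ := hcl _ _ ha.2 hs'
    obtain ⟨r, hr, σ, rfl, rfl⟩ := hs
    rw [Pat.nf_inst] at hbn
    exact Pat.within_inst (fun x hx => Pat.within_of_inst (h.vars r hr hx) ha.1) hbn

/-- Replace every maximal subtree headed by `cfg` by a constant. -/
def CTree.collapse : CTree → CTree
  | .leaf => .leaf
  | .pair a b => .pair a.collapse b.collapse
  | .cfg _ => .cfg .leaf

/-- A family of reachable trees that stay distinct after collapsing prevents termination. -/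
theorem not_finIdx_of_family {t : CTree} (u : ℕ → CTree) (hu : Function.Injective fun n => (u n).collapse)
    (h : ∀ n, TDer rs t (u n) (u n)) : ¬ FinIdx (Der {r | r ∈ cfgRules rs} t.tm) := by
  rw [finIdx_der_iff]
  rintro ⟨W, hW, hW'⟩
  refine Set.infinite_range_of_injective hu ((hW.image CTree.collapse).subset ?_)
  rintro _ ⟨n, rfl⟩
  obtain ⟨w, hw, hnw⟩ := hW' _ (h n)
  refine ⟨w, hw, ((TDer.invariant (D := fun _ => True) (f := CTree.collapse) ?_ ?_ ?_ ?_ ?_ ?_ ?_ ?_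
    hnw).1).symm⟩
  · intro _ _ _ _ h h'
    rw [CTree.collapse, CTree.collapse, h, h']
  all_goals simp [CTree.collapse]

end Saturation

section Machine

open Relation Turing.ToPartrec

namespace Pat

/-- The successor of a numeral. -/
def succ (p : Pat) : Pat := .pair .leaf p

def num : ℕ → Pat
  | 0 => .leaf
  | n + 1 => .succ (num n)

/-- A state of the interpreter that evaluates code `c` on `v` with continuation `k`. -/
def nrm (c k v : Pat) : Pat := .pair .leaf (.pair c (.pair k v))

/-- A state of the interpreter that returns `v` to the continuation `k`. -/
def ret (k v : Pat) : Pat := .pair (.pair .leaf .leaf) (.pair k v)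

def zeroC : Pat := .pair (num 0) .leaf
def succC : Pat := .pair (num 1) .leaf
def tailC : Pat := .pair (num 2) .leaf
def consC (a b : Pat) : Pat := .pair (num 3) (.pair a b)
def compC (a b : Pat) : Pat := .pair (num 4) (.pair a b)
def caseC (a b : Pat) : Pat := .pair (num 5) (.pair a b)
def fixC (a : Pat) : Pat := .pair (num 6) a

def consK₁ (c v k : Pat) : Pat := .pair (num 0) (.pair c (.pair v k))
def consK₂ (v k : Pat) : Pat := .pair (num 1) (.pair v k)
def compK (c k : Pat) : Pat := .pair (num 2) (.pair c k)
def fixK (c k : Pat) : Pat := .pair (num 3) (.pair c k)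

def code : Code → Pat
  | .zero' => zeroC
  | .succ => succC
  | .tail => tailC
  | .cons a b => consC (code a) (code b)
  | .comp a b => compC (code a) (code b)
  | .case a b => caseC (code a) (code b)
  | .fix a => fixC (code a)

def list : List ℕ → Pat
  | [] => .leaf
  | n :: l => .pair (num n) (list l)

/-- A configuration running the interpreter with fuel `r`, for input `x` in round `k`. -/
def running (x k s r : Pat) : Pat := .pair .leaf (.pair x (.pair k (.pair s r)))

/-- A configuration checking that the rest `y` of the input `x` is a numeral, in round `k`. -/
def checking (x k y : Pat) : Pat := .pair (.pair .leaf .leaf) (.pair x (.pair k y))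

end Pat

open Pat in
/-- A small-step interpreter for `Turing.ToPartrec.Code`. -/
def machineRules : List (Pat × Pat) :=
  [(nrm zeroC (var 0) (var 1), ret (var 0) (pair leaf (var 1))),
   (nrm succC (var 0) leaf, ret (var 0) (pair (succ leaf) leaf)),
   (nrm succC (var 0) (pair (var 1) (var 2)), ret (var 0) (pair (succ (var 1)) leaf)),
   (nrm tailC (var 0) leaf, ret (var 0) leaf),
   (nrm tailC (var 0) (pair (var 1) (var 2)), ret (var 0) (var 2)),
   (nrm (consC (var 0) (var 1)) (var 2) (var 3), nrm (var 0) (consK₁ (var 1) (var 3) (var 2)) (var 3)),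
   (nrm (compC (var 0) (var 1)) (var 2) (var 3), nrm (var 1) (compK (var 0) (var 2)) (var 3)),
   (nrm (caseC (var 0) (var 1)) (var 2) leaf, nrm (var 0) (var 2) leaf),
   (nrm (caseC (var 0) (var 1)) (var 2) (pair leaf (var 3)), nrm (var 0) (var 2) (var 3)),
   (nrm (caseC (var 0) (var 1)) (var 2) (pair (succ (var 3)) (var 4)),
      nrm (var 1) (var 2) (pair (var 3) (var 4))),
   (nrm (fixC (var 0)) (var 1) (var 2), nrm (var 0) (fixK (var 0) (var 1)) (var 2)),
   (ret (consK₁ (var 0) (var 1) (var 2)) (var 3), nrm (var 0) (consK₂ (var 3) (var 2)) (var 1)),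
   (ret (consK₂ leaf (var 0)) (var 1), ret (var 0) (pair leaf (var 1))),
   (ret (consK₂ (pair (var 0) (var 1)) (var 2)) (var 3), ret (var 2) (pair (var 0) (var 3))),
   (ret (compK (var 0) (var 1)) (var 2), nrm (var 0) (var 1) (var 2)),
   (ret (fixK (var 0) (var 1)) leaf, ret (var 1) leaf),
   (ret (fixK (var 0) (var 1)) (pair leaf (var 2)), ret (var 1) (var 2)),
   (ret (fixK (var 0) (var 1)) (pair (succ (var 2)) (var 3)), nrm (fixC (var 0)) (var 1) (var 3))]

instance (p : Pat → Pat → Bool) : DecidableRel fun a b => p a b = true ∧ p b a = true :=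
  fun _ _ => inferInstanceAs (Decidable (_ ∧ _))

theorem orthogonal_machineRules : Orthogonal machineRules where
  clash := by decide
  vars := by
    have : ∀ r ∈ machineRules, (∀ x ∈ r.2.vs, x ∈ r.1.vs) := by decide
    exact this

theorem rootStep_get {rs : List (Pat × Pat)} (i : ℕ) (h : i < rs.length) (l : List CTree) :
    RootStep rs (rs[i].1.inst fun x => l.getD x .leaf) (rs[i].2.inst fun x => l.getD x .leaf) :=
  ⟨_, List.getElem_mem h, _, rfl, rfl⟩

/-- The tree of a closed pattern. -/
def Pat.tree (p : Pat) : CTree := p.inst fun _ => .leaf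

namespace CTree

def nrm (c k v : CTree) : CTree := .pair .leaf (.pair c (.pair k v))

def ret (k v : CTree) : CTree := .pair (.pair .leaf .leaf) (.pair k v)

end CTree

/-- The interpreter state that evaluates `c` on `v`. -/
abbrev nrmSt (c : Code) (K : CTree) (v : List ℕ) : CTree := .nrm (Pat.code c).tree K (Pat.list v).tree

/-- The interpreter state that returns `v`. -/
abbrev retSt (K : CTree) (v : List ℕ) : CTree := .ret K (Pat.list v).tree

abbrev consSt₁ (c : Code) (v : List ℕ) (K : CTree) : CTree :=
  .pair (Pat.num 0).tree (.pair (Pat.code c).tree (.pair (Pat.list v).tree K))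

abbrev consSt₂ (v : List ℕ) (K : CTree) : CTree :=
  .pair (Pat.num 1).tree (.pair (Pat.list v).tree K)

abbrev compSt (c : Code) (K : CTree) : CTree := .pair (Pat.num 2).tree (.pair (Pat.code c).tree K)

abbrev fixSt (c : Code) (K : CTree) : CTree := .pair (Pat.num 3).tree (.pair (Pat.code c).tree K)

section Steps

variable (f g : Code) (K : CTree) (v w : List ℕ)

theorem step_zero : RootStep machineRules (nrmSt .zero' K v) (retSt K (0 :: v)) :=
  rootStep_get 0 (by decide) [K, (Pat.list v).tree]

theorem step_succ : RootStep machineRules (nrmSt .succ K v) (retSt K [v.headI.succ]) := by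
  cases v with
  | nil => exact rootStep_get 1 (by decide) [K]
  | cons n v => exact rootStep_get 2 (by decide) [K, (Pat.num n).tree, (Pat.list v).tree]

theorem step_tail : RootStep machineRules (nrmSt .tail K v) (retSt K v.tail) := by
  cases v with
  | nil => exact rootStep_get 3 (by decide) [K]
  | cons n v => exact rootStep_get 4 (by decide) [K, (Pat.num n).tree, (Pat.list v).tree]

theorem step_cons : RootStep machineRules (nrmSt (.cons f g) K v) (nrmSt f (consSt₁ g v K) v) :=
  rootStep_get 5 (by decide) [(Pat.code f).tree, (Pat.code g).tree, K, (Pat.list v).tree]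

theorem step_comp : RootStep machineRules (nrmSt (.comp f g) K v) (nrmSt g (compSt f K) v) :=
  rootStep_get 6 (by decide) [(Pat.code f).tree, (Pat.code g).tree, K, (Pat.list v).tree]

theorem step_case : RootStep machineRules (nrmSt (.case f g) K v)
    (v.headI.rec (nrmSt f K v.tail) fun y _ => nrmSt g K (y :: v.tail)) := by
  match v with
  | [] => exact rootStep_get 7 (by decide) [(Pat.code f).tree, (Pat.code g).tree, K]
  | 0 :: v => exact rootStep_get 8 (by decide) [(Pat.code f).tree, (Pat.code g).tree, K, (Pat.list v).tree]
  | (n + 1) :: v =>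
    exact rootStep_get 9 (by decide)
      [(Pat.code f).tree, (Pat.code g).tree, K, (Pat.num n).tree, (Pat.list v).tree]

theorem step_fix : RootStep machineRules (nrmSt (.fix f) K v) (nrmSt f (fixSt f K) v) :=
  rootStep_get 10 (by decide) [(Pat.code f).tree, K, (Pat.list v).tree]

theorem step_consSt₁ :
    RootStep machineRules (retSt (consSt₁ g v K) w) (nrmSt g (consSt₂ w K) v) :=
  rootStep_get 11 (by decide) [(Pat.code g).tree, (Pat.list v).tree, K, (Pat.list w).tree]

theorem step_consSt₂ :
    RootStep machineRules (retSt (consSt₂ v K) w) (retSt K (v.headI :: w)) := by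
  cases v with
  | nil => exact rootStep_get 12 (by decide) [K, (Pat.list w).tree]
  | cons n v =>
    exact rootStep_get 13 (by decide)
      [(Pat.num n).tree, (Pat.list v).tree, K, (Pat.list w).tree]

theorem step_compSt : RootStep machineRules (retSt (compSt f K) w) (nrmSt f K w) :=
  rootStep_get 14 (by decide) [(Pat.code f).tree, K, (Pat.list w).tree]

theorem step_fixSt : RootStep machineRules (retSt (fixSt f K) w)
    (if w.headI = 0 then retSt K w.tail else nrmSt (.fix f) K w.tail) := by
  match w with
  | [] => exact rootStep_get 15 (by decide) [(Pat.code f).tree, K]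
  | 0 :: w => exact rootStep_get 16 (by decide) [(Pat.code f).tree, K, (Pat.list w).tree]
  | (n + 1) :: w =>
    exact rootStep_get 17 (by decide)
      [(Pat.code f).tree, K, (Pat.num n).tree, (Pat.list w).tree]

end Steps

theorem mem_eval_cons {f g : Code} {v w : List ℕ} : w ∈ (f.cons g).eval v ↔
    ∃ w₁ ∈ f.eval v, ∃ w₂ ∈ g.eval v, w = w₁.headI :: w₂ := by
  rw [Code.cons_eval]
  refine Part.mem_bind_iff.trans (exists_congr fun w₁ => and_congr_right fun _ => ?_)
  exact Part.mem_bind_iff.trans (exists_congr fun w₂ => and_congr_right fun _ => Part.mem_some_iff)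

theorem mem_eval_comp {f g : Code} {v w : List ℕ} : w ∈ (f.comp g).eval v ↔
    ∃ u ∈ g.eval v, w ∈ f.eval u := by
  rw [Code.comp_eval]
  exact Part.mem_bind_iff

theorem mem_eval_fix {f : Code} {v w : List ℕ} : w ∈ f.fix.eval v ↔
    ∃ u ∈ f.eval v, if u.headI = 0 then w = u.tail else w ∈ f.fix.eval u.tail := by
  refine PFun.mem_fix_iff.trans ⟨?_, ?_⟩
  · rintro (h | ⟨u', h, h'⟩)
    · obtain ⟨u, hu, h⟩ := (Part.mem_map_iff _).1 h
      refine ⟨u, hu, ?_⟩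
      split_ifs at h ⊢ with h0
      exact (Sum.inl.inj h).symm
    · obtain ⟨u, hu, h⟩ := (Part.mem_map_iff _).1 h
      refine ⟨u, hu, ?_⟩
      split_ifs at h ⊢ with h0
      exact Sum.inr.inj h ▸ h'
  · rintro ⟨u, hu, h⟩
    split_ifs at h with h0
    · exact .inl ((Part.mem_map_iff _).2 ⟨u, hu, by rw [if_pos h0, h]⟩)
    · exact .inr ⟨u.tail, (Part.mem_map_iff _).2 ⟨u, hu, by rw [if_neg h0]⟩, h⟩

theorem run_of_mem_eval : ∀ (c : Code) {v w : List ℕ}, w ∈ c.eval v → ∀ K,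
    ReflTransGen (RootStep machineRules) (nrmSt c K v) (retSt K w)
  | .zero', v, w, h, K => by
    obtain rfl : w = 0 :: v := by simpa [Code.eval] using h
    exact .single (step_zero K v)
  | .succ, v, w, h, K => by
    obtain rfl : w = [v.headI.succ] := by simpa [Code.eval] using h
    exact .single (step_succ K v)
  | .tail, v, w, h, K => by
    obtain rfl : w = v.tail := by simpa [Code.eval] using h
    exact .single (step_tail K v)
  | .cons f g, v, w, h, K => by
    obtain ⟨w₁, h₁, w₂, h₂, rfl⟩ : ∃ w₁ ∈ f.eval v, ∃ w₂ ∈ g.eval v, w = w₁.headI :: w₂ :=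
      mem_eval_cons.1 h
    exact .head (step_cons f g K v) ((run_of_mem_eval f h₁ _).trans
      (.head (step_consSt₁ g K v w₁) ((run_of_mem_eval g h₂ _).tail (step_consSt₂ K w₁ w₂))))
  | .comp f g, v, w, h, K => by
    obtain ⟨w₁, h₁, h₂⟩ : ∃ w₁ ∈ g.eval v, w ∈ f.eval w₁ := mem_eval_comp.1 h
    exact .head (step_comp f g K v) ((run_of_mem_eval g h₁ _).trans
      (.head (step_compSt f K w₁) (run_of_mem_eval f h₂ _)))
  | .case f g, v, w, h, K => by
    refine .head (step_case f g K v) ?_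
    simp only [Code.case_eval] at h
    generalize v.headI = n at h ⊢
    cases n with
    | zero => exact run_of_mem_eval f h K
    | succ n => exact run_of_mem_eval g h K
  | .fix f, v, w, h, K => by
    refine PFun.fixInduction (C := fun v => ReflTransGen (RootStep machineRules) (nrmSt f.fix K v)
      (retSt K w)) h fun v hv ih => ?_
    obtain ⟨u, hu, hw⟩ := mem_eval_fix.1 hv
    refine .head (step_fix f K v) ((run_of_mem_eval f hu _).trans (.head (step_fixSt f K u) ?_))
    split_ifs at hw ⊢ with h0
    · rw [hw]
    · exact ih _ ((Part.mem_map_iff _).2 ⟨u, hu, by rw [if_neg h0]⟩)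

/-- An interpreter state reaches a stuck state within `n` steps. -/
def HaltsIn : ℕ → CTree → Prop
  | 0, s => ∀ s', ¬ RootStep machineRules s s'
  | n + 1, s => ∀ s', RootStep machineRules s s' → HaltsIn n s'

theorem HaltsIn.step {n : ℕ} {s s' : CTree} (h : HaltsIn n s) (hs : RootStep machineRules s s') :
    ∃ m < n, HaltsIn m s' := by
  cases n with
  | zero => exact absurd hs (h s')
  | succ n => exact ⟨n, n.lt_succ_self, h s' hs⟩

theorem HaltsIn.of_step {n : ℕ} {s s' : CTree} (h : HaltsIn n s') (hs : RootStep machineRules s s') :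
    HaltsIn (n + 1) s := fun _ ht =>
  orthogonal_machineRules.functional hs ht ▸ h

theorem HaltsIn.eval (n : ℕ) : ∀ {c : Code} {K : CTree} {v : List ℕ}, HaltsIn n (nrmSt c K v) →
    ∃ w ∈ c.eval v, ∃ m < n, HaltsIn m (retSt K w) := by
  induction n using Nat.strong_induction_on with
  | _ n ih =>
    intro c K v h
    cases c with
    | zero' =>
      obtain ⟨m, hm, h⟩ := h.step (step_zero K v)
      exact ⟨_, by simp [Code.eval], m, hm, h⟩
    | succ =>
      obtain ⟨m, hm, h⟩ := h.step (step_succ K v)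
      exact ⟨_, by simp [Code.eval], m, hm, h⟩
    | tail =>
      obtain ⟨m, hm, h⟩ := h.step (step_tail K v)
      exact ⟨_, by simp [Code.eval], m, hm, h⟩
    | cons f g =>
      obtain ⟨m, hm, h⟩ := h.step (step_cons f g K v)
      obtain ⟨w₁, h₁, m₁, hm₁, h⟩ := ih m hm h
      obtain ⟨m₂, hm₂, h⟩ := h.step (step_consSt₁ g K v w₁)
      obtain ⟨w₂, h₂, m₃, hm₃, h⟩ := ih m₂ (by omega) h
      obtain ⟨m₄, hm₄, h⟩ := h.step (step_consSt₂ K w₁ w₂)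
      exact ⟨_, mem_eval_cons.2 ⟨w₁, h₁, w₂, h₂, rfl⟩, m₄, by omega, h⟩
    | comp f g =>
      obtain ⟨m, hm, h⟩ := h.step (step_comp f g K v)
      obtain ⟨w₁, h₁, m₁, hm₁, h⟩ := ih m hm h
      obtain ⟨m₂, hm₂, h⟩ := h.step (step_compSt f K w₁)
      obtain ⟨w₂, h₂, m₃, hm₃, h⟩ := ih m₂ (by omega) h
      exact ⟨w₂, mem_eval_comp.2 ⟨w₁, h₁, h₂⟩, m₃, by omega, h⟩
    | case f g =>
      obtain ⟨m, hm, h⟩ := h.step (step_case f g K v)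
      simp only [Code.case_eval]
      generalize v.headI = n at h ⊢
      cases n with
      | zero =>
        obtain ⟨w, hw, m', hm', h⟩ := ih m hm h
        exact ⟨w, hw, m', by omega, h⟩
      | succ n =>
        obtain ⟨w, hw, m', hm', h⟩ := ih m hm h
        exact ⟨w, hw, m', by omega, h⟩
    | fix f =>
      obtain ⟨m, hm, h⟩ := h.step (step_fix f K v)
      obtain ⟨w₁, h₁, m₁, hm₁, h⟩ := ih m hm h
      obtain ⟨m₂, hm₂, h⟩ := h.step (step_fixSt f K w₁)
      split_ifs at h with h0
      · exact ⟨_, mem_eval_fix.2 ⟨w₁, h₁, by rw [if_pos h0]⟩, m₂, by omega, h⟩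
      · obtain ⟨w, hw, m₃, hm₃, h⟩ := ih m₂ (by omega) h
        exact ⟨w, mem_eval_fix.2 ⟨w₁, h₁, by rwa [if_neg h0]⟩, m₃, by omega, h⟩

theorem haltsIn_retSt_leaf (w : List ℕ) : HaltsIn 0 (retSt .leaf w) := by
  rintro s' ⟨r, hr, σ, h, -⟩
  have : ∀ r ∈ machineRules, Pat.clash (.pair (.pair .leaf .leaf) (.pair .leaf (.var 0))) r.1 = true := by
    decide
  exact Pat.inst_ne_of_clash (σ := fun _ => (Pat.list w).tree) (this r hr) h

theorem HaltsIn.of_run {n : ℕ} {s s' : CTree} (hr : ReflTransGen (RootStep machineRules) s s')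
    (h : HaltsIn n s') : ∃ m, HaltsIn m s := by
  induction hr using ReflTransGen.head_induction_on with
  | refl => exact ⟨n, h⟩
  | head hs _ ih => exact ih.imp' Nat.succ fun m hm => hm.of_step hs

theorem exists_haltsIn_iff {c : Code} {v : List ℕ} :
    (∃ n, HaltsIn n (nrmSt c .leaf v)) ↔ (c.eval v).Dom := by
  constructor
  · rintro ⟨n, h⟩
    obtain ⟨w, hw, -⟩ := h.eval n
    exact Part.dom_iff_mem.2 ⟨w, hw⟩
  · intro h
    obtain ⟨w, hw⟩ := Part.dom_iff_mem.1 h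
    exact (haltsIn_retSt_leaf w).of_run (run_of_mem_eval c hw .leaf)

theorem exists_universal_code : ∃ U : Code, ∀ (c : Nat.Partrec.Code) (x : ℕ),
    (U.eval [Encodable.encode c, x]).Dom ↔ (c.eval x).Dom := by
  have h : Nat.Partrec' fun v : List.Vector ℕ 2 =>
      (Denumerable.ofNat Nat.Partrec.Code v.head).eval v.tail.head :=
    (Nat.Partrec'.part_iff₂ (f := fun a b => (Denumerable.ofNat Nat.Partrec.Code a).eval b)).2
      (Nat.Partrec.Code.eval_part.comp ((Computable.ofNat _).comp Computable.fst) Computable.snd)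
  obtain ⟨U, hU⟩ := Code.exists_code h
  refine ⟨U, fun c x => ?_⟩
  have hx : U.eval [Encodable.encode c, x] = pure <$>
      (Denumerable.ofNat Nat.Partrec.Code (Encodable.encode c)).eval x :=
    hU (Encodable.encode c ::ᵥ x ::ᵥ .nil)
  rw [Denumerable.ofNat_encode] at hx
  exact iff_of_eq (congrArg Part.Dom hx)

end Machine

section Control

open Relation Turing.ToPartrec

open Pat in
/-- A step of the interpreter, consuming one unit of fuel. -/
def fuelRule (r : Pat × Pat) : Pat × Pat :=
  (running (var 10) (var 11) r.1 (succ (var 12)), running (var 10) (var 11) r.2 (var 12))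

namespace Pat

/-- The initial state of the interpreter for code `U` on the numbers `e` and `x`. -/
def init (U : Code) (e : ℕ) (x : Pat) : Pat := nrm (code U) leaf (pair (num e) (pair x leaf))

end Pat

open Pat in
/-- Rules that run the interpreter in rounds with growing fuel, checking in between that
the input is a numeral. -/
def controlRules (U : Code) (e : ℕ) : List (Pat × Pat) :=
  [(running (var 0) (var 1) (var 2) leaf, checking (var 0) (var 1) (var 0)),
   (checking (var 0) (var 1) (succ (var 2)), checking (var 0) (var 1) (var 2)),
   (checking (var 0) (var 1) leaf, running (var 0) (succ (var 1)) (init U e (var 0)) (var 1))] ++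
  machineRules.map fuelRule

namespace Pat

theorem vs_num : ∀ n, (num n).vs = []
  | 0 => rfl
  | n + 1 => vs_num n

theorem vs_code : ∀ c, (code c).vs = []
  | .zero' => rfl
  | .succ => rfl
  | .tail => rfl
  | .cons a b => congrArg₂ (· ++ ·) (vs_code a) (vs_code b)
  | .comp a b => congrArg₂ (· ++ ·) (vs_code a) (vs_code b)
  | .case a b => congrArg₂ (· ++ ·) (vs_code a) (vs_code b)
  | .fix a => vs_code a

theorem inst_eq_tree {p : Pat} (h : p.vs = []) (σ : ℕ → CTree) : p.inst σ = p.tree :=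
  inst_congr fun x hx => by simp [h] at hx

end Pat

theorem orthogonal_controlRules (U : Code) (e : ℕ) : Orthogonal (controlRules U e) where
  clash := by
    have : ((controlRules .zero' 0).map Prod.fst).Pairwise
      fun p q => p.clash q = true ∧ q.clash p = true := by decide
    exact this
  vars := by
    intro r hr
    rcases List.mem_append.1 hr with hr | hr
    · simp only [List.mem_cons, List.not_mem_nil, or_false] at hr
      rcases hr with rfl | rfl | rfl <;>
        simp [Pat.running, Pat.checking, Pat.succ, Pat.init, Pat.nrm, Pat.vs, Pat.vs_num, Pat.vs_code]
    · have : ∀ r ∈ machineRules.map fuelRule, (∀ x ∈ r.2.vs, x ∈ r.1.vs) := by decide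
      exact this r hr

namespace CTree

def succ (a : CTree) : CTree := .pair .leaf a

def num : ℕ → CTree
  | 0 => .leaf
  | n + 1 => .succ (num n)

def running (x k s r : CTree) : CTree := .pair .leaf (.pair x (.pair k (.pair s r)))

def checking (x k y : CTree) : CTree := .pair (.pair .leaf .leaf) (.pair x (.pair k y))

def init (U : Code) (e : ℕ) (x : CTree) : CTree :=
  nrm (Pat.code U).tree .leaf (.pair (Pat.num e).tree (.pair x .leaf))

end CTree

theorem Pat.tree_num : ∀ n, (Pat.num n).tree = CTree.num n
  | 0 => rfl
  | n + 1 => congrArg CTree.succ (Pat.tree_num n)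

open CTree in
/-- The one-step relation of `controlRules`. -/
inductive ControlStep (U : Code) (e : ℕ) : CTree → CTree → Prop
  | halt (x k s : CTree) : ControlStep U e (running x k s .leaf) (checking x k x)
  | check (x k y : CTree) : ControlStep U e (checking x k (succ y)) (checking x k y)
  | start (x k : CTree) : ControlStep U e (checking x k .leaf) (running x (succ k) (init U e x) k)
  | run (x k r : CTree) {s s' : CTree} (h : RootStep machineRules s s') :
      ControlStep U e (running x k s (succ r)) (running x k s' r)

variable {U : Code} {e : ℕ} {x k : CTree}

theorem rootStep_controlRules : RootStep (controlRules U e) = ControlStep U e := by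
  ext a b
  constructor
  · rintro ⟨r, hr, σ, rfl, rfl⟩
    simp only [controlRules, List.cons_append, List.nil_append, List.mem_cons, List.mem_map] at hr
    rcases hr with rfl | rfl | rfl | ⟨r, hr, rfl⟩
    · exact .halt _ _ _
    · exact .check _ _ _
    · have := ControlStep.start (U := U) (e := e) (σ 0) (σ 1)
      rw [CTree.init, ← Pat.inst_eq_tree (Pat.vs_code U) σ, ← Pat.inst_eq_tree (Pat.vs_num e) σ] at this
      exact this
    · exact .run _ _ _ ⟨r, hr, σ, rfl, rfl⟩
  · rintro (⟨x, k, s⟩ | ⟨x, k, y⟩ | ⟨x, k⟩ | ⟨x, k, r, ⟨p, hp, σ, rfl, rfl⟩⟩)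
    · exact rootStep_get 0 (by simp [controlRules]) [x, k, s]
    · exact rootStep_get 1 (by simp [controlRules]) [x, k, y]
    · have := rootStep_get (rs := controlRules U e) 2 (by simp [controlRules]) [x, k]
      rw [CTree.init, ← Pat.inst_eq_tree (Pat.vs_code U) fun i => [x, k].getD i .leaf,
        ← Pat.inst_eq_tree (Pat.vs_num e) fun i => [x, k].getD i .leaf]
      exact this
    · let τ : ℕ → CTree := fun i => if i < 10 then σ i else [x, k, r].getD (i - 10) .leaf
      have hv : ∀ p ∈ machineRules, ∀ i ∈ p.1.vs ++ p.2.vs, i < 10 := by decide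
      have h1 : p.1.inst σ = p.1.inst τ := Pat.inst_congr fun i hi =>
        (if_pos (hv p hp i (List.mem_append_left _ hi))).symm
      have h2 : p.2.inst σ = p.2.inst τ := Pat.inst_congr fun i hi =>
        (if_pos (hv p hp i (List.mem_append_right _ hi))).symm
      rw [h1, h2]
      exact ⟨fuelRule p, List.mem_append_right _ (List.mem_map_of_mem hp), τ, rfl, rfl⟩

open CTree

theorem acc_checking (hA : Acc (flip (ControlStep U e)) (checking x k .leaf)) :
    ∀ y, Acc (flip (ControlStep U e)) (checking x k y)
  | .leaf => hA
  | .pair a b => ⟨_, fun c hc => by cases hc; exact acc_checking hA b⟩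
  | .cfg a => ⟨_, fun c hc => by cases hc⟩

theorem acc_checking_or : ∀ y, Acc (flip (ControlStep U e)) (checking x k y) ∨ ∃ n, y = num n
  | .leaf => .inr ⟨0, rfl⟩
  | .pair a b => by
    by_cases h : ∃ n, CTree.pair a b = num n
    · exact .inr h
    · refine .inl ⟨_, fun c hc => ?_⟩
      cases hc
      exact (acc_checking_or b).resolve_right fun ⟨n, hn⟩ => h ⟨n + 1, congrArg succ hn⟩
  | .cfg a => .inl ⟨_, fun c hc => by cases hc⟩

theorem acc_running (hA : Acc (flip (ControlStep U e)) (checking x k x)) :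
    ∀ r s, Acc (flip (ControlStep U e)) (running x k s r)
  | .leaf, s => ⟨_, fun c hc => by cases hc; exact hA⟩
  | .pair a b, s => ⟨_, fun c hc => by cases hc; exact acc_running hA b _⟩
  | .cfg a, s => ⟨_, fun c hc => by cases hc⟩

theorem acc_running_of_haltsIn (r : CTree) : ∀ (m : ℕ) {s : CTree}, HaltsIn m s →
    Acc (flip (ControlStep U e)) (running x k s (succ^[m + 1] r))
  | 0, s, h => ⟨_, fun c hc => by cases hc with | run _ _ _ hs => exact absurd hs (h _)⟩
  | m + 1, s, h => by
    rw [Function.iterate_succ_apply']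
    exact ⟨_, fun c hc => by
      cases hc with | run _ _ _ hs => exact acc_running_of_haltsIn r m (h _ hs)⟩

theorem acc_checking_leaf_of_haltsIn {m : ℕ} (h : HaltsIn m (init U e x)) (k : CTree) :
    Acc (flip (ControlStep U e)) (checking x k .leaf) := by
  suffices ∀ d j, j + d = m + 1 → ∀ k, Acc (flip (ControlStep U e)) (checking x (succ^[j] k) .leaf) from
    this (m + 1) 0 (Nat.zero_add _) k
  intro d
  induction d with
  | zero =>
    rintro j rfl k
    refine ⟨_, fun c hc => ?_⟩
    generalize hk : succ^[m + 1] k = k' at hc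
    cases hc
    exact hk ▸ acc_running_of_haltsIn k m h
  | succ d ih =>
    intro j hj k
    refine ⟨_, fun c hc => ?_⟩
    cases hc
    have := ih (j + 1) (by omega) k
    rw [Function.iterate_succ_apply'] at this
    exact acc_running (acc_checking this _) _ _

theorem acc_controlStep (h : ∀ n, ∃ m, HaltsIn m (init U e (num n))) (a : CTree) :
    Acc (flip (ControlStep U e)) a := by
  have hleaf : ∀ x k, Acc (flip (ControlStep U e)) (checking x k .leaf) := by
    intro x k
    by_cases hx : ∃ n, x = num n
    · obtain ⟨n, rfl⟩ := hx
      exact acc_checking_leaf_of_haltsIn (h n).choose_spec k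
    · refine ⟨_, fun c hc => ?_⟩
      cases hc
      exact acc_running ((acc_checking_or x).resolve_right hx) _ _
  refine ⟨_, fun b hb => ?_⟩
  cases hb with
  | halt => exact acc_checking (hleaf _ _) _
  | check => exact acc_checking (hleaf _ _) _
  | start => exact acc_running (acc_checking (hleaf _ _) _) _ _
  | run => exact acc_running (acc_checking (hleaf _ _) _) _ _

theorem run_checking : ∀ n, ReflTransGen (ControlStep U e) (checking x k (num n)) (checking x k .leaf)
  | 0 => .refl
  | n + 1 => .head (.check _ _ _) (run_checking n)

theorem exists_run_of_not_haltsIn : ∀ (r : ℕ) {s : CTree}, ¬ HaltsIn r s →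
    ∃ s', ReflTransGen (ControlStep U e) (running x k s (num r)) (running x k s' .leaf)
  | 0, s, _ => ⟨s, .refl⟩
  | r + 1, s, h => by
    obtain ⟨s', hs, h'⟩ : ∃ s', RootStep machineRules s s' ∧ ¬ HaltsIn r s' := by
      simpa [HaltsIn] using h
    obtain ⟨t, ht⟩ := exists_run_of_not_haltsIn r h'
    exact ⟨t, .head (.run _ _ _ hs) ht⟩

theorem run_rounds {n : ℕ} (h : ∀ m, ¬ HaltsIn m (init U e (num n))) : ∀ k,
    ReflTransGen (ControlStep U e) (checking (num n) .leaf .leaf) (checking (num n) (num k) .leaf)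
  | 0 => .refl
  | k + 1 => by
    obtain ⟨s, hs⟩ := exists_run_of_not_haltsIn (x := num n) (k := num (k + 1)) (U := U) (e := e) k (h k)
    exact (run_rounds h k).trans (.head (.start _ _) (hs.trans (.head (.halt _ _ _) (run_checking n))))

theorem haltsIn_init_iff {n : ℕ} :
    (∃ m, HaltsIn m (init U e (num n))) ↔ (U.eval [e, n]).Dom := by
  rw [← exists_haltsIn_iff, CTree.init, ← Pat.tree_num n]
  exact Iff.rfl

/-- The problem instance that encodes the computations of `U` on the pairs `(e, x)`. -/
def haltingInstance (U : Code) (e : ℕ) : TRSInstance := ⟨3, treeAr, cfgRules (controlRules U e)⟩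

theorem CTree.collapse_num : ∀ n, (num n).collapse = num n
  | 0 => rfl
  | n + 1 => congrArg succ (collapse_num n)

theorem CTree.num_injective : Function.Injective num
  | 0, 0, _ => rfl
  | _ + 1, _ + 1, h => congrArg Nat.succ (num_injective (CTree.pair.inj h).2)

theorem Tm.vars_cfg {V : Type} (a : Tm (Fin 3) treeAr V) : (Tm.cfg a).vars = a.vars := by
  simp only [Tm.cfg, Tm.vars]
  exact Set.iUnion_eq_const (ι := Fin 1) fun i : Fin 1 => by fin_cases i; rfl

theorem allTermTerminates_haltingInstance :
    AllTermTerminates (haltingInstance U e) ↔ ∀ n, (U.eval [e, n]).Dom := by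
  have ho := orthogonal_controlRules U e
  have hv : ∀ r ∈ cfgRules (controlRules U e), r.2.vars ⊆ r.1.vars := by
    intro r hr
    obtain ⟨p, hp, rfl⟩ := List.mem_map.1 hr
    simp only [Tm.vars_cfg]
    intro i hi
    exact (Pat.mem_vars _).2 (ho.vars p hp ((Pat.mem_vars _).1 hi))
  rw [allTermTerminates_iff]
  constructor
  · rintro ⟨-, h⟩ n
    rw [← haltsIn_init_iff]
    by_contra! hn
    refine not_finIdx_of_family (rs := controlRules U e) (t := .cfg (checking (num n) .leaf .leaf)) num ?_ ?_ (h _)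
    · simpa only [CTree.collapse_num] using CTree.num_injective
    · intro k
      have hr := run_rounds hn k
      rw [← rootStep_controlRules] at hr
      exact (TDer.run hr Der.init).right.of_cfg.pair_right.pair_right.pair_left
  · intro h
    refine ⟨hv, fun t => ho.finIdx ?_ t⟩
    rw [rootStep_controlRules]
    exact acc_controlStep fun n => haltsIn_init_iff.2 (h n)

end Control

section Reduction

theorem Tm.toks_pair {V : Type} [Encodable V] (a b : Tm (Fin 3) treeAr V) :
    (Tm.pair a b).toks = Sum.inl 1 :: (a.toks ++ b.toks) := by
  refine congrArg (List.cons (Sum.inl 1)) ?_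
  exact (congrArg List.flatten (List.ofFn_succ (n := 1))).trans (congrArg (a.toks ++ ·) (List.append_nil _))

theorem Tm.toks_cfg {V : Type} [Encodable V] (a : Tm (Fin 3) treeAr V) :
    (Tm.cfg a).toks = Sum.inl 2 :: a.toks :=
  congrArg (List.cons (Sum.inl 2)) (List.append_nil _)

theorem primrec_toks_pair {p q : ℕ → Pat} (hp : Primrec fun e => (p e).tm.toks)
    (hq : Primrec fun e => (q e).tm.toks) : Primrec fun e => (Pat.pair (p e) (q e)).tm.toks := by
  simp only [Pat.tm, Tm.toks_pair]
  exact Primrec.list_cons.comp (Primrec.const _) (Primrec.list_append.comp hp hq)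

theorem primrec_toks_num : Primrec fun e => (Pat.num e).tm.toks := by
  refine (Primrec.nat_rec₁ (Pat.num 0).tm.toks (f := fun _ w => Sum.inl 1 :: (Pat.leaf.tm.toks ++ w))
    (Primrec.list_cons.comp (Primrec.const _) (Primrec.list_append.comp (Primrec.const _)
      Primrec.snd)).to₂).of_eq fun e => ?_
  induction e with
  | zero => rfl
  | succ e ih =>
    simp only at ih ⊢
    rw [ih]
    exact (Tm.toks_pair _ _).symm

theorem primrec_toks_init (U : Turing.ToPartrec.Code) (p : Pat) :
    Primrec fun e => (Pat.init U e p).tm.toks :=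
  primrec_toks_pair (Primrec.const _) (primrec_toks_pair (Primrec.const _)
    (primrec_toks_pair (Primrec.const _) (primrec_toks_pair primrec_toks_num (Primrec.const _))))

theorem primrec_encode_haltingInstance (U : Turing.ToPartrec.Code) :
    Primrec fun e => encode (haltingInstance U e) := by
  have hr : Primrec fun e => (Pat.running (.var 0) (.succ (.var 1)) (.init U e (.var 0)) (.var 1)).tm.toks :=
    primrec_toks_pair (Primrec.const _) (primrec_toks_pair (Primrec.const _)
      (primrec_toks_pair (Primrec.const _) (primrec_toks_pair (primrec_toks_init U _) (Primrec.const _))))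
  have hp : Primrec fun e => ((Tm.cfg (Pat.checking (.var 0) (.var 1) .leaf).tm).toks,
      (Tm.cfg (Pat.running (.var 0) (.succ (.var 1)) (.init U e (.var 0)) (.var 1)).tm).toks) := by
    refine (Primrec.const _).pair ?_
    simp only [Tm.toks_cfg]
    exact Primrec.list_cons.comp (Primrec.const _) hr
  let t (r : Pat × Pat) : List (ℕ ⊕ ℕ) × List (ℕ ⊕ ℕ) := ((Tm.cfg r.1.tm).toks, (Tm.cfg r.2.tm).toks)
  have h : Primrec fun e => (haltingInstance U e).raw :=
    (Primrec.const (List.ofFn treeAr)).pair (Primrec.list_cons.comp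
      (Primrec.const (t (.running (.var 0) (.var 1) (.var 2) .leaf, .checking (.var 0) (.var 1) (.var 0))))
      (Primrec.list_cons.comp
        (Primrec.const (t (.checking (.var 0) (.var 1) (.succ (.var 2)), .checking (.var 0) (.var 1) (.var 2))))
        (Primrec.list_cons.comp hp
          (Primrec.const ((cfgRules (machineRules.map fuelRule)).map fun r => (r.1.toks, r.2.toks))))))
  exact (primrec_code.comp h).of_eq fun e => TRSInstance.code_raw _

theorem manyOneReducible_allTermTerminates :
    ManyOneReducible (fun c : Nat.Partrec.Code => ∀ x : ℕ, (c.eval x).Dom)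
      (fun m : ℕ => ∃ inst : TRSInstance, encode inst = m ∧ AllTermTerminates inst) := by
  obtain ⟨U, hU⟩ := exists_universal_code
  refine ⟨fun c => encode (haltingInstance U (encode c)),
    ((primrec_encode_haltingInstance U).comp Primrec.encode).to_comp, fun c => ?_⟩
  simp only [encode_inj, exists_eq_left, allTermTerminates_haltingInstance, hU]

end Reduction

/-- The all-term-instance termination problem of equality saturation is Π₂-complete:
it is expressible as a `∀∃`-condition with a computable matrix, and the universal
halting problem for Turing machines many-one reduces to it. -/
theorem eqsat_all_term_instance_termination_pi2_complete :
    (∃ f : ℕ → ℕ → ℕ → Bool,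
      Computable (fun p : ℕ × ℕ × ℕ => f p.1 p.2.1 p.2.2) ∧
      ∀ m : ℕ,
        (∃ inst : TRSInstance, Encodable.encode inst = m ∧ AllTermTerminates inst) ↔
          ∀ a : ℕ, ∃ b : ℕ, f m a b = true) ∧
    ManyOneReducible (fun c : Nat.Partrec.Code => ∀ x : ℕ, (c.eval x).Dom)
      (fun m : ℕ =>
        ∃ inst : TRSInstance, Encodable.encode inst = m ∧ AllTermTerminates inst) := by
  exact ⟨exists_computable_matrix, manyOneReducible_allTermTerminates⟩
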